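/- arXiv:1801.02885 — 3 statements merged into one kernel-verified Lean document; each statement's English description precedes it below -/
import Mathlib

section
/- The set of complex numbers t₀ for which there exist polynomials A, B ∈ ℂ[X] with B ≠ 0 satisfying A² − (X − t₀)·(X⁷ − X³ − 1)·B² = 4X + 1 is finite. -/
open Polynomial

theorem ValuationSubring.exists_primitive_scaling {K : Type*} [Field K] (O : ValuationSubring K)
    (P Q : K[X])
    (h : ¬ ((∀ i, P.coeff i ∈ O) ∧ ∀ i, Q.coeff i ∈ O)) :
    ∃ c : O, c ∈ IsLocalRing.maximalIdeal O ∧ ∃ p q : O[X],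
      p.map (algebraMap O K) = C (c : K) * P ∧ q.map (algebraMap O K) = C (c : K) * Q ∧
      (p.map (IsLocalRing.residue O) ≠ 0 ∨ q.map (IsLocalRing.residue O) ≠ 0) := by
  classical
  let s : Finset K := P.support.image P.coeff ∪ Q.support.image Q.coeff
  have hP : ∀ i, P.coeff i ≠ 0 → P.coeff i ∈ s := fun i hi =>
    Finset.mem_union_left _ (Finset.mem_image_of_mem _ (mem_support_iff.2 hi))
  have hQ : ∀ i, Q.coeff i ≠ 0 → Q.coeff i ∈ s := fun i hi =>
    Finset.mem_union_right _ (Finset.mem_image_of_mem _ (mem_support_iff.2 hi))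
  obtain ⟨x, hxs, hxO⟩ : ∃ x ∈ s, x ∉ O := by
    by_contra! hc
    refine h ⟨fun i => ?_, fun i => ?_⟩
    · by_cases hi : P.coeff i = 0
      · rw [hi]; exact O.zero_mem
      · exact hc _ (hP i hi)
    · by_cases hi : Q.coeff i = 0
      · rw [hi]; exact O.zero_mem
      · exact hc _ (hQ i hi)
  obtain ⟨m, hms, hm⟩ := s.exists_max_image O.valuation ⟨x, hxs⟩
  have hm1 : 1 < O.valuation m := by
    refine lt_of_lt_of_le ?_ (hm x hxs)
    rw [← not_le, O.valuation_le_one_iff]; exact hxO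
  have hm0 : m ≠ 0 := by rintro rfl; simp at hm1
  have hc1 : O.valuation m⁻¹ < 1 := by
    rw [map_inv₀]; exact inv_lt_one_of_one_lt₀ hm1
  let c : O := ⟨m⁻¹, (O.valuation_le_one_iff _).1 hc1.le⟩
  have key : ∀ y, (y = 0 ∨ y ∈ s) → m⁻¹ * y ∈ O := by
    rintro y (rfl | hy)
    · simp [O.zero_mem]
    · rw [← O.valuation_le_one_iff, map_mul, map_inv₀]
      exact inv_mul_le_one_of_le₀ (hm y hy) zero_le
  have lift : ∀ R : K[X], (∀ i, R.coeff i ≠ 0 → R.coeff i ∈ s) →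
      ∃ p : O[X], p.map (algebraMap O K) = C (c : K) * R := by
    intro R hR
    have : C (c : K) * R ∈ lifts (algebraMap O K) := by
      rw [lifts_iff_coeff_lifts]
      intro i
      rw [coeff_C_mul]
      refine ⟨⟨_, key _ ?_⟩, rfl⟩
      by_cases hi : R.coeff i = 0
      · exact Or.inl hi
      · exact Or.inr (hR i hi)
    exact this
  obtain ⟨p, hp⟩ := lift P hP
  obtain ⟨q, hq⟩ := lift Q hQ
  have one : ∀ (R : K[X]) (r : O[X]) (i : ℕ), r.map (algebraMap O K) = C (c : K) * R →
      R.coeff i = m → r.map (IsLocalRing.residue O) ≠ 0 := by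
    intro R r i hr hi h0
    have h1 : ((r.coeff i : O) : K) = 1 := by
      have := congrArg (fun z => coeff z i) hr
      simp only [coeff_map, coeff_C_mul, hi] at this
      exact this.trans (inv_mul_cancel₀ hm0)
    have h2 : r.coeff i = 1 := Subtype.ext h1
    have := congrArg (fun z => coeff z i) h0
    simp [coeff_map, h2] at this
  refine ⟨c, (O.valuation_lt_one_iff c).2 hc1, p, q, hp, hq, ?_⟩
  rcases Finset.mem_union.1 hms with hms | hms
  · obtain ⟨i, -, hi⟩ := Finset.mem_image.1 hms
    exact Or.inl (one P p i hp hi)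
  · obtain ⟨i, -, hi⟩ := Finset.mem_image.1 hms
    exact Or.inr (one Q q i hq hi)

/-- A solution of a quadratic equation with integral coefficients over a valued field is integral
or yields a nonzero solution of the homogeneous equation over the residue field. -/
theorem ValuationSubring.integral_or_residue {K : Type*} [Field K] (O : ValuationSubring K)
    (S U N R : O[X]) (P Q : K[X])
    (h : P ^ 2 + S.map (algebraMap O K) * P * Q + U.map (algebraMap O K) * P
      - N.map (algebraMap O K) * Q ^ 2 = R.map (algebraMap O K)) :
    (∃ p q : O[X], p.map (algebraMap O K) = P ∧ q.map (algebraMap O K) = Q ∧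
      p ^ 2 + S * p * q + U * p - N * q ^ 2 = R) ∨
    ∃ p q : (IsLocalRing.ResidueField O)[X], (p ≠ 0 ∨ q ≠ 0) ∧
      p ^ 2 + S.map (IsLocalRing.residue O) * p * q
        - N.map (IsLocalRing.residue O) * q ^ 2 = 0 := by
  have inj : Function.Injective (Polynomial.map (algebraMap O K)) :=
    map_injective _ Subtype.val_injective
  by_cases hi : (∀ i, P.coeff i ∈ O) ∧ ∀ i, Q.coeff i ∈ O
  · left
    have hP : P ∈ lifts (algebraMap O K) := by
      rw [lifts_iff_coeff_lifts]; exact fun i => ⟨⟨_, hi.1 i⟩, rfl⟩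
    have hQ : Q ∈ lifts (algebraMap O K) := by
      rw [lifts_iff_coeff_lifts]; exact fun i => ⟨⟨_, hi.2 i⟩, rfl⟩
    obtain ⟨p, rfl⟩ := hP
    obtain ⟨q, rfl⟩ := hQ
    refine ⟨p, q, rfl, rfl, inj ?_⟩
    simpa using h
  · right
    obtain ⟨c, hc, p, q, hp, hq, hpq⟩ := O.exists_primitive_scaling P Q hi
    refine ⟨_, _, hpq, ?_⟩
    have e : p ^ 2 + S * p * q + C c * U * p - N * q ^ 2 = C c ^ 2 * R := by
      apply inj
      simp only [Polynomial.map_sub, Polynomial.map_add, Polynomial.map_mul, Polynomial.map_pow,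
        hp, hq, map_C]
      rw [← h]
      change _ = (C (c : K)) ^ 2 * _
      change (C (c : K) * P) ^ 2 + _ * (C (c : K) * P) * (C (c : K) * Q)
        + C (c : K) * _ * (C (c : K) * P) - _ * (C (c : K) * Q) ^ 2 = _
      ring
    have := congrArg (Polynomial.map (IsLocalRing.residue O)) e
    have hc0 : IsLocalRing.residue O c = 0 := (IsLocalRing.residue_eq_zero_iff c).2 hc
    simpa [hc0] using this

theorem no_solution_of_two_nonunit {K : Type*} [Field K] (O : ValuationSubring K)
    (h2 : (2 : K) ≠ 0) (h2m : (2 : O) ∈ IsLocalRing.maximalIdeal O) {s : K} (hs : s ≠ 0)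
    (hsO : s⁻¹ ∈ O) (a b : K[X])
    (h : a ^ 2 - (X - C (s ^ 2)) * (X ^ 7 - X ^ 3 - 1) * b ^ 2 = 1 + 4 * X) : False := by
  let u : O := ⟨s⁻¹, hsO⟩ ^ 2
  have hu : ((u : O) : K) = (s⁻¹) ^ 2 := rfl
  have e22 : (C (2⁻¹ : K)) * 2 = 1 := by
    rw [← C_ofNat, ← C_mul, inv_mul_cancel₀ h2, C_1]
  have ess : (C (s⁻¹ : K)) * C s = 1 := by
    rw [← C_mul, inv_mul_cancel₀ hs, C_1]
  have key := O.integral_or_residue 0 1 ((C u * X - 1) * (X ^ 7 - X ^ 3 - 1)) X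
    (C 2⁻¹ * (a - 1)) (C 2⁻¹ * C s * b) (by
      simp only [Polynomial.map_zero, Polynomial.map_one, Polynomial.map_mul, Polynomial.map_sub,
        map_C, map_X, Polynomial.map_pow]
      change _ - (C ((u : O) : K) * _ - 1) * _ * _ = _
      rw [hu]
      simp only [C_pow] at h ⊢
      linear_combination (exp := 1) (C (2⁻¹ : K)) ^ 2 * h +
        X * (C 2⁻¹ * 2 + 1) * e22 - (C 2⁻¹ * (a-1)) * e22
        - C 2⁻¹ ^ 2 * X * (X ^ 7 - X ^ 3 - 1) * b ^ 2 * (C s⁻¹ * C s + 1) * ess)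
  set k := IsLocalRing.ResidueField O
  have h20 : (2 : k[X]) = 0 := by
    have : (2 : k) = 0 := by
      have := (IsLocalRing.residue_eq_zero_iff (2 : O)).2 h2m
      exact (map_ofNat (IsLocalRing.residue O) 2).symm.trans this
    rw [← C_ofNat, this, C_0]
  set w : k := IsLocalRing.residue O u
  have hd : derivative ((C w * X - 1) * (X ^ 7 - X ^ 3 - 1) : k[X]) = C w + X ^ 6 + X ^ 2 := by
    simp only [derivative_mul, derivative_sub, derivative_X, derivative_C, derivative_one,
      derivative_X_pow, map_natCast]
    push_cast
    linear_combination (4 * C w * X ^ 7 - 2 * C w * X ^ 3 - C w - 4 * X ^ 6 + X ^ 2) * h20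
  have hdeg : (C w + X ^ 6 + X ^ 2 : k[X]).natDegree = 6 := by compute_degree!
  have hne : (C w + X ^ 6 + X ^ 2 : k[X]) ≠ 0 := by
    intro h0; rw [h0] at hdeg; simp at hdeg
  rcases key with ⟨p, q, -, -, e⟩ | ⟨p, q, hpq, e⟩
  · have e := congrArg (Polynomial.map (IsLocalRing.residue O)) e
    simp only [Polynomial.map_zero, Polynomial.map_one, Polynomial.map_mul, Polynomial.map_sub,
        map_C, map_X, Polynomial.map_pow, Polynomial.map_add] at e
    set p := p.map (IsLocalRing.residue O)
    set q := q.map (IsLocalRing.residue O)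
    change p ^ 2 + 0 * p * q + 1 * p - (C w * X - 1) * (X ^ 7 - X ^ 3 - 1) * q ^ 2 = X at e
    have e' := congrArg derivative e
    rw [derivative_sub, derivative_mul, hd] at e'
    simp only [derivative_add, derivative_pow, derivative_X, map_natCast, zero_mul,
      one_mul, add_zero] at e'
    push_cast at e'
    simp only [h20, zero_mul, mul_zero, zero_add, add_zero] at e'
    have hpp : ∀ r : k[X], 1 ≤ r.natDegree → (r ^ 2 + r).natDegree = 2 * r.natDegree := by
      intro r hr
      rw [natDegree_add_eq_left_of_natDegree_lt, natDegree_pow]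
      rw [natDegree_pow]; omega
    by_cases hq : q = 0
    · have e1 : p ^ 2 + p = X := by rw [hq] at e; linear_combination e
      have : (p ^ 2 + p).natDegree = 1 := by rw [e1, natDegree_X]
      by_cases hp : 1 ≤ p.natDegree
      · rw [hpp p hp] at this; omega
      · rw [eq_C_of_natDegree_eq_zero (by omega : p.natDegree = 0), ← C_pow, ← C_add,
          natDegree_C] at this
        omega
    · have e2 : derivative p = (C w + X ^ 6 + X ^ 2) * q ^ 2 + 1 := by
        linear_combination e'
      have d2 : (derivative p).natDegree = 6 + 2 * q.natDegree := by
        rw [e2, natDegree_add_eq_left_of_natDegree_lt, natDegree_mul hne (pow_ne_zero 2 hq), hdeg,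
          natDegree_pow]
        rw [natDegree_mul hne (pow_ne_zero 2 hq), hdeg]; simp
      have d3 := natDegree_derivative_le p
      have e3 : p ^ 2 + p = (C w * X - 1) * (X ^ 7 - X ^ 3 - 1) * q ^ 2 + X := by
        linear_combination e
      have d4 : ((C w * X - 1) * (X ^ 7 - X ^ 3 - 1) * q ^ 2 + X).natDegree
          ≤ 8 + 2 * q.natDegree := by
        compute_degree; omega
      rw [← e3, hpp p (by omega)] at d4
      omega
  · simp only [Polynomial.map_zero, Polynomial.map_one, Polynomial.map_mul, Polynomial.map_sub,
        map_C, map_X, Polynomial.map_pow] at e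
    change p ^ 2 + 0 * p * q - (C w * X - 1) * (X ^ 7 - X ^ 3 - 1) * q ^ 2 = 0 at e
    have e' := congrArg derivative e
    rw [derivative_sub, derivative_mul (g := q ^ 2), hd] at e'
    simp only [derivative_pow, map_natCast, zero_mul,
      derivative_zero, add_zero] at e'
    push_cast at e'
    simp only [h20, zero_mul, mul_zero, add_zero, zero_sub, neg_eq_zero] at e'
    have hq : q = 0 := by simpa [hne] using e'
    have hp : p = 0 := by simpa [hq] using e
    simp [hp, hq] at hpq

theorem seven_le_natDegree_sq_add {k : Type*} [Field k] (p : k[X]) {q : k[X]} (hq : q ≠ 0) :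
    7 ≤ (p ^ 2 + (X ^ 7 - X ^ 3 - 1) * q ^ 2).natDegree := by
  have hf : (X ^ 7 - X ^ 3 - 1 : k[X]).natDegree = 7 := by compute_degree!
  have hf0 : (X ^ 7 - X ^ 3 - 1 : k[X]) ≠ 0 := by intro h; rw [h] at hf; simp at hf
  have h1 : ((X ^ 7 - X ^ 3 - 1) * q ^ 2).natDegree = 7 + 2 * q.natDegree := by
    rw [natDegree_mul hf0 (pow_ne_zero 2 hq), hf, natDegree_pow]
  have h2 : (p ^ 2).natDegree = 2 * p.natDegree := natDegree_pow _ _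
  rcases lt_or_gt_of_ne (show (p ^ 2).natDegree ≠ ((X ^ 7 - X ^ 3 - 1) * q ^ 2).natDegree by
    omega) with h | h
  · rw [natDegree_add_eq_right_of_natDegree_lt h]; omega
  · rw [natDegree_add_eq_left_of_natDegree_lt h]; omega

theorem not_linear_mul_sq {k : Type*} [Field k] (t : k) (g : k[X]) :
    (X ^ 7 - X ^ 3 - 1 : k[X]) ≠ (X - C t) * g ^ 2 := by
  intro h
  have hf : (X ^ 7 - X ^ 3 - 1 : k[X]).natDegree = 7 := by compute_degree!
  have hg0 : g ≠ 0 := by rintro rfl; rw [h] at hf; simp at hf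
  have hg : g.natDegree = 3 := by
    rw [h, natDegree_mul (X_sub_C_ne_zero t) (pow_ne_zero 2 hg0), natDegree_X_sub_C,
      natDegree_pow] at hf
    omega
  have d1 : g ∣ X ^ 7 - X ^ 3 - 1 := h ▸ (dvd_pow_self g two_ne_zero).mul_left _
  have d2 : g ∣ X ^ 2 * (7 * X ^ 4 - 3) := by
    have e : (X ^ 2 * (7 * X ^ 4 - 3) : k[X]) = derivative (X ^ 7 - X ^ 3 - 1) := by
      simp only [derivative_sub, derivative_X_pow, derivative_one, map_natCast]
      push_cast; ring
    rw [e, h, derivative_mul, derivative_pow]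
    refine dvd_add ((dvd_pow_self g two_ne_zero).mul_left _) (Dvd.dvd.mul_left ?_ _)
    simp only [Nat.add_one_sub_one, pow_one]
    exact (dvd_mul_left g _).mul_right _
  have cop : IsCoprime g (X ^ 2) := by
    obtain ⟨r, hr⟩ := d1
    exact ⟨-r, X ^ 5 - X, by linear_combination hr⟩
  have d3 : g ∣ 7 * X ^ 4 - 3 := cop.dvd_of_dvd_mul_left d2
  have d4 : g ∣ 49 * X + 12 := by
    have e : (49 * X + 12 : k[X]) =
        (7 * X) * (X ^ 3 * (7 * X ^ 4 - 3) - 7 * (X ^ 7 - X ^ 3 - 1)) - 4 * (7 * X ^ 4 - 3) := by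
      ring
    rw [e]
    exact dvd_sub ((dvd_sub (d3.mul_left _) (d1.mul_left _)).mul_left _) (d3.mul_left _)
  have z : (49 * X + 12 : k[X]) = 0 := by
    by_contra hne
    have := natDegree_le_of_dvd d4 hne
    have : (49 * X + 12 : k[X]).natDegree ≤ 1 := by compute_degree
    omega
  have z0 := congrArg (eval 0) z
  have z1 := congrArg (eval 1) z
  simp at z0 z1
  exact one_ne_zero (by linear_combination z1 - 5 * z0 : (1 : k) = 0)

theorem mem_of_two_unit {K : Type*} [Field K] (O : ValuationSubring K)
    (h2m : (2 : O) ∉ IsLocalRing.maximalIdeal O) (s : K) (a b : K[X])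
    (h : a ^ 2 - (X - C (s ^ 2)) * (X ^ 7 - X ^ 3 - 1) * b ^ 2 = 1 + 4 * X) :
    s ^ 2 ∈ O ∧ ∀ i, b.coeff i ∈ O := by
  set k := IsLocalRing.ResidueField O
  have h2k : (2 : k) ≠ 0 := by
    intro h0
    exact h2m ((IsLocalRing.residue_eq_zero_iff (2 : O)).1
      ((map_ofNat (IsLocalRing.residue O) 2).trans h0))
  have h4 : (4 : k) ≠ 0 := by
    have : (4 : k) = 2 * 2 := by norm_num
    rw [this]; exact mul_ne_zero h2k h2k
  have hlin : (1 + 4 * X : k[X]).natDegree = 1 := by compute_degree!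
  have ht : s ^ 2 ∈ O := by
    by_contra ht
    have hs : s ∉ O := fun hs => ht (O.pow_mem hs 2)
    have hs0 : s ≠ 0 := by rintro rfl; exact hs O.zero_mem
    have hsO : s⁻¹ ∈ O := (O.mem_or_inv_mem s).resolve_left hs
    let v : O := ⟨s⁻¹, hsO⟩
    have hv : IsLocalRing.residue O v = 0 := by
      rw [IsLocalRing.residue_eq_zero_iff, O.valuation_lt_one_iff]
      change O.valuation s⁻¹ < 1
      rw [map_inv₀]
      refine inv_lt_one_of_one_lt₀ ?_
      rw [← not_le, O.valuation_le_one_iff]; exact hs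
    have ess : (C (s⁻¹ : K)) * C s = 1 := by
      rw [← C_mul, inv_mul_cancel₀ hs0, C_1]
    have key := O.integral_or_residue 0 0 ((C v ^ 2 * X - 1) * (X ^ 7 - X ^ 3 - 1)) (1 + 4 * X)
      a (C s * b) (by
        simp only [Polynomial.map_zero, Polynomial.map_one, Polynomial.map_mul, Polynomial.map_sub,
          map_C, map_X, Polynomial.map_pow, Polynomial.map_add, Polynomial.map_ofNat]
        change _ - (C (s⁻¹) ^ 2 * _ - 1) * _ * _ = _
        simp only [C_pow] at h ⊢
        linear_combination (exp := 1) h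
          - X * (X ^ 7 - X ^ 3 - 1) * b ^ 2 * (C s⁻¹ * C s + 1) * ess)
    rcases key with ⟨p, q, -, -, e⟩ | ⟨p, q, hpq, e⟩
    · have e := congrArg (Polynomial.map (IsLocalRing.residue O)) e
      simp only [Polynomial.map_zero, Polynomial.map_one, Polynomial.map_mul, Polynomial.map_sub,
          map_C, map_X, Polynomial.map_pow, Polynomial.map_add, hv, Polynomial.map_ofNat] at e
      set p := p.map (IsLocalRing.residue O)
      set q := q.map (IsLocalRing.residue O)
      have e : p ^ 2 + (X ^ 7 - X ^ 3 - 1) * q ^ 2 = 1 + 4 * X := by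
        simp only [C_0] at e
        linear_combination e
      by_cases hq : q = 0
      · have := congrArg natDegree e
        rw [hq, hlin] at this
        simp at this
      · have := seven_le_natDegree_sq_add p hq
        rw [e, hlin] at this
        omega
    · simp only [Polynomial.map_zero, Polynomial.map_one, Polynomial.map_mul, Polynomial.map_sub,
          map_C, map_X, Polynomial.map_pow, hv] at e
      have e : p ^ 2 + (X ^ 7 - X ^ 3 - 1) * q ^ 2 = 0 := by
        simp only [C_0] at e
        linear_combination e
      by_cases hq : q = 0
      · have : p = 0 := by simpa [hq] using e
        simp [this, hq] at hpq
      · have := seven_le_natDegree_sq_add p hq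
        rw [e] at this
        simp at this
  refine ⟨ht, ?_⟩
  obtain ⟨t, htt⟩ : ∃ t : O, algebraMap O K t = s ^ 2 := ⟨⟨s ^ 2, ht⟩, rfl⟩
  have key := O.integral_or_residue 0 0 ((X - C t) * (X ^ 7 - X ^ 3 - 1)) (1 + 4 * X)
      a b (by
        simp only [Polynomial.map_zero, Polynomial.map_one, Polynomial.map_mul, Polynomial.map_sub,
          map_C, map_X, Polynomial.map_pow, Polynomial.map_add, Polynomial.map_ofNat]
        rw [htt]
        linear_combination (exp := 1) h)
  rcases key with ⟨p, q, -, hq, -⟩ | ⟨p, q, hpq, e⟩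
  · intro i
    rw [← hq, coeff_map]
    exact (q.coeff i).2
  · exfalso
    simp only [Polynomial.map_zero, Polynomial.map_one, Polynomial.map_mul, Polynomial.map_sub,
          map_C, map_X, Polynomial.map_pow] at e
    set τ := IsLocalRing.residue O t
    have e : p ^ 2 = (X - C τ) * (X ^ 7 - X ^ 3 - 1) * q ^ 2 := by linear_combination e
    by_cases hq : q = 0
    · have : p = 0 := by simpa [hq] using e
      simp [this, hq] at hpq
    have hd : q ∣ p :=
      (UniqueFactorizationMonoid.pow_dvd_pow_iff_dvd two_ne_zero).1 (e ▸ dvd_mul_left _ _)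
    obtain ⟨h₀, rfl⟩ := hd
    have e1 : h₀ ^ 2 = (X - C τ) * (X ^ 7 - X ^ 3 - 1) :=
      mul_right_cancel₀ (pow_ne_zero 2 hq) (by linear_combination e)
    have hd : X - C τ ∣ h₀ := (prime_X_sub_C τ).dvd_of_dvd_pow (e1 ▸ dvd_mul_right _ _)
    obtain ⟨g, rfl⟩ := hd
    refine not_linear_mul_sq τ g (mul_left_cancel₀ (X_sub_C_ne_zero τ) ?_)
    linear_combination -e1

theorem no_residue_solution {k : Type*} [Field k] {α β : k} (hαβ : α ≠ 0 ∨ β ≠ 0) {p q : k[X]}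
    (hpq : p ≠ 0 ∨ q ≠ 0)
    (h : p ^ 2 + X ^ 4 * p * q - (C α * X ^ 7 + C β * X) * q ^ 2 = 0) : False := by
  obtain ⟨ν, hν, N, hN, hNe⟩ : ∃ ν : ℕ, (ν = 1 ∨ ν = 7) ∧ ∃ N : k[X], N.coeff 0 ≠ 0 ∧
      C α * X ^ 7 + C β * X = X ^ ν * N := by
    by_cases hβ : β = 0
    · refine ⟨7, Or.inr rfl, C α, by simpa [hβ] using hαβ, ?_⟩
      rw [hβ, C_0, zero_mul, add_zero, mul_comm]
    · exact ⟨1, Or.inl rfl, C α * X ^ 6 + C β, by simpa using hβ, by ring⟩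
  have hN0 : N ≠ 0 := by rintro rfl; simp at hN
  have hNt : N.natTrailingDegree = 0 := natTrailingDegree_eq_zero.2 (Or.inr hN)
  have hX : ∀ j, (X ^ j : k[X]) ≠ 0 := fun j => pow_ne_zero j X_ne_zero
  rw [hNe] at h
  by_cases hq : q = 0
  · have : p = 0 := by simpa [hq] using h
    simp [this, hq] at hpq
  by_cases hp : p = 0
  · have : q = 0 := by simpa [hp, hN0] using h
    exact hq this
  have e : p * (p + X ^ 4 * q) = X ^ ν * N * q ^ 2 := by linear_combination h
  have hr0 : p + X ^ 4 * q ≠ 0 := by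
    intro h0
    rw [h0, mul_zero] at e
    exact mul_ne_zero (mul_ne_zero (hX ν) hN0) (pow_ne_zero 2 hq) e.symm
  have e1 := congrArg natTrailingDegree e
  rw [natTrailingDegree_mul hp hr0, natTrailingDegree_mul (mul_ne_zero (hX ν) hN0)
    (pow_ne_zero 2 hq), natTrailingDegree_mul (hX ν) hN0, hNt, natTrailingDegree_X_pow, sq,
    natTrailingDegree_mul hq hq] at e1
  have hXq : (X ^ 4 * q).natTrailingDegree = 4 + q.natTrailingDegree := by
    rw [natTrailingDegree_mul (hX 4) hq, natTrailingDegree_X_pow]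
  by_cases hlt : p.natTrailingDegree < 4 + q.natTrailingDegree
  · have : (p + X ^ 4 * q).natTrailingDegree = p.natTrailingDegree := by
      have hlow : ∀ j, j < 4 + q.natTrailingDegree → (X ^ 4 * q).coeff j = 0 := fun j hj =>
        coeff_eq_zero_of_lt_natTrailingDegree (hXq ▸ hj)
      refine le_antisymm (natTrailingDegree_le_of_ne_zero ?_) (le_natTrailingDegree hr0 ?_)
      · rw [coeff_add, hlow _ hlt, add_zero]
        exact trailingCoeff_nonzero_iff_nonzero.2 hp
      · intro j hj
        rw [coeff_add, hlow _ (hj.trans hlt), coeff_eq_zero_of_lt_natTrailingDegree hj, add_zero]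
    omega
  · have : 4 + q.natTrailingDegree ≤ (p + X ^ 4 * q).natTrailingDegree := by
      refine le_natTrailingDegree hr0 fun j hj => ?_
      rw [coeff_add, coeff_eq_zero_of_lt_natTrailingDegree (p := p) (by omega),
        coeff_eq_zero_of_lt_natTrailingDegree (p := X ^ 4 * q) (by omega), add_zero]
    omega

theorem quadratic_normal_form {R : Type*} [CommRing R] {x l m t i q a b : R} (hlm : l * m = 1)
    (hi : i ^ 2 = -1) (hq : 4 * q = 1)
    (h : a ^ 2 - (l * x - t) * ((l * x) ^ 7 - (l * x) ^ 3 - 1) * b ^ 2 = 1 + 4 * (l * x)) :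
    (a - (x ^ 4 + (1 - i) * m * x ^ 3 + i * m ^ 2 * x ^ 2) * (l ^ 4 * b)) ^ 2
      + (x ^ 4 + (1 - i) * m * x ^ 3 + i * m ^ 2 * x ^ 2) *
        (a - (x ^ 4 + (1 - i) * m * x ^ 3 + i * m ^ 2 * x ^ 2) * (l ^ 4 * b)) * (2 * (l ^ 4 * b))
      - (-(q * ((t + 2 * (1 - i)) * m)) * x ^ 7 + -(q * (2 * (1 + i) * m ^ 3)) * x ^ 5
        + q * (t * m ^ 5) * x ^ 3 + -(q * m ^ 7) * x + q * (t * m ^ 8)) * (2 * (l ^ 4 * b)) ^ 2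
      = 1 + 4 * (l * x) := by
  have e1 : l * x - t = l * (x - t * m) := by linear_combination t * hlm
  have e2 : (l * x) ^ 7 - (l * x) ^ 3 - 1 = l ^ 7 * (x ^ 7 - m ^ 4 * x ^ 3 - m ^ 7) := by
    have h4 : l ^ 4 * m ^ 4 = 1 := by rw [← mul_pow, hlm, one_pow]
    have h7 : l ^ 7 * m ^ 7 = 1 := by rw [← mul_pow, hlm, one_pow]
    linear_combination h7 + l ^ 3 * x ^ 3 * h4
  rw [← h, e1, e2]
  have e3 : (x - t * m) * (x ^ 7 - m ^ 4 * x ^ 3 - m ^ 7) =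
    (x ^ 4 + (1 - i) * m * x ^ 3 + i * m ^ 2 * x ^ 2) ^ 2 + 4 * q *
    (-((t + 2 * (1 - i)) * m) * x ^ 7 + -(2 * (1 + i) * m ^ 3) * x ^ 5
        + (t * m ^ 5) * x ^ 3 + -(m ^ 7) * x + t * m ^ 8) := by
    rw [hq]
    linear_combination (-m ^ 4 * x ^ 4 - m ^ 2 * x ^ 6 + 2 * m ^ 3 * x ^ 5) * hi
  linear_combination l ^ 8 * b ^ 2 * e3

set_option maxHeartbeats 1000000 in
theorem mem_of_scaling (O : ValuationSubring ℂ) {w t m : ℂ} (hw : w ^ 14 = 2)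
    (hx : O.valuation w < 1) (hm : m ≠ 0) (hm4 : O.valuation m ≤ O.valuation w ^ 4)
    (h1 : O.valuation (t + 2 * (1 - Complex.I)) * O.valuation m ≤ O.valuation w ^ 28)
    (h2 : O.valuation w ^ 28 ≤ O.valuation m)
    (h3 : O.valuation (t + 2 * (1 - Complex.I)) * O.valuation m = O.valuation w ^ 28 ∨
      O.valuation m ^ 7 = O.valuation w ^ 28) (a b : ℂ[X])
    (h : a ^ 2 - (X - C t) * (X ^ 7 - X ^ 3 - 1) * b ^ 2 = 1 + 4 * X) :
    (2 * b.leadingCoeff) ^ 7 * (t ^ 4 / 2 ^ 8) ^ (b.natDegree + 4) ∈ O := by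
  set v := O.valuation
  have hw0 : w ≠ 0 := by rintro rfl; norm_num at hw
  have hx0 : v w ≠ 0 := (Valuation.ne_zero_iff v).2 hw0
  have hxp : 0 < v w := zero_lt_iff.2 hx0
  have hpow : ∀ {i j : ℕ}, j ≤ i → v w ^ i ≤ v w ^ j := fun hij =>
    pow_le_pow_right_of_le_one' hx.le hij
  have hv2 : v 2 = v w ^ 14 := by rw [← map_pow, hw]
  have hv4 : v (4⁻¹) = (v w ^ 28)⁻¹ := by
    rw [map_inv₀, show (4 : ℂ) = w ^ 28 by
      rw [show (28 : ℕ) = 14 * 2 from rfl, pow_mul, hw]; norm_num, map_pow]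
  have hvI : v Complex.I = 1 := by
    have : v Complex.I ^ 2 = 1 := by rw [← map_pow, Complex.I_sq, Valuation.map_neg, map_one]
    exact (pow_left_inj₀ zero_le zero_le two_ne_zero).1 (this.trans (one_pow 2).symm)
  have hvp : v (1 + Complex.I) = v w ^ 7 := by
    have : v (1 + Complex.I) ^ 2 = (v w ^ 7) ^ 2 := by
      rw [← map_pow, ← pow_mul, ← hv2, show (1 + Complex.I) ^ 2 = 2 * Complex.I by
        linear_combination Complex.I_sq, map_mul, hvI, mul_one]
    exact (pow_left_inj₀ zero_le zero_le two_ne_zero).1 this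
  have hvm : v (1 - Complex.I) = v w ^ 7 := by
    rw [show 1 - Complex.I = -Complex.I * (1 + Complex.I) by linear_combination Complex.I_sq,
      map_mul, Valuation.map_neg, hvI, one_mul, hvp]
  have hm1 : v m < 1 := hm4.trans_lt (pow_lt_one₀ zero_le hx (by norm_num))
  have hmpow : ∀ i, v m ^ i ≤ v w ^ (4 * i) := fun i => by
    rw [pow_mul]; exact pow_le_pow_left' hm4 i
  have htm : v t * v m ≤ v w ^ 25 := by
    have e : t * m = (t + 2 * (1 - Complex.I)) * m - 2 * (1 - Complex.I) * m := by ring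
    rw [← map_mul, e]
    refine (Valuation.map_sub v _ _).trans (max_le ?_ ?_)
    · rw [map_mul]; exact h1.trans (hpow (by norm_num))
    · rw [map_mul, map_mul, hvm, hv2, ← pow_add]
      calc v w ^ (14 + 7) * v m ≤ v w ^ (14 + 7) * v w ^ 4 := by gcongr
        _ = _ := by rw [← pow_add]
  have div4 : ∀ {z : ℂ} {j : ℕ}, v z ≤ v w ^ (28 + j) → v (4⁻¹ * z) ≤ v w ^ j := by
    intro z j hz
    rw [map_mul, hv4, inv_mul_le_iff₀ (zero_lt_iff.2 (pow_ne_zero _ hx0)), ← pow_add]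
    exact hz
  have hlt : ∀ {z : ℂ} {j : ℕ}, v z ≤ v w ^ (j + 1) → v z < 1 := fun hz =>
    hz.trans_lt (pow_lt_one₀ zero_le hx (by omega))
  have b7 : v (4⁻¹ * ((t + 2 * (1 - Complex.I)) * m)) ≤ 1 := by
    refine (div4 (j := 0) ?_).trans (by simp)
    rw [map_mul]; exact h1
  have b5 : v (4⁻¹ * (2 * (1 + Complex.I) * m ^ 3)) < 1 := by
    refine hlt (div4 (j := 4 + 1) ?_)
    rw [map_mul, map_mul, hvp, hv2, map_pow]
    calc v w ^ 14 * v w ^ 7 * v m ^ 3 ≤ v w ^ 14 * v w ^ 7 * v w ^ (4 * 3) := by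
          exact mul_le_mul' le_rfl (hmpow 3)
      _ = v w ^ 33 := by rw [← pow_add, ← pow_add]
  have b3 : v (4⁻¹ * (t * m ^ 5)) < 1 := by
    refine hlt (div4 (j := 12 + 1) ?_)
    rw [map_mul, map_pow, pow_succ', ← mul_assoc]
    calc v t * v m * v m ^ 4 ≤ v w ^ 25 * v w ^ (4 * 4) := mul_le_mul' htm (hmpow 4)
      _ = v w ^ 41 := by rw [← pow_add]
  have b1 : v (4⁻¹ * m ^ 7) ≤ 1 := by
    refine (div4 (j := 0) ?_).trans (by simp)
    rw [map_pow]; exact hmpow 7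
  have b0 : v (4⁻¹ * (t * m ^ 8)) < 1 := by
    refine hlt (div4 (j := 24 + 1) ?_)
    rw [map_mul, map_pow, pow_succ', ← mul_assoc]
    calc v t * v m * v m ^ 7 ≤ v w ^ 25 * v w ^ (4 * 7) := mul_le_mul' htm (hmpow 7)
      _ = v w ^ 53 := by rw [← pow_add]
  have mem : ∀ {z : ℂ}, v z ≤ 1 → ∃ y : O, algebraMap O ℂ y = z := fun {z} hz =>
    ⟨⟨z, (O.valuation_le_one_iff z).1 hz⟩, rfl⟩
  have res0 : ∀ {y : O}, v (algebraMap O ℂ y) < 1 → IsLocalRing.residue O y = 0 := fun hy =>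
    (IsLocalRing.residue_eq_zero_iff _).2 ((O.valuation_lt_one_iff _).2 hy)
  have res1 : ∀ {y : O}, v (algebraMap O ℂ y) = 1 → IsLocalRing.residue O y ≠ 0 := fun hy h0 =>
    ((O.valuation_lt_one_iff _).1 ((IsLocalRing.residue_eq_zero_iff _).1 h0)).ne hy
  obtain ⟨c7, hc7⟩ := mem b7
  obtain ⟨c5, hc5⟩ := mem b5.le
  obtain ⟨c3, hc3⟩ := mem b3.le
  obtain ⟨c1, hc1⟩ := mem b1
  obtain ⟨c0, hc0⟩ := mem b0.le
  obtain ⟨μ, hμ⟩ := mem hm1.le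
  obtain ⟨i, hI⟩ := mem hvI.le
  obtain ⟨r, hr⟩ : ∃ y : O, algebraMap O ℂ y = 4 * m⁻¹ := by
    refine mem ?_
    rw [map_mul, map_inv₀, ← inv_inv (4 : ℂ), map_inv₀, hv4, inv_inv]
    exact mul_inv_le_one_of_le₀ h2 zero_le
  have hcomp := congrArg (fun P => P.comp (C m⁻¹ * X)) h
  simp only [sub_comp, mul_comp, pow_comp, X_comp, C_comp, one_comp, add_comp, ofNat_comp]
    at hcomp
  have hnf := quadratic_normal_form (m := C m) (i := C Complex.I) (q := C 4⁻¹)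
    (by rw [← C_mul, inv_mul_cancel₀ hm, C_1]) (by rw [← C_pow, Complex.I_sq, C_neg, C_1])
    (by rw [← C_ofNat, ← C_mul, mul_inv_cancel₀ (by norm_num), C_1]) hcomp
  have key := O.integral_or_residue (X ^ 4 + C ((1 - i) * μ) * X ^ 3 + C (i * μ ^ 2) * X ^ 2) 0
    (C (-c7) * X ^ 7 + C (-c5) * X ^ 5 + C c3 * X ^ 3 + C (-c1) * X + C c0) (1 + C r * X)
    (a.comp (C m⁻¹ * X) - (X ^ 4 + (1 - C Complex.I) * C m * X ^ 3 + C Complex.I * C m ^ 2 * X ^ 2)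
      * (C m⁻¹ ^ 4 * b.comp (C m⁻¹ * X))) (2 * (C m⁻¹ ^ 4 * b.comp (C m⁻¹ * X))) (by
    simp only [Polynomial.map_zero, Polynomial.map_one, Polynomial.map_mul, Polynomial.map_sub,
      map_C, map_X, Polynomial.map_pow, Polynomial.map_add, Polynomial.map_neg, map_mul, map_sub,
      map_neg, map_one, map_pow, hc7, hc5, hc3, hc1, hc0, hμ, hI, hr, map_add, map_ofNat,
      zero_mul, add_zero]
      at hnf ⊢
    linear_combination (exp := 1) hnf)
  rcases key with ⟨p, q, -, hq, -⟩ | ⟨p, q, hpq, e⟩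
  · have hqc := congrArg (fun P => P.coeff b.natDegree) hq
    have hb : (2 * (C m⁻¹ ^ 4 * b.comp (C m⁻¹ * X))).coeff b.natDegree
        = 2 * (m⁻¹ ^ 4 * (b.leadingCoeff * m⁻¹ ^ b.natDegree)) := by
      rw [← C_ofNat, coeff_C_mul, ← C_pow, coeff_C_mul, comp_C_mul_X_coeff, leadingCoeff]
    simp only [coeff_map] at hqc
    rw [hb] at hqc
    have hqO : v (2 * (m⁻¹ ^ 4 * (b.leadingCoeff * m⁻¹ ^ b.natDegree))) ≤ 1 := by
      rw [← hqc]; exact (O.valuation_le_one_iff _).2 (q.coeff b.natDegree).2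
    rw [← O.valuation_le_one_iff]
    have e : (2 * b.leadingCoeff) ^ 7 * (t ^ 4 / 2 ^ 8) ^ (b.natDegree + 4) =
        (2 * (m⁻¹ ^ 4 * (b.leadingCoeff * m⁻¹ ^ b.natDegree))) ^ 7 *
          (t ^ 4 / 2 ^ 8 * m ^ 7) ^ (b.natDegree + 4) := by
      have : (m⁻¹ ^ (b.natDegree + 4)) ^ 7 * (m ^ 7) ^ (b.natDegree + 4) = 1 := by
        rw [← pow_mul, ← pow_mul, mul_comm 7, ← mul_pow, inv_mul_cancel₀ hm, one_pow]
      rw [mul_pow (t ^ 4 / 2 ^ 8)]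
      linear_combination (exp := 1) - (2 * b.leadingCoeff) ^ 7 *
        (t ^ 4 / 2 ^ 8) ^ (b.natDegree + 4) * this
    rw [e, map_mul, map_pow, map_pow]
    refine mul_le_one' (pow_le_one' hqO 7) (pow_le_one' ?_ _)
    rw [map_mul, map_div₀, map_pow, map_pow, map_pow, hv2, div_mul_eq_mul_div]
    refine div_le_one_of_le₀ ?_ zero_le
    calc v t ^ 4 * v m ^ 7 = (v t * v m) ^ 4 * v m ^ 3 := by rw [mul_pow, mul_assoc, ← pow_add]
      _ ≤ (v w ^ 25) ^ 4 * v w ^ (4 * 3) := mul_le_mul' (pow_le_pow_left' htm 4) (hmpow 3)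
      _ = (v w ^ 14) ^ 8 := by rw [← pow_mul, ← pow_add, ← pow_mul]
  · exfalso
    have r5 : IsLocalRing.residue O c5 = 0 := res0 (by rw [hc5]; exact b5)
    have r3 : IsLocalRing.residue O c3 = 0 := res0 (by rw [hc3]; exact b3)
    have r0 : IsLocalRing.residue O c0 = 0 := res0 (by rw [hc0]; exact b0)
    have rμ : IsLocalRing.residue O μ = 0 := res0 (by rw [hμ]; exact hm1)
    have r71 : IsLocalRing.residue O c7 ≠ 0 ∨ IsLocalRing.residue O c1 ≠ 0 := by
      refine h3.imp (fun h => res1 ?_) (fun h => res1 ?_)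
      · rw [hc7, map_mul, map_mul, hv4, h, inv_mul_cancel₀ (pow_ne_zero _ hx0)]
      · rw [hc1, map_mul, map_pow, hv4, h, inv_mul_cancel₀ (pow_ne_zero _ hx0)]
    refine no_residue_solution (α := -IsLocalRing.residue O c7) (β := -IsLocalRing.residue O c1)
      (by simpa using r71) hpq ?_
    simp only [Polynomial.map_mul, map_C, map_X, Polynomial.map_pow, Polynomial.map_add,
      Polynomial.map_neg, map_mul, map_neg, map_pow, r5, r3, r0, rμ, zero_mul, add_zero, C_0,
      neg_zero, mul_zero, ne_eq, OfNat.ofNat_ne_zero, not_false_eq_true, zero_pow] at e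
    simpa using e

theorem mem_of_two_nonunit (O : ValuationSubring ℂ)
    (h2m : (2 : O) ∈ IsLocalRing.maximalIdeal O) {t : ℂ} (ht : t ∈ O) (a b : ℂ[X])
    (h : a ^ 2 - (X - C t) * (X ^ 7 - X ^ 3 - 1) * b ^ 2 = 1 + 4 * X) :
    (2 * b.leadingCoeff) ^ 7 * (t ^ 4 / 2 ^ 8) ^ (b.natDegree + 4) ∈ O := by
  obtain ⟨w, hw⟩ := IsAlgClosed.exists_pow_nat_eq (2 : ℂ) (n := 14) (by norm_num)
  have hv2 : O.valuation 2 < 1 := (O.valuation_lt_one_iff (2 : O)).1 h2m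
  have hx : O.valuation w < 1 := by
    rw [← hw, map_pow] at hv2
    exact lt_of_not_ge fun hge => absurd (one_le_pow₀ hge) hv2.not_ge
  have hw0 : w ≠ 0 := by rintro rfl; norm_num at hw
  have hx0 : O.valuation w ≠ 0 := (Valuation.ne_zero_iff _).2 hw0
  have hI : Complex.I ∈ O := by
    rw [← O.valuation_le_one_iff]
    have : O.valuation Complex.I ^ 2 = 1 := by
      rw [← map_pow, Complex.I_sq, Valuation.map_neg, map_one]
    exact ((pow_left_inj₀ zero_le zero_le two_ne_zero).1 (this.trans (one_pow 2).symm)).le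
  set τ := t + 2 * (1 - Complex.I) with hτ
  have hτO : O.valuation τ ≤ 1 := (O.valuation_le_one_iff _).2
    (O.add_mem _ _ ht (O.mul_mem _ _ (2 : O).2 (O.sub_mem O.one_mem hI)))
  have hv4 : O.valuation 4 = O.valuation w ^ 28 := by
    rw [show (4 : ℂ) = w ^ 28 by
      rw [show (28 : ℕ) = 14 * 2 from rfl, pow_mul, hw]; norm_num, map_pow]
  by_cases hc : O.valuation τ ≤ O.valuation w ^ 24
  · refine mem_of_scaling O hw hx (m := w ^ 4) (pow_ne_zero _ hw0) (by rw [map_pow]) ?_ ?_ ?_ a b h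
    · rw [map_pow, show (28 : ℕ) = 24 + 4 from rfl, pow_add]
      gcongr
    · rw [map_pow]; exact pow_le_pow_right_of_le_one' hx.le (by norm_num)
    · right; rw [map_pow, ← pow_mul]
  · push Not at hc
    have hτ0 : O.valuation τ ≠ 0 := (zero_le.trans_lt hc).ne'
    have hτ1 : τ ≠ 0 := (Valuation.ne_zero_iff _).1 hτ0
    have e : O.valuation (4 / τ) = O.valuation w ^ 28 / O.valuation τ := by rw [map_div₀, hv4]
    refine mem_of_scaling O hw hx (m := 4 / τ) (div_ne_zero (by norm_num) hτ1) ?_ ?_ ?_ ?_ a b h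
    · rw [e, div_le_iff₀ (zero_lt_iff.2 hτ0), show (28 : ℕ) = 4 + 24 from rfl, pow_add]
      gcongr
    · rw [e, mul_div_cancel₀ _ hτ0]
    · rw [e, le_div_iff₀ (zero_lt_iff.2 hτ0)]
      exact mul_le_of_le_one_right' hτO
    · left; rw [e, mul_div_cancel₀ _ hτ0]

theorem ValuationSubring.mem_of_solution (O : ValuationSubring ℂ) {t : ℂ} (ht : t ≠ 0) (a b : ℂ[X])
    (h : a ^ 2 - (X - C t) * (X ^ 7 - X ^ 3 - 1) * b ^ 2 = 1 + 4 * X) :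
    (2 * b.leadingCoeff) ^ 7 * (t ^ 4 / 2 ^ 8) ^ (b.natDegree + 4) ∈ O := by
  obtain ⟨s, rfl⟩ := IsAlgClosed.exists_pow_nat_eq t (n := 2) (by norm_num)
  have hs : s ≠ 0 := by rintro rfl; simp at ht
  by_cases h2 : (2 : O) ∈ IsLocalRing.maximalIdeal O
  · by_cases hsO : s ∈ O
    · exact mem_of_two_nonunit O h2 (O.pow_mem hsO 2) a b h
    · exact (no_solution_of_two_nonunit O two_ne_zero h2 hs
        ((O.mem_or_inv_mem s).resolve_left hsO) a b h).elim
  · obtain ⟨htO, hb⟩ := mem_of_two_unit O h2 s a b h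
    have h2i : (2 : ℂ)⁻¹ ∈ O := by
      have hu : IsUnit (2 : O) := by
        rwa [IsLocalRing.mem_maximalIdeal, _root_.mem_nonunits_iff, not_not] at h2
      obtain ⟨y, hy⟩ := hu.exists_right_inv
      have : (2 : ℂ) * y = 1 := congrArg (Subtype.val) hy
      rw [inv_eq_of_mul_eq_one_right this]; exact y.2
    rw [div_eq_mul_inv, ← inv_pow]
    exact O.mul_mem _ _ (O.pow_mem (O.mul_mem _ _ (2 : O).2 (hb _)) _)
      (O.pow_mem (O.mul_mem _ _ (O.pow_mem htO _) (O.pow_mem h2i _)) _)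

theorem isIntegral_int_of_forall_mem {K : Type*} [Field K] {x : K}
    (h : ∀ O : ValuationSubring K, x ∈ O) : IsIntegral ℤ x := by
  have hx : x ∈ (integralClosure (Subring.closure (∅ : Set K)) K).toSubring := by
    rw [← iInf_valuationSubring_superset]
    simpa [Subring.mem_iInf] using fun V => h V
  have hx : IsIntegral (Subring.closure (∅ : Set K)) x := hx
  have : Algebra.IsIntegral ℤ (Subring.closure (∅ : Set K)) := ⟨fun y => by
    obtain ⟨n, hn⟩ := Subring.mem_bot.1 ((Subring.closure_empty (R := K)).le y.2)
    have : y = algebraMap ℤ _ n := Subtype.ext (by simp [← hn])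
    rw [this]; exact isIntegral_algebraMap⟩
  exact isIntegral_trans x hx

theorem exists_root_one_le_norm {z : ℂ} (hz : z ≠ 0) (hi : IsIntegral ℤ z) :
    ∃ w : ℂ, aeval w (minpoly ℚ z) = 0 ∧ 1 ≤ ‖w‖ := by
  by_contra! hc
  set p := (minpoly ℤ z).map (Int.castRingHom ℂ) with hp
  have hm : p.Monic := (minpoly.monic hi).map _
  have hroot : ∀ w ∈ p.roots, ‖w‖ < 1 := by
    intro w hw
    refine hc w ?_
    have h1 := (mem_roots hm.ne_zero).1 hw
    rw [minpoly.isIntegrallyClosed_eq_field_fractions' ℚ hi, aeval_map_algebraMap]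
    rw [IsRoot.def, hp, eval_map] at h1
    exact h1
  have h0 : p.coeff 0 = ((minpoly ℤ z).coeff 0 : ℤ) := by rw [hp, coeff_map]; rfl
  have hn : 1 ≤ ‖p.coeff 0‖ := by
    rw [h0, Complex.norm_intCast]
    have : (minpoly ℤ z).coeff 0 ≠ 0 := by
      intro h
      have hQ := minpoly.coeff_zero_ne_zero (A := ℚ) hi.tower_top hz
      rw [minpoly.isIntegrallyClosed_eq_field_fractions' ℚ hi, coeff_map, h, map_zero] at hQ
      exact hQ rfl
    exact_mod_cast Int.one_le_abs this
  rw [(IsAlgClosed.splits p).coeff_zero_eq_prod_roots_of_monic hm, norm_mul, norm_pow, norm_neg,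
    norm_one, one_pow, one_mul] at hn
  have hne : p.roots ≠ 0 := by
    intro h
    have hd := (IsAlgClosed.splits p).natDegree_eq_card_roots
    rw [h, hp, (minpoly.monic hi).natDegree_map] at hd
    exact (minpoly.natDegree_pos hi).ne' (by simpa using hd)
  have hle : ∀ s : Multiset ℂ, (∀ w ∈ s, ‖w‖ < 1) → s ≠ 0 → ‖s.prod‖ < 1 := by
    intro s
    induction s using Multiset.induction_on with
    | empty => simp
    | cons a s ih =>
      intro h _
      rw [Multiset.prod_cons, norm_mul]
      have ha := h a (Multiset.mem_cons_self a s)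
      by_cases hs : s = 0
      · simpa [hs] using ha
      · exact mul_lt_one_of_nonneg_of_lt_one_left (norm_nonneg _) ha
          (ih (fun w hw => h w (Multiset.mem_cons_of_mem hw)) hs).le
  exact (hle _ hroot hne).not_ge hn

theorem exists_ringEquiv_of_aeval_minpoly_eq_zero {z w : ℂ} (hz : IsAlgebraic ℚ z)
    (hw : aeval w (minpoly ℚ z) = 0) : ∃ σ : ℂ ≃+* ℂ, σ z = w := by
  let R := algebraicClosure ℚ ℂ
  have hwa : IsAlgebraic ℚ w := ⟨_, minpoly.ne_zero hz.isIntegral, hw⟩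
  let z' : R := ⟨z, (mem_algebraicClosure_iff).2 hz⟩
  let w' : R := ⟨w, (mem_algebraicClosure_iff).2 hwa⟩
  have hw' : aeval w' (minpoly ℚ z') = 0 := by
    apply (algebraMap R ℂ).injective
    rw [map_zero, ← aeval_algebraMap_apply]
    have : minpoly ℚ z' = minpoly ℚ z :=
      (minpoly.algebraMap_eq (algebraMap R ℂ).injective z').symm
    rw [this]; exact hw
  have : IsAlgClosure ℚ R := algebraicClosure.isAlgClosure ℚ ℂ
  obtain ⟨τ, hτ⟩ := minpoly.exists_algEquiv_of_root (Algebra.IsAlgebraic.isAlgebraic z') hw'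
  obtain ⟨s, hs⟩ := exists_isTranscendenceBasis R ℂ
  let v : s → ℂ := Subtype.val
  let := IsAlgClosed.isAlgClosure_of_transcendence_basis v hs
  let e : Algebra.adjoin R (Set.range v) ≃+* Algebra.adjoin R (Set.range v) :=
    (hs.1.aevalEquiv.symm.toRingEquiv.trans (MvPolynomial.mapEquiv s τ.symm.toRingEquiv)).trans
      hs.1.aevalEquiv.toRingEquiv
  refine ⟨IsAlgClosure.equivOfEquiv ℂ ℂ e, ?_⟩
  have he : e (algebraMap R _ z') = algebraMap R _ w' := by
    simp only [e, RingEquiv.trans_apply, AlgEquiv.coe_ringEquiv]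
    rw [AlgEquiv.commutes, MvPolynomial.algebraMap_eq, MvPolynomial.mapEquiv_apply,
      MvPolynomial.map_C]
    have : (τ.symm.toRingEquiv : R →+* R) z' = w' := by
      rw [← hτ]; exact τ.symm_apply_apply w'
    rw [this, ← MvPolynomial.algebraMap_eq, AlgEquiv.commutes]
  have := IsAlgClosure.equivOfEquiv_algebraMap ℂ ℂ e (algebraMap R _ z')
  rw [he] at this
  exact this

theorem exists_conjugate_solution {t : ℂ} (ht : t ≠ 0) (a b : ℂ[X]) (hb : b ≠ 0)
    (h : a ^ 2 - (X - C t) * (X ^ 7 - X ^ 3 - 1) * b ^ 2 = 1 + 4 * X) :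
    ∃ (t' : ℂ) (a' b' : ℂ[X]), t' ≠ 0 ∧ b' ≠ 0 ∧ b'.natDegree = b.natDegree ∧
      a' ^ 2 - (X - C t') * (X ^ 7 - X ^ 3 - 1) * b' ^ 2 = 1 + 4 * X ∧
      1 ≤ (2 * ‖b'.leadingCoeff‖) ^ 7 * (‖t'‖ ^ 4 / 2 ^ 8) ^ (b.natDegree + 4) := by
  have hγ := isIntegral_int_of_forall_mem fun O => O.mem_of_solution ht a b h
  obtain ⟨w, hw, hw1⟩ := exists_root_one_le_norm (by
    simp [ht, hb]) hγ
  obtain ⟨σ, hσ⟩ := exists_ringEquiv_of_aeval_minpoly_eq_zero hγ.tower_top.isAlgebraic hw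
  refine ⟨σ t, a.map (σ : ℂ →+* ℂ), b.map (σ : ℂ →+* ℂ), by simpa using ht,
    by rwa [ne_eq, Polynomial.map_eq_zero], natDegree_map _, ?_, ?_⟩
  · have := congrArg (Polynomial.map (σ : ℂ →+* ℂ)) h
    simpa using this
  · rw [← hσ] at hw1
    have h2 : σ 2 = 2 := map_ofNat σ 2
    simpa [leadingCoeff_map, h2] using hw1

theorem natDegree_le_of_solution {k : Type*} [Field k] {t : k} {a b : k[X]}
    (h : a ^ 2 - (X - C t) * (X ^ 7 - X ^ 3 - 1) * b ^ 2 = 1 + 4 * X) :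
    a.natDegree ≤ b.natDegree + 4 := by
  have e : a ^ 2 = (X - C t) * (X ^ 7 - X ^ 3 - 1) * b ^ 2 + (1 + 4 * X) := by
    linear_combination h
  have d : ((X - C t) * (X ^ 7 - X ^ 3 - 1) * b ^ 2 + (1 + 4 * X)).natDegree
      ≤ 8 + 2 * b.natDegree := by
    compute_degree; omega
  rw [← e, natDegree_pow] at d
  omega

theorem exists_valuationSubring_two_nonunit {K : Type*} [Field K] {r : K}
    (hr : ∀ p : ℤ[X], aeval r p = 0 → p = 0) :
    ∃ O : ValuationSubring K, (2 : O) ∈ IsLocalRing.maximalIdeal O ∧ r ∈ O := by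
  let A : Subring K := (aeval (R := ℤ) r).range.toSubring
  have hrA : r ∈ A := ⟨X, aeval_X r⟩
  obtain ⟨O, hAO, hO⟩ := Ideal.image_subset_nonunits_valuationSubring (A := A)
    (Ideal.span {2}) (by
      rw [ne_eq, Ideal.eq_top_iff_one, Ideal.mem_span_singleton]
      rintro ⟨⟨_, ⟨p, rfl⟩⟩, hp⟩
      have hp : (1 : K) = 2 * aeval r p := congrArg Subtype.val hp
      have h0 := hr (2 * p - 1) (by
        rw [map_sub, map_mul, map_ofNat, map_one, ← hp, sub_self])
      have h1 := congrArg (fun P => (P.eval 0 : ℤ)) h0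
      simp at h1
      omega)
  refine ⟨O, ?_, hAO hrA⟩
  have := hO ⟨(2 : A), Ideal.mem_span_singleton_self 2, rfl⟩
  rw [O.valuation_lt_one_iff]
  exact (ValuationSubring.mem_nonunits_iff O).1 this

theorem finite_of_natDegree_le (m : ℕ) :
    {t : ℂ | ∃ a b : ℂ[X], b.natDegree ≤ m ∧
      a ^ 2 - (X - C t) * (X ^ 7 - X ^ 3 - 1) * b ^ 2 = 1 + 4 * X}.Finite := by
  by_contra hinf
  let f := Set.Infinite.natEmbedding _ hinf
  choose a b hb hab using fun i => (f i).2
  choose s hs using fun i => IsAlgClosed.exists_pow_nat_eq (f i : ℂ) (n := 2) (by norm_num)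
  have hsinj : Function.Injective s := by
    intro i j hij
    apply f.injective
    apply Subtype.ext
    rw [← hs, ← hs, hij]
  let l : Ultrafilter ℕ := Filter.hyperfilter ℕ
  let ψ : (ℕ → ℂ) →+* Filter.Germ (l : Filter ℕ) ℂ := Filter.Germ.coeRingHom _
  have hψ : ∀ {q r : ℕ → ℂ}, ψ q = ψ r → {i | q i = r i}.Infinite := by
    intro q r h hfin
    have h1 : {i | q i = r i} ∈ (l : Filter ℕ) := Filter.Germ.coe_eq.1 h
    exact Filter.notMem_hyperfilter_of_finite hfin h1
  have hs0 : ψ s ≠ 0 := by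
    rw [← map_zero ψ]
    intro h
    refine hψ h (Set.Subsingleton.finite ?_)
    intro i hi j hj
    exact hsinj (hi.trans hj.symm)
  have hinv : (ψ s)⁻¹ = ψ (fun i => (s i)⁻¹) := rfl
  obtain ⟨O, h2, hO⟩ := exists_valuationSubring_two_nonunit (r := (ψ s)⁻¹) (by
    intro p hp
    rw [hinv] at hp
    by_contra hp0
    have e : aeval (ψ fun i => (s i)⁻¹) p = ψ (fun i => aeval (s i)⁻¹ p) := by
      have e1 : (fun i => aeval (s i)⁻¹ p) = aeval (fun i => (s i)⁻¹) p := by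
        funext i
        exact (aeval_algHom_apply (Pi.evalAlgHom ℤ (fun _ : ℕ => ℂ) i) (fun i => (s i)⁻¹) p)
      rw [e1]
      exact aeval_algHom_apply ψ.toIntAlgHom (fun i => (s i)⁻¹) p
    rw [e, ← map_zero ψ] at hp
    refine hψ hp ?_
    have hfin : {z : ℂ | aeval z p = 0}.Finite := by
      refine (p.aroots ℂ).toFinset.finite_toSet.subset fun z hz => ?_
      exact Multiset.mem_toFinset.2 (mem_aroots.2 ⟨hp0, hz⟩)
    exact hfin.preimage (Function.Injective.injOn (fun i j hij => hsinj (inv_injective hij))))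
  let lift (u : ℕ → ℂ[X]) : (ℕ → ℂ)[X] :=
    ∑ j ∈ Finset.range (m + 5), C (fun i => (u i).coeff j) * X ^ j
  have hlift : ∀ (u : ℕ → ℂ[X]) (i : ℕ), (u i).natDegree < m + 5 →
      (lift u).map (Pi.evalRingHom (fun _ => ℂ) i) = u i := by
    intro u i hu
    simp only [lift, Polynomial.map_sum, Polynomial.map_mul, map_C, Polynomial.map_pow, map_X]
    exact ((u i).as_sum_range_C_mul_X_pow' hu).symm
  have hA : ∀ i, (a i).natDegree < m + 5 := fun i => by
    have := natDegree_le_of_solution (hab i)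
    have := hb i
    omega
  have hB : ∀ i, (b i).natDegree < m + 5 := fun i => by
    have := hb i
    omega
  have key : lift a ^ 2 - (X - C (s ^ 2)) * (X ^ 7 - X ^ 3 - 1) * lift b ^ 2 = 1 + 4 * X := by
    have : ∀ P Q : (ℕ → ℂ)[X], (∀ i, P.map (Pi.evalRingHom (fun _ => ℂ) i) =
        Q.map (Pi.evalRingHom (fun _ => ℂ) i)) → P = Q := by
      intro P Q h
      ext j i
      have := congrArg (fun R => R.coeff j) (h i)
      simpa using this
    refine this _ _ fun i => ?_
    simp only [Polynomial.map_sub, Polynomial.map_mul, Polynomial.map_pow, Polynomial.map_add,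
      map_X, map_C, Polynomial.map_one, Polynomial.map_ofNat, hlift a i (hA i), hlift b i (hB i)]
    rw [← hab i]
    have : (Pi.evalRingHom (fun _ => ℂ) i) (s ^ 2) = (f i : ℂ) := hs i
    rw [this]
  refine no_solution_of_two_nonunit O ?_ h2 hs0 hO ((lift a).map ψ) ((lift b).map ψ) ?_
  · have : (2 : Filter.Germ (l : Filter ℕ) ℂ) = ψ 2 := (map_ofNat ψ 2).symm
    rw [this, ← map_zero ψ]
    intro h
    exact hψ h (by simp)
  · have := congrArg (Polynomial.map ψ) key
    simpa using this

theorem no_continuous_sqrt_circle {G : ℝ → ℂ} (hG : Continuous G)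
    (hper : G (2 * Real.pi) = G 0) {k : ℂ} (hk : k ≠ 0)
    (hsq : ∀ θ : ℝ, G θ ^ 2 = k * Complex.exp (θ * Complex.I)) : False := by
  let H : ℝ → ℂ := fun θ => G θ * Complex.exp (-(θ / 2 * Complex.I))
  have hH : Continuous H := by fun_prop
  have hHsq : ∀ θ, H θ ^ 2 = k := by
    intro θ
    simp only [H]
    rw [mul_pow, hsq, ← Complex.exp_nat_mul, mul_assoc, ← Complex.exp_add]
    have : (θ : ℂ) * Complex.I + (2 : ℕ) * -(θ / 2 * Complex.I) = 0 := by push_cast; ring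
    rw [this, Complex.exp_zero, mul_one]
  have hH0 : H 0 ≠ 0 := fun h => hk (by rw [← hHsq 0, h]; simp)
  have h2 : H (2 * Real.pi) = -H 0 := by
    simp only [H]
    rw [hper]
    have : -(((2 * Real.pi : ℝ) : ℂ) / 2 * Complex.I) = -(Real.pi * Complex.I) := by
      push_cast; ring
    rw [this, Complex.exp_neg, Complex.exp_pi_mul_I]
    norm_num
  rcases isPreconnected_univ.eq_or_eq_neg_of_sq_eq (f := H) (g := fun _ => H 0)
    hH.continuousOn continuousOn_const (fun θ _ => by simp [hHsq]) (fun _ => hH0) with h | h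
  · have := h (Set.mem_univ (2 * Real.pi))
    rw [h2] at this
    exact hH0 (neg_eq_self.1 this)
  · have := h (Set.mem_univ 0)
    exact hH0 (self_eq_neg.1 this)

theorem Complex.sqrt_sq_continuous {X : Type*} [TopologicalSpace X] {h : X → ℂ}
    (hc : Continuous h) (hs : ∀ x, h x ∈ Complex.slitPlane) :
    ∃ g : X → ℂ, Continuous g ∧ (∀ x, g x ^ 2 = h x) ∧ ∀ x y, h x = h y → g x = g y :=
  ⟨fun x => h x ^ ((2 : ℕ) : ℂ)⁻¹, hc.cpow continuous_const fun x => hs x,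
    fun x => Complex.cpow_nat_inv_pow _ two_ne_zero, fun x y hxy => by simp only [hxy]⟩

theorem sqrt_prod_on_circle {c : ℂ} {r : ℝ} (hr : 0 < r) (s : Multiset ℂ)
    (hs : ∀ d ∈ s, r < ‖d - c‖) :
    ∃ (g : ℝ → ℂ) (k : ℂ), Continuous g ∧ k ≠ 0 ∧ g (2 * Real.pi) = g 0 ∧
      ∀ θ : ℝ, k * g θ ^ 2 = (s.map fun d => c + r * Complex.exp (θ * Complex.I) - d).prod := by
  induction s using Multiset.induction_on with
  | empty => exact ⟨fun _ => 1, 1, continuous_const, one_ne_zero, rfl, by simp⟩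
  | cons d s ih =>
    obtain ⟨g, k, hg, hk, hp, hgk⟩ := ih fun e he => hs e (Multiset.mem_cons_of_mem he)
    have hd := hs d (Multiset.mem_cons_self d s)
    have hcd : c - d ≠ 0 := by
      intro h
      rw [← norm_neg, neg_sub, h, norm_zero] at hd
      exact hd.not_gt hr
    obtain ⟨u, hu, hu2, hup⟩ := Complex.sqrt_sq_continuous
      (h := fun θ : ℝ => 1 + r * Complex.exp (θ * Complex.I) / (c - d))
      (by fun_prop) (fun θ => Complex.mem_slitPlane_of_norm_lt_one (by
        rw [norm_div, norm_mul, Complex.norm_exp_ofReal_mul_I, mul_one, Complex.norm_real,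
          Real.norm_eq_abs, abs_of_pos hr, div_lt_one (norm_pos_iff.2 hcd), ← norm_neg, neg_sub]
        exact hd))
    refine ⟨fun θ => u θ * g θ, (c - d) * k, hu.mul hg, mul_ne_zero hcd hk, ?_, fun θ => ?_⟩
    · simp only
      rw [hp, hup (2 * Real.pi) 0 (by simp)]
    · rw [Multiset.map_cons, Multiset.prod_cons, ← hgk, mul_pow, hu2]
      field_simp
      ring

theorem exists_norm_sq_le_on_circle {a b D F : ℂ[X]} {c : ℂ} {s : Multiset ℂ} {r : ℝ} (hr : 0 < r)
    (hD : ∀ z, D.eval z = (z - c) * (s.map fun d => z - d).prod)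
    (hs : ∀ d ∈ s, r < ‖d - c‖) (h : a ^ 2 - D * b ^ 2 = F) :
    ∃ z, ‖z - c‖ = r ∧ ‖a.eval z‖ ^ 2 ≤ ‖F.eval z‖ := by
  by_contra! hlt
  let γ : ℝ → ℂ := fun θ => c + r * Complex.exp (θ * Complex.I)
  have hγ : Continuous γ := by fun_prop
  have hγp : γ (2 * Real.pi) = γ 0 := by simp [γ]
  have hγr : ∀ θ, ‖γ θ - c‖ = r := by
    intro θ
    simp only [γ, add_sub_cancel_left]
    rw [norm_mul, Complex.norm_exp_ofReal_mul_I, mul_one, Complex.norm_real,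
          Real.norm_eq_abs, abs_of_pos hr]
  have hF : ∀ θ, ‖F.eval (γ θ)‖ < ‖a.eval (γ θ)‖ ^ 2 := fun θ => hlt _ (hγr θ)
  have ha : ∀ θ, a.eval (γ θ) ≠ 0 := by
    intro θ h0
    have := hF θ
    rw [h0, norm_zero] at this
    exact (norm_nonneg _).not_gt (by simpa using this)
  have heq : ∀ θ, a.eval (γ θ) ^ 2 - D.eval (γ θ) * b.eval (γ θ) ^ 2 = F.eval (γ θ) := by
    intro θ; rw [← h]; simp
  have hlt1 : ∀ θ, ‖-(F.eval (γ θ) / a.eval (γ θ) ^ 2)‖ < 1 := by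
    intro θ
    rw [norm_neg, norm_div, norm_pow, div_lt_one (by have := ha θ; positivity)]
    exact hF θ
  obtain ⟨u, hu, hu2, hup⟩ := Complex.sqrt_sq_continuous
    (h := fun θ : ℝ => 1 + -(F.eval (γ θ) / a.eval (γ θ) ^ 2))
    (by
      have h1 : Continuous fun θ => F.eval (γ θ) := F.continuous.comp hγ
      have h2 : Continuous fun θ => a.eval (γ θ) := a.continuous.comp hγ
      exact continuous_const.add ((h1.div (h2.pow 2) fun θ => pow_ne_zero 2 (ha θ)).neg))
    (fun θ => Complex.mem_slitPlane_of_norm_lt_one (hlt1 θ))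
  have hDb : ∀ θ, D.eval (γ θ) * b.eval (γ θ) ^ 2 = u θ ^ 2 * a.eval (γ θ) ^ 2 := by
    intro θ
    rw [hu2, add_mul, neg_mul, div_mul_cancel₀ _ (pow_ne_zero 2 (ha θ)), ← heq θ]
    ring
  have hu0 : ∀ θ, u θ ≠ 0 := by
    intro θ h0
    have := hu2 θ
    rw [h0, zero_pow two_ne_zero] at this
    exact Complex.slitPlane_ne_zero (Complex.mem_slitPlane_of_norm_lt_one (hlt1 θ)) this.symm
  have hb : ∀ θ, b.eval (γ θ) ≠ 0 := by
    intro θ h0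
    have := hDb θ
    rw [h0, zero_pow two_ne_zero, mul_zero] at this
    exact mul_ne_zero (pow_ne_zero 2 (hu0 θ)) (pow_ne_zero 2 (ha θ)) this.symm
  obtain ⟨g, k, hg, hk, hgp, hgk⟩ := sqrt_prod_on_circle hr s hs
  have hDg : ∀ θ : ℝ, D.eval (γ θ) = r * Complex.exp (θ * Complex.I) * (k * g θ ^ 2) := by
    intro θ; rw [hD, hgk]; simp [γ]
  have hg0 : ∀ θ, g θ ≠ 0 := by
    intro θ h0
    have h1 := hDb θ
    rw [hDg, h0, zero_pow two_ne_zero, mul_zero, mul_zero, zero_mul] at h1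
    exact mul_ne_zero (pow_ne_zero 2 (hu0 θ)) (pow_ne_zero 2 (ha θ)) h1.symm
  refine no_continuous_sqrt_circle (G := fun θ => u θ * a.eval (γ θ) / (b.eval (γ θ) * g θ)) ?_ ?_
    (k := r * k) (mul_ne_zero (by exact_mod_cast hr.ne') hk) ?_
  · exact (hu.mul (a.continuous.comp hγ)).div ((b.continuous.comp hγ).mul hg)
      fun θ => mul_ne_zero (hb θ) (hg0 θ)
  · rw [hgp, hup (2 * Real.pi) 0 (by rw [hγp]), hγp]
  · intro θ
    have h1 := hDb θ
    rw [hDg] at h1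
    rw [div_pow, mul_pow, ← h1, mul_pow, div_eq_iff (mul_ne_zero (pow_ne_zero 2 (hb θ))
      (pow_ne_zero 2 (hg0 θ)))]
    ring

/-- The mean over `r ∈ (0, ℓ)` of `log |s - r|`. -/
noncomputable def logMean (ℓ s : ℝ) : ℝ :=
  (s * Real.log s - (s - ℓ) * Real.log (s - ℓ)) / ℓ - 1

theorem integral_log_sub {ℓ : ℝ} (hℓ : 0 < ℓ) (s : ℝ) :
    ∫ r in 0..ℓ, Real.log (s - r) = ℓ * logMean ℓ s := by
  rw [intervalIntegral.integral_comp_sub_left (fun x => Real.log x), integral_log, logMean]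
  field_simp
  ring_nf

theorem intervalIntegrable_log_sub (s u v : ℝ) :
    IntervalIntegrable (fun r => Real.log (s - r)) MeasureTheory.volume u v := by
  have := (intervalIntegral.intervalIntegrable_log' (a := s - u) (b := s - v)).comp_sub_left s
  simpa using this

theorem integral_multiset_sum_log {ℓ : ℝ} (hℓ : 0 < ℓ) (c : ℂ) (s : Multiset ℂ) :
    IntervalIntegrable (fun r => (s.map fun ξ => Real.log (‖ξ - c‖ - r)).sum)
      MeasureTheory.volume 0 ℓ ∧
    ∫ r in 0..ℓ, (s.map fun ξ => Real.log (‖ξ - c‖ - r)).sum =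
      ℓ * (s.map fun ξ => logMean ℓ ‖ξ - c‖).sum := by
  induction s using Multiset.induction_on with
  | empty => simp
  | cons d s ih =>
    simp only [Multiset.map_cons, Multiset.sum_cons]
    have h1 := intervalIntegrable_log_sub ‖d - c‖ 0 ℓ
    refine ⟨h1.add ih.1, ?_⟩
    rw [intervalIntegral.integral_add h1 ih.1, ih.2, integral_log_sub hℓ, mul_add]

theorem sum_log_le_log_norm_prod {c z : ℂ} {r : ℝ} (hz : ‖z - c‖ = r) (s : Multiset ℂ)
    (hs : ∀ ξ ∈ s, r ≠ ‖ξ - c‖) :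
    (s.map fun ξ => z - ξ).prod ≠ 0 ∧ (s.map fun ξ => Real.log (‖ξ - c‖ - r)).sum ≤
      Real.log ‖(s.map fun ξ => z - ξ).prod‖ := by
  induction s using Multiset.induction_on with
  | empty => simp
  | cons d s ih =>
    obtain ⟨h0, h1⟩ := ih fun e he => hs e (Multiset.mem_cons_of_mem he)
    have hd := hs d (Multiset.mem_cons_self d s)
    have hzd : z - d ≠ 0 := by
      intro h
      rw [sub_eq_zero] at h
      exact hd (by rw [← hz, h])
    simp only [Multiset.map_cons, Multiset.sum_cons, Multiset.prod_cons]
    refine ⟨mul_ne_zero hzd h0, ?_⟩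
    rw [norm_mul, Real.log_mul (norm_ne_zero_iff.2 hzd) (norm_ne_zero_iff.2 h0)]
    refine add_le_add ?_ h1
    rw [← Real.log_abs (‖d - c‖ - r)]
    refine Real.log_le_log (abs_pos.2 (sub_ne_zero.2 hd.symm)) ?_
    rw [← hz]
    refine (abs_norm_sub_norm_le _ _).trans_eq ?_
    rw [← norm_neg]; congr 1; ring

theorem log_leadingCoeff_add_sum_logMean_le {a : ℂ[X]} (ha : a ≠ 0) {c : ℂ} {ℓ M : ℝ} (hℓ : 0 < ℓ)
    (h : ∀ r, 0 < r → r < ℓ → ∃ z, ‖z - c‖ = r ∧ ‖a.eval z‖ ^ 2 ≤ M) :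
    Real.log ‖a.leadingCoeff‖ + (a.roots.map fun ξ => logMean ℓ ‖ξ - c‖).sum
      ≤ Real.log M / 2 := by
  obtain ⟨hi, hI⟩ := integral_multiset_sum_log hℓ c a.roots
  have hpt : ∀ r, 0 < r → r < ℓ → (∀ ξ ∈ a.roots, r ≠ ‖ξ - c‖) →
      (a.roots.map fun ξ => Real.log (‖ξ - c‖ - r)).sum
        ≤ Real.log M / 2 - Real.log ‖a.leadingCoeff‖ := by
    intro r h0 h1 hr
    obtain ⟨z, hz, hM⟩ := h r h0 h1
    obtain ⟨hp0, hp⟩ := sum_log_le_log_norm_prod hz a.roots hr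
    have e : a.eval z = a.leadingCoeff * (a.roots.map fun ξ => z - ξ).prod :=
      (IsAlgClosed.splits a).eval_eq_prod_roots z
    have hl : a.leadingCoeff ≠ 0 := leadingCoeff_ne_zero.2 ha
    have h2 : Real.log (‖a.eval z‖ ^ 2) ≤ Real.log M :=
      Real.log_le_log (by rw [e]; exact pow_pos (norm_pos_iff.2 (mul_ne_zero hl hp0)) 2) hM
    rw [Real.log_pow, e, norm_mul, Real.log_mul (norm_ne_zero_iff.2 hl)
      (norm_ne_zero_iff.2 hp0)] at h2
    push_cast at h2
    linarith
  have hmean := intervalIntegral.integral_mono_ae_restrict hℓ.le hi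
    (intervalIntegrable_const (c := Real.log M / 2 - Real.log ‖a.leadingCoeff‖)) (by
      have hfin : ({0, ℓ} ∪ Set.image (fun ξ => ‖ξ - c‖) {ξ | ξ ∈ a.roots} : Set ℝ).Finite := by
        refine (Set.toFinite _).union (Set.Finite.image _ ?_)
        exact (a.roots.toFinset.finite_toSet).subset fun ξ hξ => by simpa using hξ
      have h1 := MeasureTheory.ae_restrict_of_ae (s := Set.Icc 0 ℓ)
        (hfin.countable.ae_notMem MeasureTheory.volume)
      filter_upwards [h1, MeasureTheory.ae_restrict_mem measurableSet_Icc] with r hr hr2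
      simp only [Set.mem_union, not_or, Set.mem_insert_iff, Set.mem_singleton_iff] at hr
      exact hpt r (lt_of_le_of_ne hr2.1 (Ne.symm hr.1.1)) (lt_of_le_of_ne hr2.2 hr.1.2)
        fun ξ hξ he => hr.2 ⟨ξ, hξ, he.symm⟩)
  rw [hI, intervalIntegral.integral_const, smul_eq_mul, sub_zero] at hmean
  have := le_of_mul_le_mul_left hmean hℓ
  linarith

/-- A lower bound for `logMean ℓ` at the distance `p / D`, stated for `ℓ = a / D` as an inequality
of natural numbers; it certifies the value `(k / 64 - 10) * log 2`. -/
def logMeanCheck (a D p k : ℕ) : Bool :=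
  bif a.ble p then
    ((p - a) ^ ((p - a) * 64) * 271829 ^ (64 * a) * D ^ (64 * a) * 2 ^ (a * k)).ble
      (p ^ (p * 64) * 100000 ^ (64 * a) * 2 ^ (640 * a))
  else
    (271829 ^ (64 * a) * D ^ (64 * a) * 2 ^ (a * k)).ble
      (p ^ (p * 64) * (a - p) ^ ((a - p) * 64) * 100000 ^ (64 * a) * 2 ^ (640 * a))

/-- Decision trees for lower bounds of a nondecreasing function. -/
inductive StepTree
  | leaf (k : ℕ)
  | node (p : ℕ) (l r : StepTree)

namespace StepTree

/-- The certified value at squared distance `v`, in units of `1 / 1024`. -/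
noncomputable def lookup (v : ℕ) (T : StepTree) : ℕ :=
  T.rec (fun k => k) fun p _ _ l r => bif (4 * p * p).ble v then r else l

theorem lookup_node (v p : ℕ) (l r : StepTree) :
    (node p l r).lookup v = bif (4 * p * p).ble v then r.lookup v else l.lookup v :=
  rfl

/-- All leaves are lower bounds for `logMean (25 / 128)`. -/
def valid : StepTree → ℕ → Bool
  | leaf k, p => bif (p % 4).beq 0 then logMeanCheck 25 128 (p / 4) k
      else logMeanCheck 100 512 p k
  | node q l r, p => (50).ble q && (l.valid p && r.valid q)

end StepTree

/-- Evaluate a natural number before passing it on. -/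
def Nat.eager {α : Type} (n : ℕ) (f : ℕ → α) : α :=
  match n with
  | 0 => f 0
  | k + 1 => f (k + 1)

/-- A weighted sum of certified values at a square cell; the list consists of a weight and the
two coordinates of a centre. -/
noncomputable def cellSum (T : StepTree) (x y L : ℕ) (cs : List (ℕ × ℕ × ℕ)) : ℕ :=
  cs.rec 0 fun c _ S =>
    (((x - (c.2.1 + 1) + (c.2.1 - (x + L + 1))) ^ 2 +
      (y - (c.2.2 + 1) + (c.2.2 - (y + L + 1))) ^ 2).eager fun v => c.1 * T.lookup v) + S

theorem cellSum_cons (T : StepTree) (x y L w p q : ℕ) (cs : List (ℕ × ℕ × ℕ)) :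
    cellSum T x y L ((w, p, q) :: cs) =
      (((x - (p + 1) + (p - (x + L + 1))) ^ 2 + (y - (q + 1) + (q - (y + L + 1))) ^ 2).eager
        fun v => w * T.lookup v) + cellSum T x y L cs :=
  rfl

/-- The lower bounds `g` outside the discs of radius `r / 32` hold on the given cell. -/
noncomputable def cellOK (T : StepTree) (cs : List (ℕ × ℕ × ℕ)) (sh : List (ℕ × ℕ))
    (L x y : ℕ) : Bool :=
  (cellSum T x y L cs).eager fun S =>
    ((8192 - x + (x + L - 8192)) ^ 2 + (8192 - y + (y + L - 8192)) ^ 2).eager fun m =>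
      sh.all fun s => s.2.ble S || (m + 1).ble ((32 * s.1) ^ 2)

/-- Recursive subdivision of a square cell of side `2 ^ k`. -/
noncomputable def quadOK (T : StepTree) (cs : List (ℕ × ℕ × ℕ)) (sh : List (ℕ × ℕ)) :
    ℕ → ℕ → ℕ → Bool
  | 0, x, y => cellOK T cs sh 1 x y
  | k + 1, x, y => x.eager fun x => y.eager fun y =>
      cellOK T cs sh (2 ^ (k + 1)) x y ||
        ((quadOK T cs sh k x y && quadOK T cs sh k (x + 2 ^ k) y) &&
          (quadOK T cs sh k x (y + 2 ^ k) && quadOK T cs sh k (x + 2 ^ k) (y + 2 ^ k)))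

/-- The bounds hold on the square of half-side `8` and far away from the centres. -/
noncomputable def planeOK (T : StepTree) (cs : List (ℕ × ℕ × ℕ)) (sh : List (ℕ × ℕ)) : Bool :=
  quadOK T cs sh 14 0 0 &&
    sh.all fun s => s.2.ble ((cs.map fun c => c.1).sum * T.lookup (6800 ^ 2))

/-- The weight `j / 40` on the circles of radius less than `a / 32` about `t`, with
`q ≤ 32 * ‖t‖`, improves the bounds on each shell to `(R / 64 - 10) * log 2`. -/
def shellsOK (q j a R : ℕ) : List (ℕ × ℕ) → Bool
  | [] => true
  | [(_, g)] => logMeanCheck a 32 (a / 2) ((1240 * R - (40 - j) * g + 31 * j - 1) / (31 * j))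
  | (_, g) :: (r, g') :: l =>
    logMeanCheck a 32 (max (q - r) (a / 2)) ((1240 * R - (40 - j) * g + 31 * j - 1) / (31 * j)) &&
      shellsOK q j a R ((r, g') :: l)

/-- Consecutive intervals of `32 * ‖t‖`, from `q` up to at least `768`, with certificates. -/
def rangeOK (sh : List (ℕ × ℕ)) : ℕ → List (ℕ × ℕ × ℕ × ℕ) → Bool
  | q, [] => (768).ble q
  | q, (q', j, a, R) :: l =>
    ((1).ble j && j.ble 40 && (1).ble a && (a % 2).beq 0 && (a + 37).ble q &&
      (q' ^ 256 * 2 ^ 4480).ble (2 ^ (7 * (R - 1)) * 128 ^ 256) && shellsOK q j a R sh) &&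
      rangeOK sh q' l

theorem hasDerivAt_logMean {ℓ s : ℝ} (h0 : s ≠ 0) (h1 : s ≠ ℓ) :
    HasDerivAt (logMean ℓ) ((Real.log s - Real.log (s - ℓ)) / ℓ) s := by
  have h2 : s - ℓ ≠ 0 := sub_ne_zero.2 h1
  have := (((Real.hasDerivAt_mul_log h0).sub
    ((Real.hasDerivAt_mul_log h2).comp s ((hasDerivAt_id s).sub_const ℓ))).div_const ℓ).sub_const 1
  have h3 : (Real.log s - Real.log (s - ℓ)) / ℓ =
      (Real.log s + 1 - (Real.log (s - ℓ) + 1) * 1) / ℓ := by ring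
  rw [h3]
  exact this

theorem continuous_logMean (ℓ : ℝ) : Continuous (logMean ℓ) :=
  ((Real.continuous_mul_log.sub
    (Real.continuous_mul_log.comp (continuous_id.sub continuous_const))).div_const ℓ).sub
      continuous_const

theorem logMean_le_logMean {ℓ x s : ℝ} (hℓ : 0 < ℓ) (hx : ℓ / 2 ≤ x) (h : x ≤ s) :
    logMean ℓ x ≤ logMean ℓ s := by
  have h1 : MonotoneOn (logMean ℓ) (Set.Icc (ℓ / 2) ℓ) := by
    refine monotoneOn_of_deriv_nonneg (convex_Icc _ _) (continuous_logMean ℓ).continuousOn ?_ ?_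
    · intro y hy
      rw [interior_Icc] at hy
      exact (hasDerivAt_logMean (by linarith [hy.1])
        hy.2.ne).differentiableAt.differentiableWithinAt
    · intro y hy
      rw [interior_Icc] at hy
      rw [(hasDerivAt_logMean (by linarith [hy.1]) hy.2.ne).deriv, ← Real.log_neg_eq_log (y - ℓ)]
      refine div_nonneg (sub_nonneg.2 (Real.log_le_log ?_ ?_)) hℓ.le <;> linarith [hy.1, hy.2]
  have h2 : MonotoneOn (logMean ℓ) (Set.Ici ℓ) := by
    refine monotoneOn_of_deriv_nonneg (convex_Ici _) (continuous_logMean ℓ).continuousOn ?_ ?_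
    · intro y hy
      rw [interior_Ici] at hy
      have hy' : ℓ < y := hy
      exact (hasDerivAt_logMean (by linarith) hy'.ne').differentiableAt.differentiableWithinAt
    · intro y hy
      rw [interior_Ici] at hy
      have hy' : ℓ < y := hy
      rw [(hasDerivAt_logMean (by linarith) hy'.ne').deriv]
      refine div_nonneg (sub_nonneg.2 (Real.log_le_log ?_ ?_)) hℓ.le <;> linarith
  rcases le_total s ℓ with hs | hs
  · exact h1 ⟨hx, h.trans hs⟩ ⟨hx.trans h, hs⟩ h
  · rcases le_total x ℓ with hx' | hx'
    · exact (h1 ⟨hx, hx'⟩ ⟨by linarith, le_rfl⟩ hx').trans (h2 (Set.mem_Ici.2 le_rfl) hs hs)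
    · exact h2 hx' hs h

theorem logMean_symm (ℓ s : ℝ) : logMean ℓ (ℓ - s) = logMean ℓ s := by
  have h : Real.log (ℓ - s) = Real.log (s - ℓ) := by rw [← neg_sub, Real.log_neg_eq_log]
  rw [logMean, logMean, h, show ℓ - s - ℓ = -s by ring, Real.log_neg_eq_log]
  ring

theorem logMean_half_le {ℓ : ℝ} (hℓ : 0 < ℓ) (s : ℝ) : logMean ℓ (ℓ / 2) ≤ logMean ℓ s := by
  rcases le_total (ℓ / 2) s with h | h
  · exact logMean_le_logMean hℓ le_rfl h
  · rw [← logMean_symm ℓ s]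
    exact logMean_le_logMean hℓ le_rfl (by linarith)

theorem logMean_self {ℓ : ℝ} (hℓ : 0 < ℓ) : logMean ℓ ℓ = Real.log ℓ - 1 := by
  rw [logMean, sub_self, zero_mul, sub_zero, mul_div_cancel_left₀ _ hℓ.ne']

/-- The lower bound for `logMean` certified by the number `k`. -/
noncomputable def certValue (k : ℝ) : ℝ := (k / 64 - 10) * Real.log 2

theorem logMean_div {a D : ℕ} (ha : 0 < a) (hD : 0 < D) (p : ℕ) :
    a * logMean (a / D) (p / D) = p * Real.log p - ((p : ℝ) - a) * Real.log ((p : ℝ) - a)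
      - a * Real.log D - a := by
  have hD' : (D : ℝ) ≠ 0 := by positivity
  have ha' : (a : ℝ) ≠ 0 := by positivity
  have key : ∀ x : ℝ, x / D * Real.log (x / D) = (x * Real.log x - x * Real.log D) / D := by
    intro x
    rcases eq_or_ne x 0 with rfl | hx
    · simp
    · rw [Real.log_div hx hD']
      ring
  rw [logMean, ← sub_div, key, key]
  field_simp
  ring

theorem certValue_le_of_logMeanCheck {a D p k : ℕ} (ha : 0 < a) (hD : 0 < D) (hp : a ≤ 2 * p)
    (h : logMeanCheck a D p k = true) : certValue k ≤ logMean (a / D) (p / D) := by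
  have hE : 1 ≤ Real.log 271829 - Real.log 100000 := by
    rw [← Real.log_div (by norm_num) (by norm_num), Real.le_log_iff_exp_le (by norm_num)]
    linarith [Real.exp_one_lt_d9]
  have hp0 : 0 < p := by omega
  have hpow : ∀ d : ℕ, ((d : ℝ) ^ (d * 64)) ≠ 0 ∧ 0 < d ^ (d * 64) := by
    intro d
    rcases Nat.eq_zero_or_pos d with rfl | hd
    · simp
    · constructor <;> positivity
  have hD' : (D : ℝ) ≠ 0 := by positivity
  have ha' : (0 : ℝ) < a := by positivity
  have main : a * certValue k ≤ a * logMean (a / D) (p / D) := by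
    rw [logMean_div ha hD, certValue]
    rw [logMeanCheck] at h
    rcases le_or_gt a p with hap | hap
    · rw [Nat.ble_eq_true_of_le hap, cond_true, Nat.ble_eq] at h
      have h1 := Real.log_le_log (by have := (hpow (p - a)).2; positivity)
        (Nat.cast_le (α := ℝ).2 h)
      push_cast at h1
      rw [Real.log_mul (by have := (hpow (p - a)).1; positivity) (by positivity),
        Real.log_mul (by have := (hpow (p - a)).1; positivity) (by positivity),
        Real.log_mul (hpow (p - a)).1 (by positivity),
        Real.log_mul (by positivity) (by positivity), Real.log_mul (by positivity) (by positivity)]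
        at h1
      simp only [Real.log_pow] at h1
      push_cast [Nat.cast_sub hap] at h1
      nlinarith [mul_le_mul_of_nonneg_left hE ha'.le]
    · have hble : a.ble p = false := by
        rw [← Bool.not_eq_true, Nat.ble_eq]; omega
      rw [hble, cond_false, Nat.ble_eq] at h
      have h1 := Real.log_le_log (by positivity) (Nat.cast_le (α := ℝ).2 h)
      push_cast at h1
      have h2 : ((a - p : ℕ) : ℝ) ≠ 0 := by
        have : 0 < a - p := by omega
        positivity
      rw [Real.log_mul (by positivity) (by positivity),
        Real.log_mul (by positivity) (by positivity),
        Real.log_mul (by positivity) (by positivity), Real.log_mul (by positivity) (by positivity),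
        Real.log_mul (by positivity) (by positivity)] at h1
      simp only [Real.log_pow] at h1
      rw [← Real.log_neg_eq_log ((p : ℝ) - a)]
      push_cast [Nat.cast_sub hap.le] at h1
      rw [neg_sub]
      nlinarith [mul_le_mul_of_nonneg_left hE ha'.le]
  exact le_of_mul_le_mul_left main ha'

theorem certValue_le_logMean {a D p k : ℕ} (ha : 0 < a) (hD : 0 < D) (hp : a ≤ 2 * p)
    (h : logMeanCheck a D p k = true) {s : ℝ} (hs : 2 * p = a ∨ (p : ℝ) / D ≤ s) :
    certValue k ≤ logMean (a / D) s := by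
  have ha' : (0 : ℝ) < a := by positivity
  have hD' : (0 : ℝ) < D := by positivity
  refine (certValue_le_of_logMeanCheck ha hD hp h).trans ?_
  rcases hs with hs | hs
  · have h2 : (p : ℝ) / D = a / D / 2 := by
      rw [← hs]
      push_cast
      ring
    rw [h2]
    exact logMean_half_le (div_pos ha' hD') s
  · refine logMean_le_logMean (div_pos ha' hD') ?_ hs
    have : (a : ℝ) ≤ 2 * p := by exact_mod_cast hp
    rw [div_div, div_le_div_iff₀ (by positivity) hD']
    nlinarith

theorem StepTree.certValue_lookup_le {T : StepTree} {p : ℕ} (hp : 50 ≤ p) (h : T.valid p = true)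
    {v : ℕ} {s : ℝ} (hs : 0 ≤ s) (hv : (v : ℝ) ≤ (1024 * s) ^ 2)
    (hps : p = 50 ∨ (p : ℝ) / 512 ≤ s) :
    certValue (T.lookup v) ≤ logMean (25 / 128) s := by
  induction T generalizing p with
  | leaf k =>
    rw [valid] at h
    rcases Nat.eq_zero_or_pos (p % 4) with h4 | h4
    · rw [h4] at h
      obtain ⟨q, rfl⟩ := Nat.dvd_of_mod_eq_zero h4
      rw [Nat.mul_div_cancel_left _ (by norm_num)] at h
      have := certValue_le_logMean (s := s) (by norm_num) (by norm_num) (by omega) h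
        (.inr ?_)
      · exact_mod_cast this
      · rcases hps with hps | hps
        · omega
        · push_cast at hps ⊢
          linarith
    · have h5 : (p % 4).beq 0 = false := by
        rw [← Bool.not_eq_true, Nat.beq_eq]; omega
      rw [h5, cond_false] at h
      have := certValue_le_logMean (s := s) (by norm_num) (by norm_num) (by omega) h
        (hps.imp (fun h => by omega) fun h => by exact_mod_cast h)
      change certValue k ≤ _
      convert this using 2
      norm_num
  | node q l r hl hr =>
    simp only [valid, Bool.and_eq_true, Nat.ble_eq] at h
    rw [lookup_node]
    rcases le_or_gt (4 * q * q) v with hq | hq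
    · rw [Nat.ble_eq_true_of_le hq, cond_true]
      refine hr h.1 h.2.2 (.inr ?_)
      have : (4 * q * q : ℝ) ≤ v := by exact_mod_cast hq
      have : (2 * q : ℝ) ≤ 1024 * s := abs_le_of_sq_le_sq' (by nlinarith) (by positivity) |>.2
      linarith
    · have hble : (4 * q * q).ble v = false := by
        rw [← Bool.not_eq_true, Nat.ble_eq]; omega
      rw [hble, cond_false]
      exact hl hp h.2.1 hps

section

/-- The point `z` is within `1 / 1024` of the given centre, in both coordinates. -/
def NearCell (c : ℕ × ℕ × ℕ) (z : ℂ) : Prop :=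
  |1024 * z.re + 8192 - c.2.1| ≤ 1 ∧ |1024 * z.im + 8192 - c.2.2| ≤ 1

/-- The weighted sum of means of logarithms on circles about the points `zs`. -/
noncomputable def potential (cs : List (ℕ × ℕ × ℕ)) (zs : List ℂ) (ξ : ℂ) : ℝ :=
  (List.zipWith (fun c z => (c.1 : ℝ) * logMean (25 / 128) ‖ξ - z‖) cs zs).sum

/-- The lower bound for a weighted sum of total weight `W` certified by the number `S`. -/
noncomputable def cellBound (W S : ℝ) : ℝ := (S / 64 - 10 * W) * Real.log 2

@[simp] theorem Nat.eager_eq {α : Type} (n : ℕ) (f : ℕ → α) : n.eager f = f n := by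
  cases n <;> rfl

theorem cast_gap_le {x L p : ℕ} {u v : ℝ} (h1 : x ≤ u) (h2 : u ≤ x + L) (h3 : |v - p| ≤ 1) :
    ((x - (p + 1) + (p - (x + L + 1)) : ℕ) : ℝ) ≤ |u - v| := by
  rw [abs_le] at h3
  rcases le_total x (p + 1) with h | h
  · rcases le_total p (x + L + 1) with h' | h'
    · rw [Nat.sub_eq_zero_of_le h, Nat.sub_eq_zero_of_le h']
      simp
    · rw [Nat.sub_eq_zero_of_le h, zero_add, Nat.cast_sub h', abs_sub_comm]
      refine le_trans ?_ (le_abs_self _)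
      push_cast
      linarith
  · rw [Nat.sub_eq_zero_of_le (show p ≤ x + L + 1 by omega), add_zero, Nat.cast_sub h]
    refine le_trans ?_ (le_abs_self _)
    push_cast
    linarith

theorem abs_le_cast_extent {x L : ℕ} {u : ℝ} (h1 : x ≤ u) (h2 : u ≤ x + L) :
    |u - 8192| ≤ ((8192 - x + (x + L - 8192) : ℕ) : ℝ) := by
  have h3 : (8192 : ℝ) - x ≤ (8192 - x : ℕ) := by
    rw [sub_le_iff_le_add]; exact_mod_cast (by omega : 8192 ≤ 8192 - x + x)
  have h4 : (x : ℝ) + L - 8192 ≤ (x + L - 8192 : ℕ) := by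
    rw [sub_le_iff_le_add]; exact_mod_cast (by omega : x + L ≤ x + L - 8192 + 8192)
  push_cast
  rw [abs_le]
  have h5 : (0 : ℝ) ≤ (8192 - x : ℕ) := Nat.cast_nonneg _
  have h6 : (0 : ℝ) ≤ (x + L - 8192 : ℕ) := Nat.cast_nonneg _
  constructor <;> linarith

variable {T : StepTree}

theorem cellBound_cellSum_le (hT : T.valid 50 = true) {cs : List (ℕ × ℕ × ℕ)} {zs : List ℂ}
    (hcs : List.Forall₂ NearCell cs zs) {x y L : ℕ} {ξ : ℂ}
    (hx : x ≤ 1024 * ξ.re + 8192) (hx' : 1024 * ξ.re + 8192 ≤ x + L)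
    (hy : y ≤ 1024 * ξ.im + 8192) (hy' : 1024 * ξ.im + 8192 ≤ y + L) :
    cellBound ((cs.map fun c => c.1).sum : ℕ) (cellSum T x y L cs) ≤ potential cs zs ξ := by
  induction hcs with
  | nil => simp [cellBound, potential, cellSum]
  | @cons c z cs zs h _ ih =>
    obtain ⟨w, p, q⟩ := c
    simp only [NearCell] at h
    rw [potential, List.zipWith_cons_cons, List.sum_cons, ← potential]
    simp only [List.map_cons, List.sum_cons, cellSum_cons, Nat.eager_eq]
    set v := (x - (p + 1) + (p - (x + L + 1))) ^ 2 + (y - (q + 1) + (q - (y + L + 1))) ^ 2 with hv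
    have key : certValue (T.lookup v) ≤ logMean (25 / 128) ‖ξ - z‖ := by
      refine StepTree.certValue_lookup_le le_rfl hT (norm_nonneg _) ?_ (.inl rfl)
      have h1 := cast_gap_le hx hx' h.1
      have h2 := cast_gap_le hy hy' h.2
      have h3 : (1024 * ‖ξ - z‖) ^ 2 = |1024 * ξ.re + 8192 - (1024 * z.re + 8192)| ^ 2 +
          |1024 * ξ.im + 8192 - (1024 * z.im + 8192)| ^ 2 := by
        rw [mul_pow, ← Complex.normSq_eq_norm_sq, Complex.normSq_apply, sq_abs, sq_abs,
          Complex.sub_re, Complex.sub_im]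
        ring
      rw [h3, hv]
      push_cast only [Nat.cast_add ((x - (p + 1) + (p - (x + L + 1))) ^ 2), Nat.cast_pow]
      gcongr
    have h4 := mul_le_mul_of_nonneg_left key (Nat.cast_nonneg (α := ℝ) w)
    rw [certValue] at h4
    rw [cellBound] at ih ⊢
    rw [Nat.cast_add, Nat.cast_add, Nat.cast_mul]
    linarith

theorem bound_of_cellOK (hT : T.valid 50 = true) {cs : List (ℕ × ℕ × ℕ)} {zs : List ℂ}
    (hcs : List.Forall₂ NearCell cs zs) {sh : List (ℕ × ℕ)} {x y L : ℕ} {ξ : ℂ}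
    (h : cellOK T cs sh L x y = true)
    (hx : x ≤ 1024 * ξ.re + 8192) (hx' : 1024 * ξ.re + 8192 ≤ x + L)
    (hy : y ≤ 1024 * ξ.im + 8192) (hy' : 1024 * ξ.im + 8192 ≤ y + L)
    {s : ℕ × ℕ} (hs : s ∈ sh) (hr : s.1 ≤ 32 * ‖ξ‖) :
    cellBound ((cs.map fun c => c.1).sum : ℕ) s.2 ≤ potential cs zs ξ := by
  simp only [cellOK, Nat.eager_eq, List.all_eq_true, Bool.or_eq_true, Nat.ble_eq] at h
  rcases h s hs with h | h
  · refine le_trans ?_ (cellBound_cellSum_le hT hcs hx hx' hy hy')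
    unfold cellBound
    have := Real.log_pos one_lt_two
    gcongr
  · exfalso
    have h1 := abs_le_cast_extent hx hx'
    have h2 := abs_le_cast_extent hy hy'
    have h3 : (1024 * ‖ξ‖) ^ 2 =
        |1024 * ξ.re + 8192 - 8192| ^ 2 + |1024 * ξ.im + 8192 - 8192| ^ 2 := by
      rw [mul_pow, ← Complex.normSq_eq_norm_sq, Complex.normSq_apply, sq_abs, sq_abs]
      ring
    have h4 : (((8192 - x + (x + L - 8192)) ^ 2 + (8192 - y + (y + L - 8192)) ^ 2 + 1 : ℕ) : ℝ) ≤
        ((32 * s.1) ^ 2 : ℕ) := Nat.cast_le.2 h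
    rw [Nat.cast_add, Nat.cast_add, Nat.cast_pow, Nat.cast_pow, Nat.cast_pow] at h4
    have h5 : ((32 * s.1 : ℕ) : ℝ) ≤ 1024 * ‖ξ‖ := by
      push_cast
      linarith
    have h6 := pow_le_pow_left₀ (Nat.cast_nonneg _) h5 2
    have h7 := pow_le_pow_left₀ (abs_nonneg _) h1 2
    have h8 := pow_le_pow_left₀ (abs_nonneg _) h2 2
    push_cast at h4 h6 h7 h8
    linarith

theorem bound_of_quadOK (hT : T.valid 50 = true) {cs : List (ℕ × ℕ × ℕ)} {zs : List ℂ}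
    (hcs : List.Forall₂ NearCell cs zs) {sh : List (ℕ × ℕ)} {k x y : ℕ} {ξ : ℂ}
    (h : quadOK T cs sh k x y = true)
    (hx : x ≤ 1024 * ξ.re + 8192) (hx' : 1024 * ξ.re + 8192 ≤ x + 2 ^ k)
    (hy : y ≤ 1024 * ξ.im + 8192) (hy' : 1024 * ξ.im + 8192 ≤ y + 2 ^ k)
    {s : ℕ × ℕ} (hs : s ∈ sh) (hr : s.1 ≤ 32 * ‖ξ‖) :
    cellBound ((cs.map fun c => c.1).sum : ℕ) s.2 ≤ potential cs zs ξ := by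
  induction k generalizing x y with
  | zero => exact bound_of_cellOK hT hcs h hx (by simpa using hx') hy (by simpa using hy') hs hr
  | succ k ih =>
    simp only [quadOK, Nat.eager_eq, Bool.or_eq_true, Bool.and_eq_true] at h
    rcases h with h | ⟨⟨h1, h2⟩, h3, h4⟩
    · exact bound_of_cellOK hT hcs h hx (by exact_mod_cast hx') hy (by exact_mod_cast hy') hs hr
    · rw [pow_succ] at hx' hy'
      rcases le_total (1024 * ξ.re + 8192) (x + 2 ^ k) with hxk | hxk <;>
      rcases le_total (1024 * ξ.im + 8192) (y + 2 ^ k) with hyk | hyk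
      · exact ih h1 hx hxk hy hyk
      · exact ih h3 hx hxk (by push_cast; exact hyk) (by push_cast; linarith)
      · exact ih h2 (by push_cast; exact hxk) (by push_cast; linarith) hy hyk
      · exact ih h4 (by push_cast; exact hxk) (by push_cast; linarith) (by push_cast; exact hyk)
          (by push_cast; linarith)

theorem bound_of_planeOK (hT : T.valid 50 = true) {cs : List (ℕ × ℕ × ℕ)} {zs : List ℂ}
    (hcs : List.Forall₂ NearCell cs zs) (hzs : ∀ z ∈ zs, ‖z‖ ≤ 6 / 5) {sh : List (ℕ × ℕ)}
    (h : planeOK T cs sh = true) {ξ : ℂ} {s : ℕ × ℕ} (hs : s ∈ sh) (hr : s.1 ≤ 32 * ‖ξ‖) :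
    cellBound ((cs.map fun c => c.1).sum : ℕ) s.2 ≤ potential cs zs ξ := by
  simp only [planeOK, Bool.and_eq_true, List.all_eq_true, Nat.ble_eq] at h
  rcases le_or_gt ‖ξ‖ 8 with hξ | hξ
  · have h1 := abs_le.1 ((Complex.abs_re_le_norm ξ).trans hξ)
    have h2 := abs_le.1 ((Complex.abs_im_le_norm ξ).trans hξ)
    exact bound_of_quadOK hT hcs h.1 (by push_cast; linarith) (by push_cast; linarith)
      (by push_cast; linarith) (by push_cast; linarith) hs hr
  · have h1 : cellBound ((cs.map fun c => c.1).sum : ℕ) s.2 ≤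
        cellBound ((cs.map fun c => c.1).sum : ℕ)
          ((cs.map fun c => c.1).sum * T.lookup (6800 ^ 2) : ℕ) := by
      have := h.2 s hs
      have := Real.log_pos one_lt_two
      unfold cellBound
      gcongr
    refine h1.trans ?_
    clear h1 h hs hr
    induction hcs with
    | nil => simp [cellBound, potential]
    | @cons c z cs zs hc _ ih =>
      have h2 := ih fun z hz => hzs z (List.mem_cons_of_mem _ hz)
      have h3 := hzs z List.mem_cons_self
      have h4 : certValue (T.lookup (6800 ^ 2)) ≤ logMean (25 / 128) ‖ξ - z‖ := by
        refine StepTree.certValue_lookup_le le_rfl hT (norm_nonneg _) ?_ (.inl rfl)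
        have := norm_sub_norm_le ξ z
        have h7 : (6800 : ℝ) ≤ 1024 * ‖ξ - z‖ := by linarith
        have := pow_le_pow_left₀ (by norm_num) h7 2
        exact_mod_cast this
      have h5 := mul_le_mul_of_nonneg_left h4 (Nat.cast_nonneg (α := ℝ) c.1)
      rw [potential, List.zipWith_cons_cons, List.sum_cons, ← potential]
      rw [certValue] at h5
      rw [cellBound] at h2 ⊢
      simp only [List.map_cons, List.sum_cons, Nat.cast_add, Nat.cast_mul] at h2 h5 ⊢
      linarith

end

/-- Certified values of `logMean (25 / 128)`. -/
def logMeanTree : StepTree :=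
  .node 292 (.node 129 (.node 99 (.node 86 (.node 75 (.node 67 (.node 58 (.leaf 332) (.node 63
  (.leaf 334) (.leaf 336))) (.node 70 (.leaf 338) (.node 72 (.leaf 340) (.leaf 342)))) (.node 81
  (.node 77 (.leaf 344) (.node 79 (.leaf 347) (.leaf 349))) (.node 82 (.leaf 351) (.node 84 (.leaf
  353) (.leaf 356))))) (.node 93 (.node 90 (.node 87 (.leaf 359) (.node 89 (.leaf 361) (.leaf
  364))) (.node 91 (.leaf 366) (.node 92 (.leaf 368) (.leaf 371)))) (.node 96 (.node 94 (.leaf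
  373) (.node 95 (.leaf 375) (.leaf 378))) (.node 97 (.leaf 381) (.node 98 (.leaf 384) (.leaf
  387)))))) (.node 111 (.node 105 (.node 102 (.node 100 (.leaf 391) (.node 101 (.leaf 396) (.leaf
  402))) (.node 103 (.leaf 405) (.node 104 (.leaf 409) (.leaf 412)))) (.node 108 (.node 106 (.leaf
  415) (.node 107 (.leaf 418) (.leaf 420))) (.node 109 (.leaf 423) (.node 110 (.leaf 425) (.leaf
  427))))) (.node 118 (.node 114 (.node 112 (.leaf 429) (.node 113 (.leaf 432) (.leaf 434)))
  (.node 116 (.leaf 436) (.node 117 (.leaf 439) (.leaf 441)))) (.node 122 (.node 119 (.leaf 443)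
  (.node 121 (.leaf 445) (.leaf 448))) (.node 126 (.node 124 (.leaf 450) (.leaf 453)) (.node 128
  (.leaf 456) (.leaf 458))))))) (.node 185 (.node 153 (.node 141 (.node 135 (.node 131 (.leaf 460)
  (.node 133 (.leaf 463) (.leaf 465))) (.node 137 (.leaf 468) (.node 139 (.leaf 470) (.leaf
  473)))) (.node 147 (.node 143 (.leaf 475) (.node 145 (.leaf 477) (.leaf 479))) (.node 149 (.leaf
  481) (.node 151 (.leaf 484) (.leaf 486))))) (.node 167 (.node 160 (.node 156 (.leaf 488) (.node
  158 (.leaf 490) (.leaf 492))) (.node 162 (.leaf 494) (.node 164 (.leaf 496) (.leaf 498))))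
  (.node 174 (.node 169 (.leaf 500) (.node 171 (.leaf 502) (.leaf 504))) (.node 179 (.node 177
  (.leaf 506) (.leaf 508)) (.node 182 (.leaf 510) (.leaf 512)))))) (.node 228 (.node 204 (.node
  193 (.node 187 (.leaf 514) (.node 190 (.leaf 516) (.leaf 518))) (.node 196 (.leaf 520) (.node
  199 (.leaf 522) (.leaf 524)))) (.node 216 (.node 208 (.leaf 527) (.node 212 (.leaf 529) (.leaf
  532))) (.node 220 (.leaf 534) (.node 224 (.leaf 536) (.leaf 539))))) (.node 252 (.node 240
  (.node 232 (.leaf 541) (.node 236 (.leaf 543) (.leaf 545))) (.node 244 (.leaf 547) (.node 248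
  (.leaf 549) (.leaf 551)))) (.node 268 (.node 256 (.leaf 553) (.node 264 (.leaf 555) (.leaf
  558))) (.node 280 (.node 272 (.leaf 560) (.leaf 562)) (.node 288 (.leaf 565) (.leaf 568))))))))
  (.node 784 (.node 480 (.node 380 (.node 336 (.node 316 (.node 300 (.leaf 570) (.node 308 (.leaf
  573) (.leaf 576))) (.node 320 (.leaf 578) (.node 328 (.leaf 580) (.leaf 583)))) (.node 356
  (.node 340 (.leaf 585) (.node 348 (.leaf 587) (.leaf 589))) (.node 364 (.leaf 592) (.node 372
  (.leaf 594) (.leaf 596))))) (.node 428 (.node 404 (.node 388 (.leaf 599) (.node 396 (.leaf 601)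
  (.leaf 603))) (.node 412 (.leaf 605) (.node 420 (.leaf 607) (.leaf 609)))) (.node 452 (.node 436
  (.leaf 611) (.node 444 (.leaf 613) (.leaf 615))) (.node 460 (.leaf 617) (.node 468 (.leaf 619)
  (.leaf 621)))))) (.node 604 (.node 536 (.node 508 (.node 488 (.leaf 623) (.node 496 (.leaf 625)
  (.leaf 627))) (.node 516 (.leaf 629) (.node 528 (.leaf 631) (.leaf 633)))) (.node 572 (.node 548
  (.leaf 635) (.node 560 (.leaf 637) (.leaf 639))) (.node 580 (.leaf 641) (.node 592 (.leaf 643)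
  (.leaf 645))))) (.node 680 (.node 644 (.node 616 (.leaf 647) (.node 628 (.leaf 649) (.leaf
  651))) (.node 656 (.leaf 653) (.node 668 (.leaf 655) (.leaf 657)))) (.node 724 (.node 696 (.leaf
  659) (.node 708 (.leaf 661) (.leaf 663))) (.node 752 (.node 740 (.leaf 665) (.leaf 667)) (.node
  768 (.leaf 669) (.leaf 671))))))) (.node 1368 (.node 1000 (.node 888 (.node 832 (.node 800
  (.leaf 673) (.node 816 (.leaf 675) (.leaf 677))) (.node 852 (.leaf 679) (.node 868 (.leaf 681)
  (.leaf 683)))) (.node 944 (.node 904 (.leaf 685) (.node 924 (.leaf 687) (.leaf 689))) (.node 960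
  (.leaf 691) (.node 980 (.leaf 693) (.leaf 695))))) (.node 1132 (.node 1064 (.node 1024 (.leaf
  697) (.node 1044 (.leaf 699) (.leaf 701))) (.node 1088 (.leaf 703) (.node 1112 (.leaf 705)
  (.leaf 707)))) (.node 1208 (.node 1156 (.leaf 709) (.node 1180 (.leaf 711) (.leaf 713))) (.node
  1256 (.node 1232 (.leaf 715) (.leaf 717)) (.node 1312 (.leaf 719) (.leaf 723)))))) (.node 2260
  (.node 1756 (.node 1548 (.node 1424 (.leaf 727) (.node 1484 (.leaf 731) (.leaf 735))) (.node
  1616 (.leaf 739) (.node 1684 (.leaf 743) (.leaf 747)))) (.node 1992 (.node 1832 (.leaf 751)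
  (.node 1912 (.leaf 755) (.leaf 759))) (.node 2080 (.leaf 763) (.node 2168 (.leaf 767) (.leaf
  771))))) (.node 2916 (.node 2568 (.node 2360 (.leaf 775) (.node 2460 (.leaf 779) (.leaf 783)))
  (.node 2680 (.leaf 787) (.node 2796 (.leaf 791) (.leaf 795)))) (.node 3316 (.node 3044 (.leaf
  799) (.node 3176 (.leaf 803) (.leaf 807))) (.node 3612 (.node 3460 (.leaf 811) (.leaf 815))
  (.node 3768 (.leaf 819) (.leaf 823))))))))

/-- Weights and approximate coordinates of the roots of `X ^ 7 - X ^ 3 - 1`, in units of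
`1 / 1024` and shifted by `8192`. -/
def rootCells : List (ℕ × ℕ × ℕ) :=
  [(5, 9357, 8192), (5, 8051, 9308), (5, 8051, 7076), (4, 7238, 8487), (4, 7238, 7897), (4, 8704,
  8927), (4, 8704, 7457)]

/-- Lower bounds for the weighted sum outside discs around the origin. -/
def shells : List (ℕ × ℕ) :=
  [(0, 18809), (36, 18933), (40, 19139), (42, 19380), (43, 19675), (45, 20031), (48, 20371), (51,
  20632), (54, 20853), (58, 21110), (61, 21283), (64, 21444), (70, 21734), (77, 22035), (86,
  22376), (96, 22711), (112, 23174), (128, 23572), (160, 24230), (192, 24765)]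

theorem logMeanTree_valid : logMeanTree.valid 50 = true := by decide +kernel

theorem planeOK_shells : planeOK logMeanTree rootCells shells = true := by decide +kernel

theorem planeOK_drop : ((List.range 7).all fun j =>
    planeOK logMeanTree (rootCells.modify j fun c => (0, c.2))
      [(0, bif j.ble 2 then 15199 else 15784)]) = true := by decide +kernel

/-- Interval ends of `32 * ‖t‖`, weights, radii and resulting bounds. -/
def ranges : List (ℕ × ℕ × ℕ × ℕ) :=
  [(68, 6, 2, 608), (72, 8, 4, 611), (76, 9, 8, 614), (80, 9, 6, 617), (84, 10, 10, 619), (87, 10,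
  8, 621), (91, 10, 10, 623), (95, 11, 14, 626), (99, 12, 20, 628), (103, 13, 26, 630), (107, 12,
  18, 632), (113, 13, 24, 635), (119, 13, 24, 638), (128, 14, 32, 641), (137, 15, 40, 645), (150,
  16, 52, 650), (163, 15, 40, 654), (182, 16, 52, 660), (210, 18, 82, 668), (252, 19, 104, 677),
  (315, 19, 106, 689), (456, 21, 158, 709), (772, 25, 348, 736)]

theorem rangeOK_ranges : rangeOK shells 64 ranges = true := by decide +kernel

theorem splits_septic : (X ^ 7 - X ^ 3 - 1 : ℂ[X]).Splits := IsAlgClosed.splits _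

theorem monic_septic : (X ^ 7 - X ^ 3 - 1 : ℂ[X]).Monic := by monicity!

theorem natDegree_septic : (X ^ 7 - X ^ 3 - 1 : ℂ[X]).natDegree = 7 := by compute_degree!

/-- A point where `X ^ 7 - X ^ 3 - 1` is small is close to a root. -/
theorem exists_septic_root_near {c : ℂ} {ε : ℝ} (hε : 0 ≤ ε)
    (h : ‖c ^ 7 - c ^ 3 - 1‖ ^ 2 < ε ^ 14) :
    ∃ z : ℂ, z ^ 7 - z ^ 3 - 1 = 0 ∧ ‖z - c‖ ≤ ε := by
  by_contra! hne
  have hcard : (X ^ 7 - X ^ 3 - 1 : ℂ[X]).roots.card = 7 := by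
    rw [← splits_septic.natDegree_eq_card_roots, natDegree_septic]
  have key : ∀ s : Multiset ℂ, (∀ z ∈ s, ε < ‖z - c‖) →
      ε ^ s.card ≤ ‖(s.map fun z => c - z).prod‖ := by
    intro s
    induction s using Multiset.induction with
    | empty => simp
    | cons z s ih =>
      intro h
      rw [Multiset.card_cons, pow_succ', Multiset.map_cons, Multiset.prod_cons, norm_mul,
        norm_sub_rev]
      exact mul_le_mul (h z (Multiset.mem_cons_self _ _)).le
        (ih fun w hw => h w (Multiset.mem_cons_of_mem hw)) (by positivity) (norm_nonneg _)
  have h1 := key (X ^ 7 - X ^ 3 - 1 : ℂ[X]).roots fun z hz =>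
    hne z (by simpa using isRoot_of_mem_roots hz)
  rw [hcard, ← splits_septic.eval_eq_prod_roots_of_monic monic_septic] at h1
  simp only [eval_sub, eval_pow, eval_X, eval_one] at h1
  have h2 := pow_le_pow_left₀ (by positivity) h1 2
  rw [← pow_mul] at h2
  exact absurd (h2.trans_lt h) (lt_irrefl _)

/-- The cell containing each root of `X ^ 7 - X ^ 3 - 1`, with its weight. -/
def rootCell : Fin 7 → ℕ × ℕ × ℕ :=
  ![(5, 9357, 8192), (5, 8051, 9308), (5, 8051, 7076), (4, 7238, 8487), (4, 7238, 7897),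
    (4, 8704, 8927), (4, 8704, 7457)]

theorem exists_root_near_rootCell (i : Fin 7) :
    ∃ z : ℂ, z ^ 7 - z ^ 3 - 1 = 0 ∧ NearCell (rootCell i) z := by
  have key : ∀ (a b : ℝ) (p q : ℕ), ‖(⟨a, b⟩ : ℂ) ^ 7 - ⟨a, b⟩ ^ 3 - 1‖ ^ 2 < (1 / 2048) ^ 14 →
      |1024 * a + 8192 - p| ≤ 1 / 2 → |1024 * b + 8192 - q| ≤ 1 / 2 →
      ∃ z : ℂ, z ^ 7 - z ^ 3 - 1 = 0 ∧
        |1024 * z.re + 8192 - p| ≤ 1 ∧ |1024 * z.im + 8192 - q| ≤ 1 := by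
    intro a b p q h ha hb
    obtain ⟨z, hz, hz'⟩ := exists_septic_root_near (by norm_num) h
    have h1 := abs_le.1 ((Complex.abs_re_le_norm _).trans hz')
    have h2 := abs_le.1 ((Complex.abs_im_le_norm _).trans hz')
    simp only [Complex.sub_re, Complex.sub_im] at h1 h2
    rw [abs_le] at ha hb
    refine ⟨z, hz, ?_⟩
    simp only [abs_le]
    constructor <;> constructor <;> linarith
  have norm_eq : ∀ a b : ℝ, ‖(⟨a, b⟩ : ℂ) ^ 7 - ⟨a, b⟩ ^ 3 - 1‖ ^ 2 =
      (a ^ 7 - 21 * a ^ 5 * b ^ 2 + 35 * a ^ 3 * b ^ 4 - 7 * a * b ^ 6 - a ^ 3 +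
        3 * a * b ^ 2 - 1) ^ 2
      + (7 * a ^ 6 * b - 35 * a ^ 4 * b ^ 3 + 21 * a ^ 2 * b ^ 5 - b ^ 7 - 3 * a ^ 2 * b +
        b ^ 3) ^ 2 := by
    intro a b
    rw [← Complex.normSq_eq_norm_sq, Complex.normSq_apply]
    simp only [pow_succ, pow_zero, Complex.sub_re, Complex.sub_im, Complex.mul_re, Complex.mul_im,
      Complex.one_re, Complex.one_im]
    ring
  have upper : ∀ (a b : ℝ) (p q : ℕ), (a ^ 7 - 21 * a ^ 5 * b ^ 2 + 35 * a ^ 3 * b ^ 4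
      - 7 * a * b ^ 6 - a ^ 3 + 3 * a * b ^ 2 - 1) ^ 2
      + (7 * a ^ 6 * b - 35 * a ^ 4 * b ^ 3 + 21 * a ^ 2 * b ^ 5 - b ^ 7 - 3 * a ^ 2 * b +
        b ^ 3) ^ 2
        < (1 / 2048) ^ 14 →
      |1024 * a + 8192 - p| ≤ 1 / 2 → |1024 * b + 8192 - q| ≤ 1 / 2 →
      ∃ z : ℂ, z ^ 7 - z ^ 3 - 1 = 0 ∧
        |1024 * z.re + 8192 - p| ≤ 1 ∧ |1024 * z.im + 8192 - q| ≤ 1 :=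
    fun a b p q h => key a b p q (by rw [norm_eq]; exact h)
  fin_cases i
  · exact upper (1138181861071134333257869088 / 10 ^ 27) 0 9357 8192
      (by norm_num) (by norm_num [abs_le]) (by norm_num [abs_le])
  · exact upper (-137539991413431657937477338 / 10 ^ 27) (1090036326702900817590266465 / 10 ^ 27)
      8051 9308 (by norm_num) (by norm_num [abs_le]) (by norm_num [abs_le])
  · exact upper (-137539991413431657937477338 / 10 ^ 27) (-1090036326702900817590266465 / 10 ^ 27)
      8051 7076 (by norm_num) (by norm_num [abs_le]) (by norm_num [abs_le])
  · exact upper (-931971677392896499921181290 / 10 ^ 27) (287914242913593927225848836 / 10 ^ 27)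
      7238 8487 (by norm_num) (by norm_num [abs_le]) (by norm_num [abs_le])
  · exact upper (-931971677392896499921181290 / 10 ^ 27) (-287914242913593927225848836 / 10 ^ 27)
      7238 7897 (by norm_num) (by norm_num [abs_le]) (by norm_num [abs_le])
  · exact upper (500420738270760991229724084 / 10 ^ 27) (717331542331162131328201377 / 10 ^ 27)
      8704 8927 (by norm_num) (by norm_num [abs_le]) (by norm_num [abs_le])
  · exact upper (500420738270760991229724084 / 10 ^ 27) (-717331542331162131328201377 / 10 ^ 27)
      8704 7457 (by norm_num) (by norm_num [abs_le]) (by norm_num [abs_le])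

theorem le_norm_sub_of_nearCell {i j : Fin 7} (hij : i ≠ j) {z w : ℂ} (hz : NearCell (rootCell i) z)
    (hw : NearCell (rootCell j) w) : 25 / 64 ≤ ‖z - w‖ := by
  have key : ∀ i j : Fin 7, i ≠ j →
      500 ≤ |((rootCell i).2.1 : ℤ) - (rootCell j).2.1| ∨
      500 ≤ |((rootCell i).2.2 : ℤ) - (rootCell j).2.2| := by decide +kernel
  simp only [NearCell, abs_le] at hz hw
  rcases key i j hij with h | h
  · refine le_trans ?_ (Complex.abs_re_le_norm _)
    have h' : (500 : ℝ) ≤ |((rootCell i).2.1 : ℝ) - (rootCell j).2.1| := by exact_mod_cast h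
    rw [Complex.sub_re]
    rw [le_abs] at h' ⊢
    rcases h' with h' | h'
    · left; linarith
    · right; linarith
  · refine le_trans ?_ (Complex.abs_im_le_norm _)
    have h' : (500 : ℝ) ≤ |((rootCell i).2.2 : ℝ) - (rootCell j).2.2| := by exact_mod_cast h
    rw [Complex.sub_im]
    rw [le_abs] at h' ⊢
    rcases h' with h' | h'
    · left; linarith
    · right; linarith

theorem norm_le_of_nearCell {i : Fin 7} {z : ℂ} (hz : NearCell (rootCell i) z) :
    ‖z‖ ≤ 57 / 50 := by
  have key : ∀ i : Fin 7, (|((rootCell i).2.1 : ℤ) - 8192| + 1) ^ 2 +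
      (|((rootCell i).2.2 : ℤ) - 8192| + 1) ^ 2 ≤ 1167 ^ 2 := by decide +kernel
  have h : (|((rootCell i).2.1 : ℝ) - 8192| + 1) ^ 2 +
      (|((rootCell i).2.2 : ℝ) - 8192| + 1) ^ 2 ≤ 1167 ^ 2 := by exact_mod_cast key i
  have h1 : |1024 * z.re| ≤ |((rootCell i).2.1 : ℝ) - 8192| + 1 := by
    have := abs_add_le (1024 * z.re + 8192 - (rootCell i).2.1) (((rootCell i).2.1 : ℝ) - 8192)
    have h3 := hz.1
    rw [show 1024 * z.re + 8192 - ((rootCell i).2.1 : ℝ) + (((rootCell i).2.1 : ℝ) - 8192) =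
      1024 * z.re by ring] at this
    linarith
  have h2 : |1024 * z.im| ≤ |((rootCell i).2.2 : ℝ) - 8192| + 1 := by
    have := abs_add_le (1024 * z.im + 8192 - (rootCell i).2.2) (((rootCell i).2.2 : ℝ) - 8192)
    have h3 := hz.2
    rw [show 1024 * z.im + 8192 - ((rootCell i).2.2 : ℝ) + (((rootCell i).2.2 : ℝ) - 8192) =
      1024 * z.im by ring] at this
    linarith
  have h4 := pow_le_pow_left₀ (abs_nonneg _) h1 2
  have h5 := pow_le_pow_left₀ (abs_nonneg _) h2 2
  rw [sq_abs] at h4 h5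
  have h6 : ‖z‖ ^ 2 = z.re ^ 2 + z.im ^ 2 := by
    rw [← Complex.normSq_eq_norm_sq, Complex.normSq_apply]
    ring
  refine abs_le_of_sq_le_sq' ?_ (by norm_num) |>.2
  rw [h6]
  nlinarith

/-- The roots of `X ^ 7 - X ^ 3 - 1`, indexed by their cells. -/
theorem exists_septic_roots : ∃ e : Fin 7 → ℂ,
    (X ^ 7 - X ^ 3 - 1 : ℂ[X]) = ∏ i, (X - C (e i)) ∧ ∀ i, NearCell (rootCell i) (e i) := by
  choose e he hcell using exists_root_near_rootCell
  refine ⟨e, ?_, hcell⟩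
  have hinj : Function.Injective e := by
    intro i j hij
    by_contra hne
    have := le_norm_sub_of_nearCell hne (hcell i) (hcell j)
    rw [hij, sub_self, norm_zero] at this
    norm_num at this
  have hdvd : ∏ i, (X - C (e i)) ∣ (X ^ 7 - X ^ 3 - 1 : ℂ[X]) := by
    refine Finset.prod_dvd_of_coprime ?_ ?_
    · intro i _ j _ hij
      exact pairwise_coprime_X_sub_C hinj hij
    · intro i _
      rw [dvd_iff_isRoot]
      simp [IsRoot, he i]
  refine eq_of_monic_of_dvd_of_natDegree_le (monic_prod_of_monic _ _ fun i _ => monic_X_sub_C _)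
    monic_septic hdvd ?_
  rw [natDegree_septic, natDegree_prod_of_monic _ _ fun i _ => monic_X_sub_C _]
  simp

/-- A convex combination of upper bounds for sums over a multiset. -/
theorem add_card_mul_le_of_convex {ι : Type*} [Fintype ι] {u : ι → ℝ} (hu : ∀ i, 0 ≤ u i)
    (hsum : ∑ i, u i = 1) {φ : ι → ℂ → ℝ} {s : Multiset ℂ} {A M K : ℝ}
    (h : ∀ i, u i ≠ 0 → A + (s.map (φ i)).sum ≤ M) (hK : ∀ ξ, K ≤ ∑ i, u i * φ i ξ) :
    A + s.card * K ≤ M := by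
  have h1 : (s.card : ℝ) * K ≤ ∑ i, u i * (s.map (φ i)).sum := by
    clear h
    induction s using Multiset.induction with
    | empty => simp
    | cons ξ s ih =>
      simp only [Multiset.card_cons, Multiset.map_cons, Multiset.sum_cons, mul_add,
        Finset.sum_add_distrib]
      push_cast
      linarith [hK ξ]
  have h2 : ∑ i, u i * (A + (s.map (φ i)).sum) ≤ ∑ i, u i * M := by
    refine Finset.sum_le_sum fun i _ => ?_
    rcases eq_or_ne (u i) 0 with h0 | h0
    · simp [h0]
    · exact mul_le_mul_of_nonneg_left (h i h0) (hu i)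
  simp only [mul_add, Finset.sum_add_distrib, ← Finset.sum_mul, hsum, one_mul] at h2
  linarith

theorem eval_prod_X_sub_C {ι : Type*} (s : Finset ι) (e : ι → ℂ) (z : ℂ) :
    (∏ i ∈ s, (X - C (e i))).eval z = ∏ i ∈ s, (z - e i) := by
  simp [eval_prod]

section Solution

variable {t : ℂ} {a b : ℂ[X]} (hb : b ≠ 0)
  (h : a ^ 2 - (X - C t) * (X ^ 7 - X ^ 3 - 1) * b ^ 2 = 1 + 4 * X)
include hb h

theorem solution_leading : a.natDegree = b.natDegree + 4 ∧
    ‖a.leadingCoeff‖ = ‖b.leadingCoeff‖ := by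
  have hm : ((X - C t) * (X ^ 7 - X ^ 3 - 1)).Monic := (monic_X_sub_C t).mul monic_septic
  have hd : ((X - C t) * (X ^ 7 - X ^ 3 - 1)).natDegree = 8 := by
    rw [(monic_X_sub_C t).natDegree_mul monic_septic, natDegree_X_sub_C, natDegree_septic]
  have h1 : ((X - C t) * (X ^ 7 - X ^ 3 - 1) * b ^ 2).natDegree = 8 + 2 * b.natDegree := by
    rw [hm.natDegree_mul' (pow_ne_zero 2 hb), hd, natDegree_pow]
  have h2 : (1 + 4 * X : ℂ[X]).natDegree ≤ 1 := by compute_degree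
  have h3 : a ^ 2 = (1 + 4 * X) + (X - C t) * (X ^ 7 - X ^ 3 - 1) * b ^ 2 := by
    rw [← h]; ring
  have hlt : (1 + 4 * X : ℂ[X]).natDegree <
      ((X - C t) * (X ^ 7 - X ^ 3 - 1) * b ^ 2).natDegree := by omega
  have h4 := congrArg natDegree h3
  rw [natDegree_add_eq_right_of_natDegree_lt hlt, natDegree_pow, h1] at h4
  refine ⟨by omega, ?_⟩
  have h5 := congrArg leadingCoeff h3
  rw [leadingCoeff_add_of_degree_lt (degree_lt_degree hlt), leadingCoeff_pow, leadingCoeff_mul,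
    hm.leadingCoeff, one_mul, leadingCoeff_pow] at h5
  have h6 := congrArg norm h5
  rw [norm_pow, norm_pow] at h6
  exact (pow_left_inj₀ (norm_nonneg _) (norm_nonneg _) two_ne_zero).1 h6

theorem log_add_sum_le {c : ℂ} {ℓ : ℝ} (hℓ : 0 < ℓ) {s : Multiset ℂ}
    (hD : ∀ z, ((X - C t) * (X ^ 7 - X ^ 3 - 1)).eval z = (z - c) * (s.map fun d => z - d).prod)
    (hs : ∀ d ∈ s, ℓ ≤ ‖d - c‖) {M : ℝ} (hM : 4 * (‖c‖ + ℓ) + 1 ≤ M) :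
    Real.log ‖b.leadingCoeff‖ + (a.roots.map fun ξ => logMean ℓ ‖ξ - c‖).sum ≤ Real.log M / 2 := by
  have ha : a ≠ 0 := by
    rintro rfl
    have := (solution_leading hb h).1
    simp at this
  rw [← (solution_leading hb h).2]
  refine log_leadingCoeff_add_sum_logMean_le ha hℓ fun r hr hrℓ => ?_
  obtain ⟨z, hz, hz'⟩ := exists_norm_sq_le_on_circle hr hD (fun d hd => hrℓ.trans_le (hs d hd)) h
  refine ⟨z, hz, hz'.trans ?_⟩
  have h1 : ‖z‖ ≤ ‖c‖ + r := by
    have := norm_add_le c (z - c)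
    rw [add_sub_cancel, hz] at this
    exact this
  have h2 := norm_add_le (1 : ℂ) (4 * z)
  simp only [eval_add, eval_one, eval_mul, eval_X, eval_ofNat]
  rw [norm_mul, norm_one, Complex.norm_ofNat] at h2
  linarith

theorem log_add_mul_le_of_weights {e : Fin 7 → ℂ}
    (hf : (X ^ 7 - X ^ 3 - 1 : ℂ[X]) = ∏ i, (X - C (e i)))
    (he : ∀ i, NearCell (rootCell i) (e i)) {u : Fin 7 → ℝ} {v ℓ K : ℝ} (hu : ∀ i, 0 ≤ u i)
    (hv : 0 ≤ v) (hsum : ∑ i, u i + v = 1) (hE : ∀ i, u i ≠ 0 → 25 / 128 ≤ ‖t - e i‖)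
    (hV : v ≠ 0 → 0 < ℓ ∧ ℓ ≤ ‖t‖ ∧ ∀ i, ℓ ≤ ‖t - e i‖)
    (hK : ∀ ξ, K ≤ ∑ i, u i * logMean (25 / 128) ‖ξ - e i‖ + v * logMean ℓ ‖ξ - t‖) :
    Real.log ‖b.leadingCoeff‖ + (b.natDegree + 4 : ℕ) * K ≤ Real.log (8 * ‖t‖ + 20) / 2 := by
  rw [← (solution_leading hb h).1, (IsAlgClosed.splits a).natDegree_eq_card_roots]
  refine add_card_mul_le_of_convex (ι := Option (Fin 7)) (u := fun i => i.elim v u)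
    (φ := fun i ξ => i.elim (logMean ℓ ‖ξ - t‖) fun i => logMean (25 / 128) ‖ξ - e i‖) ?_ ?_ ?_ ?_
  · rintro (_ | i)
    exacts [hv, hu i]
  · simpa [Fintype.sum_option, add_comm] using hsum
  · rintro (_ | i) hi
    · obtain ⟨h0, h1, h2⟩ := hV hi
      refine log_add_sum_le hb h h0 (s := (Finset.univ.val.map e)) ?_ ?_ ?_
      · intro z
        rw [hf, Multiset.map_map, eval_mul, eval_prod_X_sub_C, eval_sub, eval_X, eval_C]
        rfl
      · intro d hd
        obtain ⟨j, -, rfl⟩ := Multiset.mem_map.1 hd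
        rw [norm_sub_rev]
        exact h2 j
      · linarith [norm_nonneg t]
    · refine log_add_sum_le hb h (by norm_num)
        (s := t ::ₘ ((Finset.univ.erase i).val.map e)) ?_ ?_ ?_
      · intro z
        rw [hf, Multiset.map_cons, Multiset.map_map, Multiset.prod_cons,
          ← Finset.mul_prod_erase _ _ (Finset.mem_univ i), eval_mul, eval_mul, eval_prod_X_sub_C,
          eval_sub, eval_X, eval_C, eval_sub, eval_X, eval_C, mul_left_comm]
        rfl
      · intro d hd
        rw [Multiset.mem_cons] at hd
        rcases hd with rfl | hd
        · exact hE i hi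
        · obtain ⟨j, hj, rfl⟩ := Multiset.mem_map.1 hd
          have hji : j ∈ Finset.univ.erase i := hj
          have := le_norm_sub_of_nearCell (Finset.ne_of_mem_erase hji) (he j) (he i)
          linarith
      · linarith [norm_nonneg t, norm_le_of_nearCell (he i)]
  · intro ξ
    simpa [Fintype.sum_option, add_comm] using hK ξ

end Solution

theorem exists_shell_of_shellsOK {q j a R : ℕ} (hj : 1 ≤ j) (hj' : j ≤ 40) (ha : 1 ≤ a)
    (ha' : a % 2 = 0) {sh : List (ℕ × ℕ)} (h : shellsOK q j a R sh = true) {s d : ℝ}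
    (hd : q ≤ 32 * (s + d)) (hsh : ∃ r ∈ sh.head?, (r.1 : ℝ) ≤ 32 * s) :
    ∃ r ∈ sh, (r.1 : ℝ) ≤ 32 * s ∧
      (1240 * R : ℝ) / 64 * Real.log 2 ≤
        (40 - j) * (r.2 : ℝ) / 64 * Real.log 2 +
          31 * j * (logMean (a / 32) d + 10 * Real.log 2) := by
  have hl2 := Real.log_pos one_lt_two
  have final : ∀ g p : ℕ, a ≤ 2 * p →
      logMeanCheck a 32 p ((1240 * R - (40 - j) * g + 31 * j - 1) / (31 * j)) = true →
      (2 * p = a ∨ (p : ℝ) / (32 : ℕ) ≤ d) →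
      (1240 * R : ℝ) / 64 * Real.log 2 ≤
        (40 - j) * (g : ℝ) / 64 * Real.log 2 +
          31 * j * (logMean (a / 32) d + 10 * Real.log 2) := by
    intro g p hp h1 h2
    have h3 := certValue_le_logMean ha (by norm_num) hp h1 h2
    set k := (1240 * R - (40 - j) * g + 31 * j - 1) / (31 * j) with hk
    have h4 : 1240 * R ≤ (40 - j) * g + 31 * j * k := by
      have h5 := Nat.lt_div_mul_add (a := 1240 * R - (40 - j) * g + 31 * j - 1)
        (b := 31 * j) (by omega)
      rw [← hk, mul_comm k] at h5
      generalize (40 - j) * g = x at *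
      generalize 31 * j * k = y at *
      omega
    have h6 : (1240 * R : ℝ) ≤ (40 - j) * g + 31 * j * k := by
      have := Nat.cast_le (α := ℝ).2 h4
      push_cast [Nat.cast_sub hj'] at this
      exact this
    rw [certValue] at h3
    have h7 := mul_le_mul_of_nonneg_right h6 hl2.le
    have h8 := mul_le_mul_of_nonneg_left h3 (by positivity : (0 : ℝ) ≤ 31 * j)
    push_cast at h8
    linarith
  induction sh with
  | nil => simp at hsh
  | cons r l ih =>
    simp only [List.head?_cons, Option.mem_def, Option.some.injEq, exists_eq_left'] at hsh
    obtain ⟨r, g⟩ := r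
    cases l with
    | nil =>
      refine ⟨(r, g), by simp, hsh, final g (a / 2) (by omega) h (.inl (by omega))⟩
    | cons r' l =>
      obtain ⟨r', g'⟩ := r'
      rw [shellsOK, Bool.and_eq_true] at h
      by_cases h1 : (r' : ℝ) ≤ 32 * s
      · obtain ⟨x, hx, hx'⟩ := ih h.2 ⟨(r', g'), by simp, h1⟩
        exact ⟨x, List.mem_cons_of_mem _ hx, hx'⟩
      · refine ⟨(r, g), by simp, hsh, final g _ (by omega) h.1 ?_⟩
        rcases le_total (q - r') (a / 2) with h2 | h2
        · left
          rw [max_eq_right h2]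
          omega
        · right
          rw [max_eq_left h2, div_le_iff₀ (by norm_num)]
          have h3 : q - r' ≠ 0 := by omega
          rw [Nat.cast_sub (by omega)]
          push_cast
          linarith

theorem exists_range_of_rangeOK {sh : List (ℕ × ℕ)} {l : List (ℕ × ℕ × ℕ × ℕ)} {q : ℕ}
    (h : rangeOK sh q l = true) {x : ℝ} (hq : q ≤ x) (hx : x < 768) :
    ∃ q q' j a R : ℕ, q ≤ x ∧ x ≤ q' ∧ 1 ≤ j ∧ j ≤ 40 ∧ 1 ≤ a ∧ a % 2 = 0 ∧ a + 37 ≤ q ∧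
      q' ^ 256 * 2 ^ 4480 ≤ 2 ^ (7 * (R - 1)) * 128 ^ 256 ∧ shellsOK q j a R sh = true := by
  induction l generalizing q with
  | nil =>
    rw [rangeOK, Nat.ble_eq] at h
    have : (768 : ℝ) ≤ q := by exact_mod_cast h
    linarith
  | cons y l ih =>
    obtain ⟨q', j, a, R⟩ := y
    simp only [rangeOK, Bool.and_eq_true, Nat.ble_eq, Nat.beq_eq] at h
    rcases le_total (q' : ℝ) x with h1 | h1
    · exact ih h.2 h1
    · obtain ⟨⟨⟨⟨⟨⟨⟨h2, h3⟩, h4⟩, h5⟩, h6⟩, h7⟩, h8⟩, -⟩ := h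
      exact ⟨q, q', j, a, R, hq, h1, h2, h3, h4, h5, h6, h7, h8⟩

theorem logMean_half {ℓ : ℝ} (hℓ : 0 < ℓ) : logMean ℓ (ℓ / 2) = Real.log (ℓ / 2) - 1 := by
  rw [logMean, show ℓ / 2 - ℓ = -(ℓ / 2) by ring, Real.log_neg_eq_log]
  field_simp
  ring

theorem mul_log_add_le {x : ℝ} {n m k : ℕ} (hx : 0 < x) (h : x ^ n * 2 ^ m ≤ 2 ^ k) :
    n * Real.log x + m * Real.log 2 ≤ k * Real.log 2 := by
  have := Real.log_le_log (by positivity) h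
  rwa [Real.log_mul (by positivity) (by positivity), Real.log_pow, Real.log_pow, Real.log_pow]
    at this

theorem mul_log_add_le_of_nat {q p n m k : ℕ} (hq : (0 : ℝ) < q)
    (h : q ^ n * 2 ^ m ≤ 2 ^ k * p ^ n) :
    n * Real.log q + m * Real.log 2 ≤ k * Real.log 2 + n * Real.log p := by
  rcases Nat.eq_zero_or_pos n with rfl | hn
  · simp only [pow_zero, one_mul, mul_one] at h
    have := Nat.pow_le_pow_iff_right (one_lt_two) |>.1 h
    simpa using mul_le_mul_of_nonneg_right (Nat.cast_le (α := ℝ).2 this)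
      (Real.log_nonneg one_le_two)
  · have hq' : 0 < q := by exact_mod_cast hq
    have hp : (p : ℝ) ≠ 0 := by
      rintro hp
      rw [Nat.cast_eq_zero] at hp
      rw [hp, zero_pow hn.ne', mul_zero] at h
      have : 0 < q ^ n * 2 ^ m := by positivity
      omega
    have := Real.log_le_log (by positivity) (Nat.cast_le (α := ℝ).2 h)
    push_cast at this
    rwa [Real.log_mul (by positivity) (by positivity), Real.log_mul (by positivity)
      (by positivity), Real.log_pow, Real.log_pow, Real.log_pow, Real.log_pow] at this

section

variable {e : Fin 7 → ℂ} (he : ∀ i, NearCell (rootCell i) (e i))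
include he

theorem weighted_bound {w : Fin 7 → ℕ} {sh : List (ℕ × ℕ)}
    (h : planeOK logMeanTree (List.ofFn fun i => (w i, (rootCell i).2)) sh = true) {ξ : ℂ}
    {s : ℕ × ℕ} (hs : s ∈ sh) (hr : s.1 ≤ 32 * ‖ξ‖) :
    cellBound (∑ i, w i : ℕ) s.2 ≤ ∑ i, (w i : ℝ) * logMean (25 / 128) ‖ξ - e i‖ := by
  have h1 := bound_of_planeOK logMeanTree_valid (zs := List.ofFn e)
    (List.forall₂_iff_get.2 ⟨by simp, fun i _ _ => by
      simp only [List.get_ofFn]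
      exact he _⟩)
    (by
      intro z hz
      obtain ⟨i, rfl⟩ := (List.mem_ofFn' _ _).1 hz
      linarith [norm_le_of_nearCell (he i)]) h hs hr
  convert h1 using 1
  · rw [List.map_ofFn, List.sum_ofFn]
    rfl
  · simp [potential, List.ofFn_succ, Fin.sum_univ_succ]

theorem shells_bound {ξ : ℂ} {s : ℕ × ℕ} (hs : s ∈ shells) (hr : s.1 ≤ 32 * ‖ξ‖) :
    cellBound 31 s.2 ≤ ∑ i, ((rootCell i).1 : ℝ) * logMean (25 / 128) ‖ξ - e i‖ := by
  have h1 := weighted_bound he (w := fun i => (rootCell i).1) planeOK_shells hs hr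
  rwa [show (∑ i, (rootCell i).1) = 31 by decide] at h1

theorem drop_bound (j : Fin 7) (ξ : ℂ) :
    cellBound (31 - (rootCell j).1) (if j ≤ 2 then 15199 else 15784) ≤
      ∑ i, ((if i = j then 0 else (rootCell i).1 : ℕ) : ℝ) * logMean (25 / 128) ‖ξ - e i‖ := by
  have h1 := (List.all_eq_true.1 planeOK_drop) j (by simp)
  have h2 : rootCells.modify j (fun c => (0, c.2)) =
      List.ofFn fun i => (if i = j then 0 else (rootCell i).1, (rootCell i).2) := by
    revert j
    decide +kernel
  rw [h2] at h1
  have h3 := weighted_bound he h1 (ξ := ξ) (List.mem_singleton.2 rfl) (by simp)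
  convert h3 using 2
  · have h4 : ∀ j, (∑ i, if i = j then 0 else (rootCell i).1) + (rootCell j).1 = 31 := by
      decide +kernel
    rw [sub_eq_iff_eq_add]
    exact_mod_cast (h4 j).symm
  · clear h1 h2 h3
    fin_cases j <;> simp [Nat.ble]

theorem exists_weights {t : ℂ} (ht : t ≠ 0) : ∃ (u : Fin 7 → ℝ) (v ℓ K : ℝ), (∀ i, 0 ≤ u i) ∧
    0 ≤ v ∧ ∑ i, u i + v = 1 ∧ (∀ i, u i ≠ 0 → 25 / 128 ≤ ‖t - e i‖) ∧
    (v ≠ 0 → 0 < ℓ ∧ ℓ ≤ ‖t‖ ∧ ∀ i, ℓ ≤ ‖t - e i‖) ∧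
    (∀ ξ, K ≤ ∑ i, u i * logMean (25 / 128) ‖ξ - e i‖ + v * logMean ℓ ‖ξ - t‖) ∧
    4 / 7 * Real.log (‖t‖ / 4) + 1 / 1000 * Real.log (8 * ‖t‖ + 20) ≤ K := by
  have hT : 0 < ‖t‖ := norm_pos_iff.2 ht
  have hl2 := Real.log_pos one_lt_two
  have hnorm : ∀ i, ‖t‖ - 57 / 50 ≤ ‖t - e i‖ := fun i => by
    linarith [norm_sub_norm_le t (e i), norm_le_of_nearCell (he i)]
  have hw : ∑ i, ((rootCell i).1 : ℝ) = 31 := by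
    rw [← Nat.cast_sum, show (∑ i, (rootCell i).1) = 31 by decide]
    norm_num
  have inner : ∀ ξ, cellBound 31 18809 ≤
      ∑ i, ((rootCell i).1 : ℝ) * logMean (25 / 128) ‖ξ - e i‖ := fun ξ =>
    shells_bound he (s := (0, 18809)) (by decide) (by simp)
  by_cases hfar : ∀ i, 25 / 128 ≤ ‖t - e i‖
  · rcases le_or_gt ‖t‖ 2 with h2 | h2
    · refine ⟨fun i => (rootCell i).1 / 31, 0, 1, cellBound 31 18809 / 31, fun i => by positivity,
        le_rfl, ?_, fun i _ => hfar i, fun h => absurd rfl h, fun ξ => ?_, ?_⟩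
      · rw [← Finset.sum_div, hw]
        norm_num
      · simp only [div_mul_eq_mul_div, ← Finset.sum_div]
        linarith [inner ξ]
      · have h3 := mul_log_add_le (x := ‖t‖ / 4) (n := 1) (m := 1) (k := 0) (by positivity)
          (by linarith)
        have h4 := mul_log_add_le (x := 8 * ‖t‖ + 20) (n := 1) (m := 0) (k := 6) (by positivity)
          (by linarith)
        rw [cellBound]
        push_cast at h3 h4
        linarith
    · rcases lt_or_ge ‖t‖ 24 with h24 | h24
      · obtain ⟨q, q', j, a, R, hq, hq', hj, hj', ha, ha', haq, hR, hsh⟩ :=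
          exists_range_of_rangeOK rangeOK_ranges (x := 32 * ‖t‖) (by push_cast; linarith)
            (by linarith)
        have haq' : (a : ℝ) + 37 ≤ q := by exact_mod_cast haq
        have ha1 : (1 : ℝ) ≤ a := by exact_mod_cast ha
        have hj1 : (j : ℝ) ≤ 40 := by exact_mod_cast hj'
        refine ⟨fun i => (40 - j) / 40 * ((rootCell i).1 / 31), j / 40, a / 32,
          certValue R, fun i => mul_nonneg (div_nonneg (by linarith) (by norm_num)) (by positivity),
          by positivity, ?_, fun i _ => hfar i, fun _ => ⟨by positivity, by linarith, fun i => ?_⟩,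
          fun ξ => ?_, ?_⟩
        · rw [← Finset.mul_sum, ← Finset.sum_div, hw]
          ring
        · linarith [hnorm i]
        · obtain ⟨r, hr, hr', h3⟩ := exists_shell_of_shellsOK hj hj' ha ha' hsh
            (s := ‖ξ‖) (d := ‖ξ - t‖) (by linarith [norm_sub_norm_le t ξ, norm_sub_rev t ξ])
            ⟨(0, 18809), by simp [shells], by simp⟩
          have h4 := shells_bound he hr hr'
          simp only [mul_assoc, ← Finset.mul_sum, div_mul_eq_mul_div, ← Finset.sum_div]
          have h5 := mul_le_mul_of_nonneg_left h4 (by linarith : (0 : ℝ) ≤ 40 - j)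
          rw [cellBound] at h5
          rw [certValue]
          linarith
        · have hq0 : (1 : ℝ) ≤ q' := by
            have : (0 : ℝ) < q' := by linarith
            exact_mod_cast this
          have h3 := mul_log_add_le_of_nat (by linarith) hR
          have h128 : Real.log (128 : ℕ) = 7 * Real.log 2 := by
            rw [show ((128 : ℕ) : ℝ) = 2 ^ 7 by norm_num, Real.log_pow]
            norm_num
          rw [h128] at h3
          push_cast at h3
          have h4 := Real.log_nonneg hq0
          have h5 : Real.log (‖t‖ / 4) ≤ Real.log q' - 7 * Real.log 2 := by
            have h6 := Real.log_le_log (by positivity) (show ‖t‖ / 4 ≤ q' / 2 ^ 7 by linarith)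
            rw [Real.log_div (x := (q' : ℝ)) (by positivity) (by positivity), Real.log_pow] at h6
            exact_mod_cast h6
          have h6 := mul_log_add_le (x := 8 * ‖t‖ + 20) (n := 1) (m := 0) (k := 8) (by positivity)
            (by linarith)
          rcases Nat.eq_zero_or_pos R with rfl | hR0
          · push_cast at h3
            linarith
          · push_cast [Nat.cast_sub hR0] at h3 h6
            rw [certValue]
            linarith
      · refine ⟨fun i => 1 / 4 * ((rootCell i).1 / 31), 3 / 4, 7 / 10 * ‖t‖, _,
          fun i => by positivity, by norm_num, ?_, fun i _ => hfar i,
          fun _ => ⟨by positivity, by linarith, fun i => by linarith [hnorm i]⟩, fun ξ => ?_,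
          le_rfl⟩
        · rw [← Finset.mul_sum, ← Finset.sum_div, hw]
          norm_num
        · simp only [mul_assoc, ← Finset.mul_sum, div_mul_eq_mul_div, ← Finset.sum_div]
          have hℓ : 0 < 7 * ‖t‖ / 10 := by positivity
          have h7 : -3 * Real.log 2 ≤ 5 * Real.log (7 / 10) := by
            have := mul_log_add_le (x := 10 / 7) (n := 5) (m := 0) (k := 3) (by norm_num)
              (by norm_num)
            rw [show (7 / 10 : ℝ) = (10 / 7)⁻¹ by norm_num, Real.log_inv]
            push_cast at this
            linarith
          have hlogℓ : Real.log (7 * ‖t‖ / 10) = Real.log (7 / 10) + Real.log ‖t‖ := by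
            rw [← Real.log_mul (by norm_num) hT.ne']
            congr 1
            ring
          have hlog24 : 9 * Real.log 2 ≤ 2 * Real.log ‖t‖ := by
            have h3 := Real.log_le_log (by norm_num) (show (2 : ℝ) ^ 9 ≤ ‖t‖ ^ 2 by nlinarith)
            rw [Real.log_pow, Real.log_pow] at h3
            exact_mod_cast h3
          have h4 : Real.log (‖t‖ / 4) = Real.log ‖t‖ - 2 * Real.log 2 := by
            rw [Real.log_div hT.ne' (by norm_num), show (4 : ℝ) = 2 ^ 2 by norm_num, Real.log_pow]
            norm_num
          have h20 : Real.log (8 * ‖t‖ + 20) ≤ 4 * Real.log 2 + Real.log ‖t‖ := by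
            have h3 := Real.log_le_log (by positivity)
              (show 8 * ‖t‖ + 20 ≤ 2 ^ 4 * ‖t‖ by linarith)
            rw [Real.log_mul (by norm_num) hT.ne', Real.log_pow] at h3
            exact_mod_cast h3
          have hl := Real.log_two_gt_d9
          rcases le_or_gt ‖ξ‖ 4 with hξ | hξ
          · have h5 := logMean_le_logMean (s := ‖ξ - t‖) hℓ (by linarith) (show 7 * ‖t‖ / 10 ≤ _ by
              linarith [norm_sub_norm_le t ξ, norm_sub_rev t ξ])
            rw [logMean_self hℓ, hlogℓ] at h5
            have h6 := inner ξ
            rw [cellBound] at h6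
            rw [h4]
            linarith
          · have h5 := logMean_half_le hℓ ‖ξ - t‖
            rw [logMean_half hℓ, Real.log_div hℓ.ne' two_ne_zero, hlogℓ] at h5
            have h6 := shells_bound he (ξ := ξ) (s := (128, 23572)) (by decide)
              (by push_cast; linarith)
            rw [cellBound] at h6
            push_cast at h6
            rw [h4]
            linarith
  · push Not at hfar
    obtain ⟨j, hj⟩ := hfar
    have hwj : ((rootCell j).1 : ℝ) ≤ 5 := by
      have : ∀ j, (rootCell j).1 ≤ 5 := by decide
      exact_mod_cast this j
    have hW : (0 : ℝ) < 31 - (rootCell j).1 := by linarith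
    have hTj : ‖t‖ ≤ 1336 / 1000 := by linarith [hnorm j]
    refine ⟨fun i => (if i = j then 0 else (rootCell i).1 : ℕ) / (31 - (rootCell j).1), 0, 1,
      cellBound (31 - (rootCell j).1) (if j ≤ 2 then 15199 else 15784) / (31 - (rootCell j).1),
      fun i => by positivity, le_rfl, ?_, fun i hi => ?_, fun h => absurd rfl h, fun ξ => ?_, ?_⟩
    · have h3 : ∀ j, (∑ i, if i = j then 0 else (rootCell i).1) + (rootCell j).1 = 31 := by
        decide +kernel
      rw [← Finset.sum_div, add_zero, div_eq_one_iff_eq hW.ne', eq_sub_iff_add_eq]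
      exact_mod_cast h3 j
    · have hij : i ≠ j := by
        rintro rfl
        simp at hi
      have h3 := le_norm_sub_of_nearCell hij (he i) (he j)
      have h4 := norm_sub_le_norm_sub_add_norm_sub (e i) t (e j)
      rw [norm_sub_rev (e i) t] at h4
      linarith
    · simp only [div_mul_eq_mul_div, ← Finset.sum_div]
      rw [zero_mul, add_zero]
      gcongr
      exact drop_bound he j ξ
    · have h3 := mul_log_add_le (x := ‖t‖ / 4) (n := 20) (m := 31) (k := 0) (by positivity) (by
        have := pow_le_pow_left₀ (by positivity) (show ‖t‖ / 4 ≤ 334 / 1000 by linarith) 20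
        norm_num at this ⊢
        linarith)
      have h4 := mul_log_add_le (x := 8 * ‖t‖ + 20) (n := 1) (m := 0) (k := 6) (by positivity)
        (by linarith)
      rw [cellBound, le_div_iff₀ hW]
      push_cast at h3 h4
      clear hj hwj hW
      fin_cases j <;> simp [rootCell] <;> linarith

end

/-- In a solution with a conjugate of controlled leading coefficient, `B` has degree
at most `1000`. -/
theorem natDegree_le_of_norm_leadingCoeff {t : ℂ} (ht : t ≠ 0) {a b : ℂ[X]} (hb : b ≠ 0)
    (h : a ^ 2 - (X - C t) * (X ^ 7 - X ^ 3 - 1) * b ^ 2 = 1 + 4 * X)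
    (hlead : 1 ≤ (2 * ‖b.leadingCoeff‖) ^ 7 * (‖t‖ ^ 4 / 2 ^ 8) ^ (b.natDegree + 4)) :
    b.natDegree ≤ 1000 := by
  obtain ⟨e, hf, he⟩ := exists_septic_roots
  obtain ⟨u, v, ℓ, K, hu, hv, hsum, hE, hV, hK, hle⟩ := exists_weights he ht
  have hup := log_add_mul_le_of_weights hb h hf he hu hv hsum hE hV hK
  have hT : 0 < ‖t‖ := norm_pos_iff.2 ht
  have hβ : 0 < ‖b.leadingCoeff‖ := norm_pos_iff.2 (leadingCoeff_ne_zero.2 hb)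
  set n := b.natDegree + 4 with hn
  have hlow := Real.log_nonneg hlead
  rw [show ‖t‖ ^ 4 / 2 ^ 8 = (‖t‖ / 4) ^ 4 by ring, Real.log_mul (by positivity) (by positivity),
    Real.log_pow, Real.log_pow, Real.log_pow, Real.log_mul (by positivity) hβ.ne'] at hlow
  have hlog : 2 * Real.log 2 ≤ Real.log (8 * ‖t‖ + 20) := by
    have := Real.log_le_log (by norm_num) (show (2 : ℝ) ^ 2 ≤ 8 * ‖t‖ + 20 by linarith)
    rw [Real.log_pow] at this
    exact_mod_cast this
  have hl2 := Real.log_pos one_lt_two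
  have hnK := mul_le_mul_of_nonneg_left hle n.cast_nonneg
  have hfin : (n : ℝ) * Real.log (8 * ‖t‖ + 20) ≤ 1000 * Real.log (8 * ‖t‖ + 20) := by
    push_cast at hlow hup
    linarith
  have : (n : ℝ) ≤ 1000 := le_of_mul_le_mul_right hfin (by linarith)
  have : n ≤ 1000 := by exact_mod_cast this
  omega

/-- The set of complex numbers `t₀` for which there exist
`A, B ∈ ℂ[X]` with `B ≠ 0` satisfying `A² − (X − t₀)·(X⁷ − X³ − 1)·B² = 4X + 1`
is finite. -/
theorem finite_pellian_specializations :
    {t₀ : ℂ | ∃ A B : Polynomial ℂ, B ≠ 0 ∧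
      A ^ 2 - (X - C t₀) * (X ^ 7 - X ^ 3 - 1) * B ^ 2 = 4 * X + 1}.Finite := by
  refine ((finite_of_natDegree_le 1000).insert 0).subset ?_
  rintro t ⟨a, b, hb, h⟩
  rw [add_comm] at h
  rcases eq_or_ne t 0 with ht | ht
  · exact Or.inl ht
  · obtain ⟨t', a', b', ht', hb', hdeg, h', hlead⟩ := exists_conjugate_solution ht a b hb h
    refine Or.inr ⟨a, b, hdeg ▸ natDegree_le_of_norm_leadingCoeff ht' hb' h' ?_, h⟩
    rwa [hdeg]
end

section
/- Let K be an algebraic closure of the rational function field ℚ(t), and let t also denote the image in K of the independent variable of ℚ(t). There do not exist polynomials A, B ∈ K[X] with B ≠ 0 such that A² − (X¹² + X⁴ + t)·B² = X⁴ − 1. -/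
open Polynomial

/-- The derivation `d/dt` of `ℚ(t)` extends to its algebraic closure. -/
theorem exists_derivation_ratFuncX_eq_one (K : Type*) [Field K] [Algebra (RatFunc ℚ) K]
    [Algebra.IsAlgebraic (RatFunc ℚ) K] :
    ∃ d : Derivation ℤ K K, d (algebraMap (RatFunc ℚ) K RatFunc.X) = 1 := by
  have : CharZero (RatFunc ℚ) := algebraRat.charZero _
  have : CharZero K := charZero_of_injective_algebraMap (algebraMap (RatFunc ℚ) K).injective
  let : Algebra ℚ[X] K :=
    ((algebraMap (RatFunc ℚ) K).comp (algebraMap ℚ[X] (RatFunc ℚ))).toAlgebra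
  have : IsScalarTower ℚ[X] (RatFunc ℚ) K := IsScalarTower.of_algebraMap_eq' rfl
  have : IsScalarTower ℚ ℚ[X] K := IsScalarTower.of_algebraMap_eq' (RingHom.ext_rat _ _)
  have : Algebra.FormallyEtale (RatFunc ℚ) K := Algebra.FormallyEtale.of_isSeparable _ _
  have : Algebra.FormallyEtale ℚ[X] (RatFunc ℚ) :=
    Algebra.FormallyEtale.of_isLocalization (nonZeroDivisors ℚ[X])
  have : Algebra.FormallyEtale ℚ[X] K := Algebra.FormallyEtale.comp _ (RatFunc ℚ) _
  let e := KaehlerDifferential.tensorKaehlerEquivOfFormallyEtale ℚ ℚ[X] K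
  let f : TensorProduct ℚ[X] K (Ω[ℚ[X]⁄ℚ]) →ₗ[K] K :=
    (TensorProduct.AlgebraTensorModule.rid ℚ[X] K K).toLinearMap ∘ₗ
      ((KaehlerDifferential.polynomialEquiv ℚ).toLinearMap.baseChange K)
  refine ⟨((f ∘ₗ e.symm.toLinearMap).compDer (KaehlerDifferential.D ℚ K)).restrictScalars ℤ, ?_⟩
  have hX : algebraMap (RatFunc ℚ) K RatFunc.X = algebraMap ℚ[X] K X := by
    rw [IsScalarTower.algebraMap_apply ℚ[X] (RatFunc ℚ) K, RatFunc.algebraMap_X]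
  simp [hX, e, f, KaehlerDifferential.tensorKaehlerEquivOfFormallyEtale_symm_D_algebraMap]

open Differential in
/-- The coefficientwise derivation commutes with the derivative in the variable. -/
theorem Differential.derivative_mapCoeffs {R : Type*} [CommRing R] [Differential R] (p : R[X]) :
    derivative (mapCoeffs p) = mapCoeffs (derivative p) := by
  ext n
  simp only [coeff_derivative, Differential.coeff_mapCoeffs, Derivation.leibniz, smul_eq_mul]
  have : (Differential.deriv ((n : R) + 1)) = 0 := by
    simp
  rw [this]; ring

open Differential in
/-- If `A² - D B² = F` with `F` squarefree and constant for the coefficientwise derivation, then the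
logarithmic derivatives of `(A + B √D) / √F` with respect to that derivation and to the variable are
`P / √D` and `G / (2 F √D)` for polynomials `P` and `G`. The last identity expresses that the two
derivations commute. -/
theorem exists_logDeriv_of_almostPell {K : Type*} [Field K] [CharZero K] [Differential K]
    {A B D F : K[X]} (hF : Squarefree F) (hF' : mapCoeffs F = 0) (hB : B ≠ 0)
    (h : A ^ 2 - D * B ^ 2 = F) :
    ∃ P G : K[X], mapCoeffs A = P * B ∧ 2 * F * derivative A - A * derivative F = G * B ∧
      2 * D * mapCoeffs G - G * mapCoeffs D =
        2 * F * (2 * D * derivative P - P * derivative D) := by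
  have hcop : IsCoprime B A := by
    classical
    rw [← EuclideanDomain.gcd_isUnit_iff]
    refine hF _ ?_
    obtain ⟨a, ha⟩ := EuclideanDomain.gcd_dvd_right B A
    obtain ⟨b, hb⟩ := EuclideanDomain.gcd_dvd_left B A
    refine ⟨a ^ 2 - D * b ^ 2, ?_⟩
    generalize EuclideanDomain.gcd B A = g at ha hb
    rw [← h, ha, hb]
    ring
  have ht : 2 * A * mapCoeffs A = mapCoeffs D * B ^ 2 + 2 * D * B * mapCoeffs B := by
    have := congrArg mapCoeffs h
    simp only [hF', map_sub, pow_two, Derivation.leibniz, smul_eq_mul] at this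
    linear_combination this
  have hx : 2 * A * derivative A =
      derivative F + derivative D * B ^ 2 + 2 * D * B * derivative B := by
    have := congrArg derivative h
    simp only [map_sub, pow_two, derivative_mul] at this
    linear_combination this
  have two_dvd {Q : K[X]} (hQ : B ∣ 2 * Q) : B ∣ Q := by
    have hu : IsUnit (2 : K[X]) := isUnit_C.mpr (IsUnit.mk0 (2 : K) two_ne_zero)
    exact hu.dvd_mul_left.mp hQ
  obtain ⟨P, hP⟩ : B ∣ mapCoeffs A := by
    refine hcop.dvd_of_dvd_mul_left (two_dvd ⟨mapCoeffs D * B + 2 * D * mapCoeffs B, ?_⟩)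
    linear_combination ht
  obtain ⟨G, hG⟩ : B ∣ 2 * F * derivative A - A * derivative F := by
    refine hcop.dvd_of_dvd_mul_left
      ⟨F * derivative D * B + 2 * F * D * derivative B - D * B * derivative F, ?_⟩
    linear_combination F * hx - derivative F * h
  refine ⟨P, G, by rw [hP, mul_comm], by rw [hG, mul_comm], mul_left_cancel₀ hB ?_⟩
  have hAP : 2 * A * P = mapCoeffs D * B + 2 * D * mapCoeffs B :=
    mul_left_cancel₀ hB (by linear_combination ht - 2 * A * hP)
  have hAG : A * G = F * derivative D * B + 2 * F * D * derivative B - D * B * derivative F :=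
    mul_left_cancel₀ hB (by linear_combination F * hx - derivative F * h - A * hG)
  have hxt := congrArg derivative hP
  rw [derivative_mul, derivative_mapCoeffs] at hxt
  have htx := congrArg mapCoeffs hG
  have h2 : mapCoeffs (2 : K[X]) = 0 := Derivation.map_natCast mapCoeffs 2
  have hdF : mapCoeffs (derivative F) = 0 := by rw [← derivative_mapCoeffs, hF', map_zero]
  simp only [map_sub, Derivation.leibniz, smul_eq_mul, hF', hdF, h2] at htx
  linear_combination 4 * F * D * hxt - 2 * D * htx - 2 * D * derivative F * hP + G * hAP - 2 * P * hAG

/-- The coefficients `g₁, g₅, N` of `X, X⁵, X⁹` in `G` and `p₂, p₆` of `X², X⁶` in `P` cannot satisfy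
the compatibility condition. -/
theorem false_of_coeff_system {K : Type*} [Field K] [CharZero K] (d : Derivation ℤ K K)
    {t N g₁ g₅ p₂ p₆ : K} (ht : d t = 1) (hN : N ≠ 0) (hdN : d N = 0)
    (h₁ : 2 * t * d g₁ - g₁ = -8 * t * p₂)
    (h₅ : 2 * t * d g₅ + 2 * d g₁ - g₅ = 8 * t * p₂ - 24 * t * p₆)
    (h₉ : 2 * d g₅ - N = (24 * t - 16) * p₆)
    (h₁₃ : d g₁ = 8 * p₆ + 8 * p₂)
    (h₁₇ : d g₅ = -8 * p₂) : False := by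
  have hnum (n : ℕ) [n.AtLeastTwo] : d (OfNat.ofNat n : K) = 0 :=
    Derivation.map_natCast d n
  have e₁ : g₁ = 16 * t * p₆ + 24 * t * p₂ := by linear_combination -h₁ + 2 * t * h₁₃
  have e₅ : g₅ = -24 * t * p₂ + 16 * p₂ + 16 * p₆ + 24 * t * p₆ := by
    linear_combination -h₅ + 2 * h₁₃ + 2 * t * h₁₇
  have e₂ : 16 * p₂ = -N - (24 * t - 16) * p₆ := by linear_combination -h₉ + 2 * h₁₇
  have d₁ := congrArg d e₁
  have d₅ := congrArg d e₅
  have d₂ := congrArg d e₂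
  simp only [map_sub, map_add, map_neg, neg_mul, Derivation.leibniz, smul_eq_mul, hnum, ht, hdN]
    at d₁ d₅ d₂
  have hq₁ : t * (40 - 36 * t) * d p₆ + (24 - 60 * t) * p₆ = N := by
    linear_combination h₁₃ - d₁ - e₂ - 3 / 2 * t * d₂
  have hq₂ : (32 - 24 * t + 36 * t ^ 2) * d p₆ + (60 * t - 16) * p₆ = -N := by
    linear_combination h₁₇ - d₅ + e₂ - (16 - 24 * t) / 16 * d₂
  have hq : (4 + 2 * t) * d p₆ = - p₆ := by linear_combination (hq₁ + hq₂) / 8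
  have hR : p₆ * (-84 * t ^ 2 - 232 * t + 96) = N * (4 + 2 * t) := by
    linear_combination (4 + 2 * t) * hq₁ - t * (40 - 36 * t) * hq
  have hR' := congrArg d hR
  simp only [map_sub, map_add, map_neg, neg_mul, pow_two, Derivation.leibniz, smul_eq_mul, hnum, ht,
    hdN] at hR'
  have ht₀ : 4 + 2 * t ≠ 0 := by
    intro h
    have := congrArg d h
    simp [Derivation.leibniz, hnum, ht] at this
  have hp : p₆ ≠ 0 := by
    rintro rfl
    simp_all
  have hquad : 84 * t ^ 2 + 440 * t + 1216 = 0 := by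
    refine (mul_eq_zero.mp ?_).resolve_left hp
    linear_combination (-84 * t ^ 2 - 232 * t + 96) * hq + 2 * hR - (4 + 2 * t) * hR'
  have hlin : 168 * t + 440 = 0 := by
    have := congrArg d hquad
    simp only [map_add, pow_two, Derivation.leibniz, smul_eq_mul, hnum, ht, map_zero] at this
    linear_combination this
  have := congrArg d hlin
  simp [Derivation.leibniz, hnum, ht] at this

/-- Comparison of leading terms in an almost-Pell equation with `deg D = 12` and `deg F = 4`. -/
theorem natDegree_eq_and_leadingCoeff_sq {K : Type*} [Field K] {A B D F : K[X]}
    (hD : D.Monic) (hD' : D.natDegree = 12) (hF : F.natDegree = 4) (hB : B ≠ 0)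
    (h : A ^ 2 - D * B ^ 2 = F) :
    A.natDegree = B.natDegree + 6 ∧ A.leadingCoeff ^ 2 = B.leadingCoeff ^ 2 := by
  have hDB : (D * B ^ 2).natDegree = 12 + 2 * B.natDegree := by
    rw [natDegree_mul hD.ne_zero (pow_ne_zero 2 hB), hD', natDegree_pow]
  have hlt : F.natDegree < (D * B ^ 2).natDegree := by omega
  have hA : A ^ 2 = D * B ^ 2 + F := by linear_combination h
  have hdeg := congrArg natDegree hA
  rw [natDegree_add_eq_left_of_natDegree_lt hlt, hDB, natDegree_pow] at hdeg
  refine ⟨by omega, ?_⟩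
  have hlc := congrArg leadingCoeff hA
  rwa [leadingCoeff_add_of_degree_lt' (degree_lt_degree hlt), leadingCoeff_pow, leadingCoeff_mul,
    hD.leadingCoeff, one_mul, leadingCoeff_pow] at hlc

/-- Let `K` be an algebraic closure of `ℚ(t)` and let `t` also denote
the image in `K` of the independent variable. There do not exist `A, B ∈ K[X]` with
`B ≠ 0` such that `A² − (X¹² + X⁴ + t)·B² = X⁴ − 1`. -/
theorem no_nontrivial_solution_degree_twelve_family
    {K : Type*} [Field K] [Algebra (RatFunc ℚ) K] [IsAlgClosure (RatFunc ℚ) K] :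
    ¬ ∃ A B : Polynomial K, B ≠ 0 ∧
      A ^ 2 - (X ^ 12 + X ^ 4 + C (algebraMap (RatFunc ℚ) K RatFunc.X)) * B ^ 2
        = X ^ 4 - 1 := by
  rintro ⟨A, B, hB, h⟩
  have : Algebra.IsAlgebraic (RatFunc ℚ) K := IsAlgClosure.isAlgebraic
  have : CharZero (RatFunc ℚ) := algebraRat.charZero _
  have : CharZero K := charZero_of_injective_algebraMap (algebraMap (RatFunc ℚ) K).injective
  obtain ⟨d, ht⟩ := exists_derivation_ratFuncX_eq_one K
  let : Differential K := ⟨d⟩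
  generalize algebraMap (RatFunc ℚ) K RatFunc.X = t at h ht
  have hF : Squarefree (X ^ 4 - 1 : K[X]) :=
    (X_pow_sub_one_separable_iff.mpr (by norm_num)).squarefree
  have hF' : Differential.mapCoeffs (X ^ 4 - 1 : K[X]) = 0 := by simp
  have hD' : Differential.mapCoeffs (X ^ 12 + X ^ 4 + C t : K[X]) = 1 := by
    simp [show Differential.deriv t = 1 from ht]
  have hDm : (X ^ 12 + X ^ 4 + C t : K[X]).Monic := by monicity!
  have hDd : (X ^ 12 + X ^ 4 + C t : K[X]).natDegree = 12 := by compute_degree!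
  have hFd : (X ^ 4 - 1 : K[X]).natDegree = 4 := by compute_degree!
  obtain ⟨hA, hlc⟩ := natDegree_eq_and_leadingCoeff_sq hDm hDd hFd hB h
  obtain ⟨P, G, hP, hG, hPG⟩ := exists_logDeriv_of_almostPell hF hF' hB h
  have hPd : P.natDegree ≤ 6 := by
    rcases eq_or_ne P 0 with rfl | hP0
    · simp
    have : (Differential.mapCoeffs A).natDegree ≤ A.natDegree := natDegree_le_iff_coeff_eq_zero.mpr
      fun n hn ↦ by rw [Differential.coeff_mapCoeffs, coeff_eq_zero_of_natDegree_lt hn, map_zero]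
    rw [hP, natDegree_mul hP0 hB] at this
    omega
  have hGB : G * B = C 2 * (derivative A * X ^ 4) - C 2 * derivative A - C 4 * (A * X ^ 3) := by
    have hFX : derivative (X ^ 4 - 1 : K[X]) = C 4 * X ^ 3 := by simp [C_ofNat]; norm_num
    rw [← hG, hFX]
    simp only [C_ofNat]
    ring
  have hGd : G.natDegree ≤ 9 := by
    rcases eq_or_ne G 0 with rfl | hG0
    · simp
    have h₁ : (G * B).natDegree ≤ B.natDegree + 9 := by
      refine natDegree_le_iff_coeff_eq_zero.mpr fun n hn ↦ ?_
      rw [hGB]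
      simp only [coeff_sub, coeff_C_mul, coeff_mul_X_pow', coeff_derivative]
      rw [if_pos (by omega), if_pos (by omega), coeff_eq_zero_of_natDegree_lt (by omega),
        coeff_eq_zero_of_natDegree_lt (by omega), coeff_eq_zero_of_natDegree_lt (by omega)]
      ring
    rw [natDegree_mul hG0 hB] at h₁
    omega
  have hlead : G.coeff 9 * B.leadingCoeff = ((2 * B.natDegree + 8 : ℕ) : K) * A.leadingCoeff := by
    rw [← coeff_natDegree, ← coeff_mul_add_eq_of_natDegree_le hGd le_rfl, hGB]
    simp only [coeff_sub, coeff_C_mul, coeff_mul_X_pow', coeff_derivative]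
    rw [if_pos (by omega), if_pos (by omega), show 9 + B.natDegree - 4 + 1 = A.natDegree by omega,
      show 9 + B.natDegree - 3 = A.natDegree by omega,
      coeff_eq_zero_of_natDegree_lt (show A.natDegree < 9 + B.natDegree + 1 by omega),
      show 9 + B.natDegree - 4 = B.natDegree + 5 by omega, coeff_natDegree]
    push_cast
    ring
  obtain ⟨z, hz, hGz⟩ : ∃ z : ℤ, z ≠ 0 ∧ G.coeff 9 = z := by
    have hB' := leadingCoeff_ne_zero.mpr hB
    rcases sq_eq_sq_iff_eq_or_eq_neg.mp hlc with hl | hl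
    · refine ⟨2 * B.natDegree + 8, by omega, mul_right_cancel₀ hB' ?_⟩
      rw [hlead, hl]
      push_cast
      ring
    · refine ⟨-(2 * B.natDegree + 8), by omega, mul_right_cancel₀ hB' ?_⟩
      rw [hlead, hl]
      push_cast
      ring
  have hN : d (G.coeff 9) = 0 := by rw [hGz, Derivation.map_intCast]
  have hP_coeff (n : ℕ) (hn : 6 < n) : P.coeff n = 0 :=
    coeff_eq_zero_of_natDegree_lt (hPd.trans_lt hn)
  have hG_coeff (n : ℕ) (hn : 9 < n) : G.coeff n = 0 :=
    coeff_eq_zero_of_natDegree_lt (hGd.trans_lt hn)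
  have hexp : C 2 * (Differential.mapCoeffs G * X ^ 12 + Differential.mapCoeffs G * X ^ 4
        + C t * Differential.mapCoeffs G) - G =
      C 4 * (derivative P * X ^ 16 - derivative P * X ^ 12 + derivative P * X ^ 8
        - derivative P * X ^ 4 + C t * (derivative P * X ^ 4) - C t * derivative P)
      - (C 24 * (P * X ^ 15) - C 24 * (P * X ^ 11) + C 8 * (P * X ^ 7) - C 8 * (P * X ^ 3)) := by
    have hDX : derivative (X ^ 12 + X ^ 4 + C t) = C 12 * X ^ 11 + C 4 * X ^ 3 := by
      simp [C_ofNat]; norm_num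
    rw [hD', hDX] at hPG
    simp only [C_ofNat] at hPG ⊢
    linear_combination hPG
  have hcoeff (n : ℕ) := congrArg (coeff · n) hexp
  simp only [coeff_sub, coeff_add, coeff_C_mul, coeff_mul_X_pow', coeff_derivative,
    Differential.coeff_mapCoeffs]
    at hcoeff
  have c₁ := hcoeff 1
  have c₅ := hcoeff 5
  have c₉ := hcoeff 9
  have c₁₃ := hcoeff 13
  have c₁₇ := hcoeff 17
  have hd (x : K) : Differential.deriv x = d x := rfl
  norm_num [hP_coeff, hG_coeff, hd, hN] at c₁ c₅ c₉ c₁₃ c₁₇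
  refine false_of_coeff_system d (t := t) (N := G.coeff 9) (g₁ := G.coeff 1) (g₅ := G.coeff 5)
    (p₂ := P.coeff 2) (p₆ := P.coeff 6) ht (by rw [hGz]; exact_mod_cast hz) hN ?_ ?_ ?_ ?_ ?_
  · linear_combination c₁
  · linear_combination c₅
  · linear_combination c₉
  · linear_combination c₁₃ / 2
  · linear_combination c₁₇ / 2
end

section
/- The set of complex numbers t₀ for which there exist polynomials A, B ∈ ℂ[X] with B ≠ 0 satisfying A² − (X⁴ + X² + t₀·X)·B² = X − 1 is infinite. -/
open Polynomial

/-- `(x, y)` is a point of `y² = x⁴ + x² + t x` which is the only affine zero of some function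
`A - B y`, so that `A² - (X⁴ + X² + t X) B²` is a nonzero multiple of `X - x`. -/
def IsNormPoint {K : Type*} [Field K] (t x y : K) : Prop :=
  y ^ 2 = x ^ 4 + x ^ 2 + t * x ∧ ∃ A B : K[X], ∃ c : K, c ≠ 0 ∧
    A ^ 2 - (X ^ 4 + X ^ 2 + C t * X) * B ^ 2 = C c * (X - C x) ∧ A.eval x = y * B.eval x

theorem isNormPoint_base {K : Type*} [Field K] [CharZero K] {t : K} (ht : t ≠ 0) :
    IsNormPoint t (1 / (4 * t)) ((1 / (4 * t)) ^ 2 + 1 / 2) := by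
  refine ⟨by field_simp; ring, X ^ 2 + C (1 / 2), 1, -t, neg_ne_zero.2 ht, ?_, by simp⟩
  have h1 : C t * C (1 / (4 * t)) = (C (1 / 2 : K)) ^ 2 := by
    rw [← C_mul, ← C_pow]; congr 1; field_simp; norm_num
  have h2 : 2 * C (1 / 2 : K) = 1 := by
    rw [show (2 : K[X]) = C 2 from rfl, ← C_mul, ← C_1]; congr 1; norm_num
  rw [C_neg]
  linear_combination (-1) * h1 + X ^ 2 * h2

/-- One step of the continued fraction expansion of the square root of `X⁴ + X² + t X`. -/
theorem IsNormPoint.step {K : Type*} [Field K] {t x y x' : K} (h : IsNormPoint t x y)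
    (hS : 1 + 2 * x ^ 2 + 2 * y ≠ 0) (hx' : (1 + 2 * x ^ 2 + 2 * y) * (x + x') = -t) :
    IsNormPoint t x' (x' ^ 2 - x ^ 2 - y) := by
  obtain ⟨hy, A, B, c, hc, hN, hAB⟩ := h
  set S := 1 + 2 * x ^ 2 + 2 * y with hSdef
  set P : K[X] := X ^ 2 - C (x ^ 2 + y) with hP
  have hD : X ^ 4 + X ^ 2 + C t * X - P ^ 2 = C S * ((X - C x) * (X - C x')) := by
    have e1 := congrArg C hx'
    have e2 := congrArg C hy
    have e3 := congrArg C hSdef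
    simp only [C_mul, C_add, C_neg, C_pow, C_1, show (C (2 : K)) = 2 from rfl] at e1 e2 e3
    rw [hP, C_add, C_pow]
    linear_combination (X - C x) * e1 - e2 - (X - C x) * (X + C x) * e3
  have hlin : (X - C x : K[X]) ≠ 0 := X_sub_C_ne_zero x
  obtain ⟨A', hA'⟩ : (X - C x) ∣ A * P + B * (X ^ 4 + X ^ 2 + C t * X) := by
    rw [dvd_iff_isRoot]
    simp only [IsRoot.def, hP, eval_add, eval_mul, eval_sub, eval_pow, eval_X, eval_C, hAB]
    linear_combination (-B.eval x) * hy
  obtain ⟨B', hB'⟩ : (X - C x) ∣ A + B * P := by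
    rw [dvd_iff_isRoot]
    simp only [IsRoot.def, hP, eval_add, eval_mul, eval_sub, eval_pow, eval_X, eval_C, hAB]
    ring
  have hdiff : A' - P * B' = B * (C S * (X - C x')) := by
    apply mul_left_cancel₀ hlin
    linear_combination P * hB' - hA' + B * hD
  have hev := congrArg (eval x') hdiff
  have heq := congrArg (eval x') hD
  simp only [hP, eval_add, eval_mul, eval_sub, eval_pow, eval_X, eval_C] at hev heq
  refine ⟨by linear_combination -heq, A', B', -(c * S), by simp [hc, hS], ?_,
    by linear_combination hev⟩
  apply mul_left_cancel₀ (pow_ne_zero 2 hlin)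
  have key : (X - C x) ^ 2 * (A' ^ 2 - (X ^ 4 + X ^ 2 + C t * X) * B' ^ 2) =
      (A ^ 2 - (X ^ 4 + X ^ 2 + C t * X) * B ^ 2) * (P ^ 2 - (X ^ 4 + X ^ 2 + C t * X)) := by
    linear_combination (-((X - C x) * A' + (A * P + B * (X ^ 4 + X ^ 2 + C t * X)))) * hA' +
      (X ^ 4 + X ^ 2 + C t * X) * ((X - C x) * B' + (A + B * P)) * hB'
  rw [key, hN, C_neg, C_mul]
  linear_combination (-(C c * (X - C x))) * hD

theorem IsNormPoint.exists_solution {t y : ℝ} (h : IsNormPoint t 1 y) :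
    ∃ A B : ℂ[X], B ≠ 0 ∧ A ^ 2 - (X ^ 4 + X ^ 2 + C (t : ℂ) * X) * B ^ 2 = X - 1 := by
  obtain ⟨-, A, B, c, hc, hN, -⟩ := h
  obtain ⟨r, hr⟩ := IsAlgClosed.exists_pow_nat_eq ((c : ℂ)⁻¹) (n := 2) (by norm_num)
  have hN' := congrArg (Polynomial.map Complex.ofRealHom) hN
  simp only [Polynomial.map_sub, Polynomial.map_mul, Polynomial.map_pow, Polynomial.map_add,
    map_X, map_C, Complex.ofRealHom_eq_coe, Polynomial.map_one, C_1] at hN'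
  have hrc : (C r) ^ 2 * C (c : ℂ) = 1 := by
    rw [← C_pow, ← C_mul, hr, inv_mul_cancel₀ (by exact_mod_cast hc), C_1]
  have hsol : (C r * A.map Complex.ofRealHom) ^ 2 -
      (X ^ 4 + X ^ 2 + C (t : ℂ) * X) * (C r * B.map Complex.ofRealHom) ^ 2 = X - 1 := by
    linear_combination (C r) ^ 2 * hN' + (X - 1) * hrc
  refine ⟨_, _, fun hB => ?_, hsol⟩
  rw [hB] at hsol
  have hdeg := congrArg natDegree hsol
  rw [zero_pow two_ne_zero, mul_zero, sub_zero, natDegree_pow, ← C_1, natDegree_X_sub_C] at hdeg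
  omega

noncomputable section

/-- The quantity `1 + 2 x² + 2 √(x⁴ + x² + t x)`. -/
def stepDenom (t x : ℝ) : ℝ := 1 + 2 * x ^ 2 + 2 * √(x ^ 4 + x ^ 2 + t * x)

/-- The effect on abscissae of two steps of the continued fraction expansion. -/
def twoStep (t x : ℝ) : ℝ :=
  x + t / stepDenom t x
    - t * stepDenom t x ^ 2 / (stepDenom t x * (1 + 4 * t * x) + 4 * t ^ 2)

/-- The orbit of `1 / (4 t)` under `twoStep t`. -/
def orbit (t : ℝ) : ℕ → ℝ
  | 0 => 1 / (4 * t)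
  | k + 1 => twoStep t (orbit t k)

end

theorem five_le_stepDenom {t x : ℝ} (ht : 0 < t) (hx : 1 ≤ x) : 5 ≤ stepDenom t x := by
  have : 1 ≤ √(x ^ 4 + x ^ 2 + t * x) := by
    rw [Real.one_le_sqrt]
    nlinarith [one_le_pow₀ hx (n := 4), one_le_pow₀ hx (n := 2), mul_pos ht (by linarith : 0 < x)]
  unfold stepDenom
  nlinarith

theorem stepDenom_le {t x : ℝ} (ht : 0 < t) (hx : 1 ≤ x) :
    stepDenom t x ≤ 2 + 4 * x ^ 2 + t := by
  have : √(x ^ 4 + x ^ 2 + t * x) ≤ x ^ 2 + 1 / 2 + t / 2 := by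
    rw [Real.sqrt_le_left (by positivity)]
    nlinarith [mul_nonneg ht.le (mul_nonneg (by linarith : 0 ≤ x) (by linarith : 0 ≤ x - 1))]
  unfold stepDenom
  linarith

theorem twoStep_le {t x : ℝ} (ht : 0 < t) (ht' : t ≤ 1 / 8) (hx : 1 ≤ x) (htx : 4 * t * x ≤ 1) :
    twoStep t x ≤ x - t := by
  have hS := five_le_stepDenom ht hx
  unfold twoStep
  set S := stepDenom t x
  have h1 : t / S ≤ t / 5 := by gcongr
  have h2 : t * (6 / 5) ≤ t * S ^ 2 / (S * (1 + 4 * t * x) + 4 * t ^ 2) := by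
    have : 0 < t * x := by positivity
    rw [le_div_iff₀ (by positivity), mul_assoc]
    gcongr
    nlinarith
  linarith

theorem le_twoStep {t x : ℝ} (ht : 0 < t) (ht' : t ≤ 1 / 8) (hx : 1 ≤ x) (htx : 4 * t * x ≤ 1) :
    (x - 1) / 2 ≤ twoStep t x := by
  have hS := five_le_stepDenom ht hx
  have hS' := stepDenom_le ht hx
  unfold twoStep
  set S := stepDenom t x
  have h1 : 0 < t / S := by positivity
  have h0 : 0 < t * x := by positivity
  have h2 : t * S ^ 2 / (S * (1 + 4 * t * x) + 4 * t ^ 2) ≤ t * S / (1 + 4 * t * x) := by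
    rw [div_le_div_iff₀ (by positivity) (by positivity)]
    have : 0 ≤ t * S * (4 * t ^ 2) := by positivity
    nlinarith
  have h3 : t * S / (1 + 4 * t * x) ≤ (x + 1) / 2 := by
    rw [div_le_iff₀ (by positivity)]
    have : t * S ≤ t * (2 + 4 * x ^ 2 + t) := by gcongr
    nlinarith [mul_nonneg (by linarith : 0 ≤ x) (by linarith : 0 ≤ 1 - 4 * t * x)]
  linarith

theorem IsNormPoint.twoStep {t x : ℝ} (ht : 0 < t) (ht' : t ≤ 1 / 8) (hx : 1 ≤ x)
    (htx : 4 * t * x ≤ 1) (h : IsNormPoint t x √(x ^ 4 + x ^ 2 + t * x)) :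
    IsNormPoint t (twoStep t x)
      √(twoStep t x ^ 4 + twoStep t x ^ 2 + t * twoStep t x) := by
  have hS := five_le_stepDenom ht hx
  have hSdef : stepDenom t x = 1 + 2 * x ^ 2 + 2 * √(x ^ 4 + x ^ 2 + t * x) := rfl
  have hy := h.1
  set y := √(x ^ 4 + x ^ 2 + t * x)
  have hE : _root_.twoStep t x = x + t / stepDenom t x
    - t * stepDenom t x ^ 2 / (stepDenom t x * (1 + 4 * t * x) + 4 * t ^ 2) := rfl
  set S := stepDenom t x
  have hS0 : S ≠ 0 := by positivity
  have h0 : 0 < t * x := by positivity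
  have hM : 0 < S * (1 + 4 * t * x) + 4 * t ^ 2 := by positivity
  have h1 := h.step (x' := -(t / S) - x) (by rw [← hSdef]; exact hS0)
    (by rw [← hSdef]; field_simp; ring)
  set x' := -(t / S) - x with hx'
  have hq : S * (1 + 2 * x ^ 2 - 2 * y) = 1 - 4 * t * x := by
    rw [hSdef]; linear_combination (-4) * hy
  have hb : 1 + 2 * x' ^ 2 + 2 * (x' ^ 2 - x ^ 2 - y) =
      (S * (1 + 4 * t * x) + 4 * t ^ 2) / S ^ 2 := by
    rw [hx']; field_simp
    linear_combination S * hq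
  have h2 := h1.step (x' := _root_.twoStep t x) (by rw [hb]; positivity) (by
    rw [hb, hE, hx']; field_simp; ring)
  have hpos : 0 ≤ _root_.twoStep t x ^ 2 - x' ^ 2 - (x' ^ 2 - x ^ 2 - y) := by
    have : (S * (1 + 4 * t * x) + 4 * t ^ 2) / S ^ 2 ≤ 1 := by
      rw [div_le_one (by positivity)]
      nlinarith
    nlinarith [sq_nonneg (_root_.twoStep t x)]
  rw [← h2.1, Real.sqrt_sq hpos]
  exact h2

theorem orbit_le {t : ℝ} (ht : 0 < t) (ht' : t ≤ 1 / 8) {k : ℕ} (h : ∀ j < k, 1 ≤ orbit t j) :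
    orbit t k ≤ 1 / (4 * t) - k * t := by
  induction k with
  | zero => simp [orbit]
  | succ k ih =>
    have ih := ih fun j hj => h j (by omega)
    have h4 : orbit t k ≤ 1 / (4 * t) := ih.trans (by have : 0 ≤ k * t := by positivity
                                                      linarith)
    rw [le_div_iff₀ (by positivity)] at h4
    have := twoStep_le ht ht' (h k (by omega)) (by linarith)
    push_cast
    rw [orbit]
    linarith

theorem four_mul_orbit_le {t : ℝ} (ht : 0 < t) (ht' : t ≤ 1 / 8) {k : ℕ}
    (h : ∀ j < k, 1 ≤ orbit t j) : 4 * t * orbit t k ≤ 1 := by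
  have h4 := orbit_le ht ht' h
  have h5 : orbit t k ≤ 1 / (4 * t) := by
    have : 0 ≤ k * t := by positivity
    linarith
  rw [le_div_iff₀ (by positivity)] at h5
  linarith

theorem le_orbit {t : ℝ} (ht : 0 < t) (ht' : t ≤ 1 / 8) {k : ℕ} (h : ∀ j < k, 1 ≤ orbit t j) :
    (1 / (4 * t) + 1) / 2 ^ k - 1 ≤ orbit t k := by
  induction k with
  | zero => simp [orbit]
  | succ k ih =>
    have ih := ih fun j hj => h j (by omega)
    have := le_twoStep ht ht' (h k (by omega))
      (four_mul_orbit_le ht ht' fun j hj => h j (by omega))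
    rw [orbit, pow_succ, ← div_div]
    linarith

theorem isNormPoint_orbit {t : ℝ} (ht : 0 < t) (ht' : t ≤ 1 / 8) {k : ℕ}
    (h : ∀ j < k, 1 ≤ orbit t j) :
    IsNormPoint t (orbit t k) √(orbit t k ^ 4 + orbit t k ^ 2 + t * orbit t k) := by
  induction k with
  | zero =>
    have := isNormPoint_base ht.ne'
    simp only [orbit]
    rw [← this.1, Real.sqrt_sq (by positivity)]
    exact this
  | succ k ih =>
    exact (ih fun j hj => h j (by omega)).twoStep ht ht' (h k (by omega))
      (four_mul_orbit_le ht ht' fun j hj => h j (by omega))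

theorem continuousOn_orbit {s : Set ℝ} (hs : ∀ t ∈ s, 0 < t) {k : ℕ}
    (h : ∀ t ∈ s, ∀ j < k, 1 ≤ orbit t j) : ContinuousOn (fun t => orbit t k) s := by
  induction k with
  | zero =>
    simp only [orbit]
    exact continuousOn_const.div (by fun_prop) fun t ht => by have := hs t ht; positivity
  | succ k ih =>
    have ih := ih fun t ht j hj => h t ht j (by omega)
    have hS : ContinuousOn (fun t => stepDenom t (orbit t k)) s := by
      unfold stepDenom; fun_prop
    simp only [orbit, twoStep]
    refine (ih.add (continuousOn_id.div hS fun t ht => ?_)).sub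
      (ContinuousOn.div (by fun_prop) (by fun_prop) fun t ht => ?_)
    · have := five_le_stepDenom (hs t ht) (h t ht k (by omega))
      positivity
    · have h0 := hs t ht
      have h1 := h t ht k (by omega)
      have := five_le_stepDenom h0 h1
      positivity

theorem exists_orbit_eq_one {ε : ℝ} (hε : 0 < ε) (hε' : ε ≤ 1 / 8) :
    ∃ t, 0 < t ∧ t ≤ ε ∧ ∃ k, orbit t k = 1 ∧ ∀ j < k, 1 ≤ orbit t j := by
  classical
  have hex : ∃ k, ∃ t, 0 < t ∧ t ≤ ε ∧ orbit t k < 1 := by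
    by_contra! hcon
    obtain ⟨k, hk⟩ := exists_nat_gt (1 / (4 * ε) / ε)
    have h1 := orbit_le hε hε' (k := k) fun j _ => hcon j ε hε le_rfl
    have h2 := hcon k ε hε le_rfl
    rw [div_lt_iff₀ hε] at hk
    linarith
  obtain ⟨t₁, ht₁, ht₁ε, h₁⟩ := Nat.find_spec hex
  have hmin : ∀ t ∈ Set.Ioc 0 ε, ∀ j < Nat.find hex, 1 ≤ orbit t j := fun t ht j hj => by
    by_contra! hlt
    exact Nat.find_min hex hj ⟨t, ht.1, ht.2, hlt⟩
  set k := Nat.find hex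
  set t₂ := min ε (1 / (8 * 2 ^ k)) with ht₂
  have ht₂pos : 0 < t₂ := by positivity
  have h₂ : 1 ≤ orbit t₂ k := by
    refine le_trans ?_ (le_orbit ht₂pos ((min_le_left _ _).trans hε')
      (hmin t₂ ⟨ht₂pos, min_le_left _ _⟩))
    have h3 : t₂ ≤ 1 / (8 * 2 ^ k) := min_le_right _ _
    have h4 : 2 * 2 ^ k ≤ 1 / (4 * t₂) := by
      rw [le_div_iff₀ (by positivity)] at h3 ⊢
      linarith
    rw [le_sub_iff_add_le, le_div_iff₀ (by positivity)]
    linarith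
  have hcont := continuousOn_orbit (fun t (ht : t ∈ Set.Ioc 0 ε) => ht.1) hmin
  obtain ⟨t, ht, hteq⟩ := Set.ordConnected_Ioc.isPreconnected.intermediate_value
    (⟨ht₁, ht₁ε⟩ : t₁ ∈ Set.Ioc 0 ε) (⟨ht₂pos, min_le_left _ _⟩ : t₂ ∈ Set.Ioc 0 ε) hcont
    ⟨h₁.le, h₂⟩
  exact ⟨t, ht.1, ht.2, k, hteq, hmin t ht⟩

/-- The set of complex numbers `t₀` for which there exist
`A, B ∈ ℂ[X]` with `B ≠ 0` satisfying `A² − (X⁴ + X² + t₀·X)·B² = X − 1` is infinite. -/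
theorem infinite_solvable_specializations_genus_one :
    {t₀ : ℂ | ∃ A B : Polynomial ℂ, B ≠ 0 ∧
      A ^ 2 - (X ^ 4 + X ^ 2 + C t₀ * X) * B ^ 2 = X - 1}.Infinite := by
  have hreal : {t : ℝ | 0 < t ∧ ∃ A B : ℂ[X], B ≠ 0 ∧
      A ^ 2 - (X ^ 4 + X ^ 2 + C (t : ℂ) * X) * B ^ 2 = X - 1}.Infinite := by
    intro hfin
    obtain ⟨ε, hε, hlt⟩ : ∃ ε > 0, ∀ t ∈ {t : ℝ | 0 < t ∧ ∃ A B : ℂ[X], B ≠ 0 ∧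
        A ^ 2 - (X ^ 4 + X ^ 2 + C (t : ℂ) * X) * B ^ 2 = X - 1}, ε < t := by
      have := (Filter.eventually_all_finite hfin).2 fun t ht =>
        (eventually_lt_nhds ht.1).filter_mono (nhdsWithin_le_nhds (s := Set.Ioi (0 : ℝ)))
      obtain ⟨ε, h, hε⟩ := (this.and self_mem_nhdsWithin).exists
      exact ⟨ε, hε, h⟩
    obtain ⟨t, ht, htε, k, hk, hj⟩ :=
      exists_orbit_eq_one (lt_min hε (by norm_num : (0 : ℝ) < 1 / 8)) (min_le_right _ _)
    have hP := isNormPoint_orbit ht (htε.trans (min_le_right _ _)) hj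
    rw [hk] at hP
    exact absurd (hlt t ⟨ht, hP.exists_solution⟩) (not_lt.2 (htε.trans (min_le_left _ _)))
  refine (hreal.image Complex.ofReal_injective.injOn).mono ?_
  rintro _ ⟨t, ht, rfl⟩
  exact ht.2
end
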